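/- arXiv:1708.05378 — 6 statements merged into one kernel-verified Lean document; each statement's English description precedes it below -/
import Mathlib

section
/- Let k be an algebraically closed field of characteristic zero and let L = I_d − Σ_{j=1}^g A_j x_j be a monic linear pencil of size d. Then there exists a natural number d_L ≤ d such that for every n ≥ max(d² − 1, 1) the total degree of the polynomial det L(gX^(n)) ∈ k[ξ] equals d_L·n. -/
open Matrix MvPolynomial

noncomputable section

/-- Evaluation of the monic linear pencil `L = I_d - ∑ j, A j * x j` at a `g`-tuple `X` of
`n × n` matrices over a commutative `k`-algebra `R`, via the Kronecker product. -/
def pencilEval {k : Type*} [CommRing k] {g d n : ℕ} {R : Type*} [CommRing R] [Algebra k R]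
    (A : Fin g → Matrix (Fin d) (Fin d) k) (X : Fin g → Matrix (Fin n) (Fin n) R) :
    Matrix (Fin d × Fin n) (Fin d × Fin n) R :=
  1 - ∑ j, Matrix.kroneckerMap (· * ·) ((A j).map fun a => algebraMap k R a) (X j)

/-- The `g`-tuple of `n × n` generic matrices. -/
def genX (k : Type*) [CommRing k] (g n : ℕ) :
    Fin g → Matrix (Fin n) (Fin n) (MvPolynomial (Fin g × Fin n × Fin n) k) :=
  fun j => Matrix.of fun ι κ => MvPolynomial.X (j, ι, κ)

section RankLemmas

variable {F : Type*} [Field F] {m n : Type*} [Fintype n]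

lemma matrix_rank_add_le (A B : Matrix m n F) : (A + B).rank ≤ A.rank + B.rank := by
  classical
  rw [Matrix.rank, Matrix.rank, Matrix.rank, Matrix.mulVecLin_add]
  exact (Submodule.finrank_mono (LinearMap.range_add_le _ _)).trans
    (Submodule.finrank_add_le_finrank_add_finrank _ _)

lemma matrix_rank_eq_zero {A : Matrix m n F} :
    A.rank = 0 ↔ A = 0 := by
  classical
  rw [Matrix.rank, Submodule.finrank_eq_zero, LinearMap.range_eq_bot]
  exact (Matrix.toLin' (R := F)).map_eq_zero_iff

lemma card_le_rank_of_det_submatrix_ne_zero {r : ℕ} (A : Matrix m n F) (f : Fin r → m)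
    (g : Fin r → n) (h : (A.submatrix f g).det ≠ 0) : r ≤ A.rank := by
  have := Matrix.rank_of_det_ne_zero h
  rw [Fintype.card_fin] at this
  exact this ▸ Matrix.rank_submatrix_le A f g

lemma finrank_ker_add_rank (A : Matrix m n F) :
    Module.finrank F (LinearMap.ker A.mulVecLin) + A.rank = Fintype.card n := by
  rw [add_comm, Matrix.rank, LinearMap.finrank_range_add_finrank_ker,
    Module.finrank_fintype_fun_eq_card]

variable [Fintype m]

lemma exists_rows_linearIndependent (A : Matrix m n F) {ρ : ℕ} (hρ : A.rank = ρ) :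
    ∃ r : Fin ρ → m, LinearIndependent F (A.submatrix r id).row := by
  obtain ⟨f, hf, -, hli⟩ := Submodule.exists_fun_fin_finrank_span_eq F (Set.range A.row)
  choose r hr using hf
  rw [A.rank_eq_finrank_span_row] at hρ
  subst hρ
  exact ⟨r, (funext hr : (A.submatrix r id).row = f) ▸ hli⟩

lemma exists_submatrix_det_ne_zero (A : Matrix m n F) :
    ∃ (r : Fin A.rank → m) (c : Fin A.rank → n), (A.submatrix r c).det ≠ 0 := by
  obtain ⟨r, hr⟩ := exists_rows_linearIndependent A rfl
  obtain ⟨c, hc⟩ := exists_rows_linearIndependent (A.submatrix r id)ᵀ (ρ := A.rank) (by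
    rw [Matrix.rank_transpose]
    simpa using hr.rank_matrix)
  refine ⟨r, c, ?_⟩
  rw [← Matrix.det_transpose]
  exact ((Matrix.isUnit_iff_isUnit_det _).1 (Matrix.linearIndependent_rows_iff_isUnit.1 hc)).ne_zero

/-- The rank of a matrix can only drop under specialization. -/
lemma rank_map_le_rank_map {P K : Type*} [CommRing P] [Field K] (φ : P →+* K)
    (hφ : Function.Injective φ) (χ : P →+* F) (A : Matrix m n P) :
    (A.map χ).rank ≤ (A.map φ).rank := by
  obtain ⟨r, c, h⟩ := exists_submatrix_det_ne_zero (A.map χ)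
  refine card_le_rank_of_det_submatrix_ne_zero _ r c fun h0 => h ?_
  rw [Matrix.submatrix_map] at h0 ⊢
  have hA : (A.submatrix r c).det = 0 := hφ (by simpa [RingHom.map_det] using h0)
  simpa [RingHom.map_det, hA] using (χ.map_det (A.submatrix r c)).symm

lemma rank_map_pow_le_rank_map_pow {P K : Type*} [CommRing P] [Field K] [DecidableEq m]
    (φ : P →+* K) (hφ : Function.Injective φ) (χ : P →+* F) (A : Matrix m m P) (N : ℕ) :
    (A.map χ ^ N).rank ≤ (A.map φ ^ N).rank := by
  have h := rank_map_le_rank_map φ hφ χ (A ^ N)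
  have h1 : (A ^ N).map χ = A.map χ ^ N := map_pow χ.mapMatrix A N
  have h2 : (A ^ N).map φ = A.map φ ^ N := map_pow φ.mapMatrix A N
  rwa [h1, h2] at h

end RankLemmas

section Twisted

variable {K : Type*} [Field K] {m : Type*} [Fintype m] [DecidableEq m]

/-- If `T` commutes with the `σ`-semilinear operator `v ↦ Y⁻¹ σ(v)`, whose `n`-th power is the
scalar `z⁻¹`, then `z ^ dim ker T` is, up to inversion, a norm. -/
lemma exists_norm_mul_pow_eq_one {n : ℕ} (σ : K →+* K) (hσ : ∀ x, σ^[n] x = x) (Y : Matrix m m K)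
    (hYσ : Y.map σ = Y) {z : K} (hz : z ≠ 0) (hn : n ≠ 0) (hYn : Y ^ n = z • 1)
    (T : Matrix m m K) (hT : Y * T = T.map σ * Y) :
    ∃ a : K, z ^ Module.finrank K (LinearMap.ker T.mulVecLin) *
      ∏ i ∈ Finset.range n, σ^[i] a = 1 := by
  set w := Module.finrank K (LinearMap.ker T.mulVecLin) with hw
  let b := Module.finBasis K (LinearMap.ker T.mulVecLin)
  let G : Matrix m (Fin w) K := Matrix.of fun i a => (b a : m → K) i
  have hcol : ∀ a, G.col a = (b a : m → K) := fun a => rfl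
  have hTG : T * G = 0 := by
    ext i a
    have : T *ᵥ (b a : m → K) = 0 := (b a).2
    simpa [Matrix.mul_apply, Matrix.mulVec, dotProduct, G] using congrFun this i
  have hspan : ∀ H : Matrix m (Fin w) K, T * H = 0 → ∃ N : Matrix (Fin w) (Fin w) K, H = G * N := by
    intro H hH
    have hk : ∀ a, H.col a ∈ LinearMap.ker T.mulVecLin := fun a => by
      ext i
      simpa [Matrix.mul_apply, Matrix.mulVec, dotProduct] using congrFun (congrFun hH i) a
    refine ⟨Matrix.of fun c a => b.repr ⟨_, hk a⟩ c, ?_⟩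
    ext i a
    have := congrArg (fun v : LinearMap.ker T.mulVecLin => (v : m → K) i) (b.sum_repr ⟨_, hk a⟩)
    simp only [Submodule.coe_sum, Submodule.coe_smul, Finset.sum_apply, Pi.smul_apply,
      smul_eq_mul] at this
    rw [Matrix.mul_apply, ← show H.col a i = H i a from rfl, ← this]
    exact Finset.sum_congr rfl fun c _ => mul_comm _ _
  have hinj : ∀ N : Matrix (Fin w) (Fin w) K, G * N = 0 → N = 0 := by
    intro N hN
    have hli : LinearIndependent K G.col := by
      have := b.linearIndependent.map' (Submodule.subtype _) (Submodule.ker_subtype _)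
      exact this
    have := Matrix.mulVec_injective_iff.2 hli
    ext c a
    have h0 : G *ᵥ N.col a = G *ᵥ 0 := by
      rw [Matrix.mulVec_zero]
      ext i
      simpa [Matrix.mul_apply, Matrix.mulVec, dotProduct] using congrFun (congrFun hN i) a
    exact congrFun (this h0) c
  obtain ⟨l, rfl⟩ := Nat.exists_eq_succ_of_ne_zero hn
  have hY1 : Y * (z⁻¹ • Y ^ l) = 1 := by
    rw [Matrix.mul_smul, ← pow_succ', hYn, smul_smul, inv_mul_cancel₀ hz, one_smul]
  have hY2 : (z⁻¹ • Y ^ l) * Y = 1 := by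
    rw [Matrix.smul_mul, ← pow_succ, hYn, smul_smul, inv_mul_cancel₀ hz, one_smul]
  set Z := z⁻¹ • Y ^ l
  obtain ⟨N, hN⟩ := hspan (Z * G.map σ) (by
    have h : T * Z = Z * T.map σ := by
      calc T * Z = (Z * Y) * T * Z := by rw [hY2, one_mul]
        _ = Z * (Y * T) * Z := by simp only [Matrix.mul_assoc]
        _ = Z * T.map σ * (Y * Z) := by rw [hT]; simp only [Matrix.mul_assoc]
        _ = _ := by rw [hY1, mul_one]
    rw [← Matrix.mul_assoc, h, Matrix.mul_assoc, ← Matrix.map_mul, hTG]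
    simp)
  have hG : G.map σ = Y * (G * N) := by
    rw [← hN, ← Matrix.mul_assoc, hY1, Matrix.one_mul]
  have key : ∀ i : ℕ, ∃ Q : Matrix (Fin w) (Fin w) K, G.map σ^[i] = Y ^ i * (G * Q) ∧
      Q.det = ∏ j ∈ Finset.range i, σ^[j] N.det := by
    intro i
    induction i with
    | zero => exact ⟨1, by simp, by simp⟩
    | succ i ih =>
      obtain ⟨Q, hQ, hd⟩ := ih
      refine ⟨N * Q.map σ, ?_, ?_⟩
      · have : G.map σ^[i + 1] = (G.map σ^[i]).map σ := by
          ext; simp only [Matrix.map_apply, Function.iterate_succ_apply']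
        have hYi : (Y ^ i).map σ = Y ^ i := by
          have := map_pow σ.mapMatrix Y i
          simpa [RingHom.mapMatrix_apply, hYσ] using this
        rw [this, hQ, Matrix.map_mul, Matrix.map_mul, hYi, hG, pow_succ]
        simp only [Matrix.mul_assoc]
      · have : (Q.map σ).det = σ Q.det := (σ.map_det Q).symm
        rw [Matrix.det_mul, this, hd, Finset.prod_range_succ', map_prod, mul_comm]
        simp [Function.iterate_succ_apply']
  obtain ⟨Q, hQ, hd⟩ := key (l + 1)
  have h1 : G.map σ^[l + 1] = G := by ext; simp [hσ, -Function.iterate_succ]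
  rw [h1, hYn, Matrix.smul_mul, Matrix.one_mul] at hQ
  have h2 : 1 - z • Q = 0 := hinj _ (by
    rw [Matrix.mul_sub, Matrix.mul_one, Matrix.mul_smul, ← hQ, sub_self])
  refine ⟨N.det, ?_⟩
  have h3 := Matrix.det_smul Q z
  rwa [← sub_eq_zero.1 h2, Matrix.det_one, Fintype.card_fin, hd, eq_comm] at h3

end Twisted

section Chain

variable {K : Type*} [Field K] {m : Type*} [Fintype m] [DecidableEq m]

lemma rank_pow_anti (T : Matrix m m K) {a b : ℕ} (h : a ≤ b) : (T ^ b).rank ≤ (T ^ a).rank := by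
  obtain ⟨c, rfl⟩ := Nat.exists_eq_add_of_le h
  rw [pow_add]
  exact Matrix.rank_mul_le_left _ _

lemma rank_pow_eq_of_stable (T : Matrix m m K) {a b : ℕ} (h : (T ^ (a + 1)).rank = (T ^ a).rank)
    (hab : a ≤ b) : (T ^ b).rank = (T ^ a).rank := by
  have hk : ∀ i, Module.finrank K (LinearMap.ker (toLin' T ^ i)) + (T ^ i).rank =
      Fintype.card m := fun i => by
    rw [← Matrix.toLin'_pow]
    exact finrank_ker_add_rank (T ^ i)
  have hle : LinearMap.ker (toLin' T ^ a) ≤ LinearMap.ker (toLin' T ^ a.succ) := by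
    rw [pow_succ']
    exact LinearMap.ker_le_ker_comp _ _
  have heq : LinearMap.ker (toLin' T ^ a) = LinearMap.ker (toLin' T ^ a.succ) :=
    Submodule.eq_of_le_of_finrank_eq hle (by
      have h1 := hk a
      have h2 := hk (a + 1)
      rw [Nat.succ_eq_add_one]
      omega)
  obtain ⟨c, rfl⟩ := Nat.exists_eq_add_of_le hab
  have h1 := hk a
  have h2 := hk (a + c)
  rw [← Module.End.ker_pow_constant heq c] at h2
  omega

/-- If the ranks of all powers of `T` are multiples of `n`, they stabilize in steps of size `n`. -/
lemma rank_pow_le_of_dvd {n : ℕ} (T : Matrix m m K) (hT : ∀ a, n ∣ (T ^ a).rank) {N : ℕ}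
    (h : Fintype.card m < (T ^ N).rank + n * N) (b : ℕ) : (T ^ N).rank ≤ (T ^ b).rank := by
  have hstab : ∃ a < N, (T ^ (a + 1)).rank = (T ^ a).rank := by
    by_contra! hne
    have : ∀ a ≤ N, (T ^ a).rank + n * a ≤ Fintype.card m := by
      intro a ha
      induction a with
      | zero => simp [Matrix.rank_one]
      | succ a ih =>
        have h1 := ih (by omega)
        have h2 := lt_of_le_of_ne (rank_pow_anti T (Nat.le_add_right a 1)) (hne a (by omega))
        have h3 : n ≤ (T ^ a).rank - (T ^ (a + 1)).rank :=
          Nat.le_of_dvd (by omega)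
            (Nat.dvd_sub (hT _) (hT _))
        rw [mul_add]
        omega
    have := this N le_rfl
    omega
  obtain ⟨a, haN, ha⟩ := hstab
  rcases le_total b N with hb | hb
  · exact rank_pow_anti T hb
  · rw [rank_pow_eq_of_stable T ha haN.le, rank_pow_eq_of_stable T ha (haN.le.trans hb)]

end Chain

section Compression

variable {K : Type*} [Field K] {m p : Type*} [Fintype m] [DecidableEq m] [Fintype p] [DecidableEq p]

lemma mul_pow_mul_comm (E : Matrix m p K) (F : Matrix p m K) (M : Matrix m m K) (N : ℕ) :
    E * (F * M * E) ^ N * F = E * F * (M * (E * F)) ^ N := by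
  induction N with
  | zero => simp
  | succ N ih =>
    rw [pow_succ, pow_succ, ← Matrix.mul_assoc (E * F), ← ih]
    simp only [Matrix.mul_assoc]

lemma rank_pow_le_rank_compression_pow (E : Matrix m p K) (F : Matrix p m K) (M : Matrix m m K)
    {d : ℕ} (hd : (1 - E * F).rank ≤ d) (N : ℕ) :
    (M ^ N).rank ≤ ((F * M * E) ^ N).rank + (N + 1) * d := by
  have hins : ∀ P Q : Matrix m m K, (P * Q).rank ≤ (P * (E * F) * Q).rank + d := fun P Q => by
    have : P * Q = P * (E * F) * Q + P * (1 - E * F) * Q := by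
      rw [← Matrix.add_mul, ← Matrix.mul_add, add_sub_cancel, Matrix.mul_one]
    calc (P * Q).rank ≤ (P * (E * F) * Q).rank + (P * (1 - E * F) * Q).rank := by
          conv_lhs => rw [this]
          exact matrix_rank_add_le _ _
      _ ≤ _ := by
          gcongr
          exact ((Matrix.rank_mul_le_left _ _).trans (Matrix.rank_mul_le_right _ _)).trans hd
  have key : ∀ N (P : Matrix m m K), (P * M ^ N).rank ≤ (P * (M * (E * F)) ^ N).rank + N * d := by
    intro N
    induction N with
    | zero => simp
    | succ N ih =>
      intro P
      have h1 := ih (P * M)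
      have h2 := hins (P * M) ((M * (E * F)) ^ N)
      rw [pow_succ' M, pow_succ' (M * (E * F)), ← Matrix.mul_assoc, ← Matrix.mul_assoc,
        ← Matrix.mul_assoc P M, add_mul]
      omega
  have h1 := hins 1 (M ^ N)
  have h2 := key N (E * F)
  rw [Matrix.one_mul, Matrix.one_mul] at h1
  rw [← mul_pow_mul_comm] at h2
  have h3 := (Matrix.rank_mul_le_left (E * (F * M * E) ^ N) F).trans (Matrix.rank_mul_le_right _ _)
  rw [add_mul]
  omega

lemma rank_pow_le_rank_dilation_pow (E : Matrix m p K) (F : Matrix p m K) (hFE : F * E = 1)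
    (M : Matrix p p K) (N : ℕ) : (M ^ N).rank ≤ ((E * M * F) ^ N).rank := by
  have key : F * (E * M * F) ^ N * E = M ^ N := by
    induction N with
    | zero => simp [hFE]
    | succ N ih =>
      rw [pow_succ, pow_succ, ← ih]
      calc F * ((E * M * F) ^ N * (E * M * F)) * E = F * (E * M * F) ^ N * E * M * (F * E) := by
            simp only [Matrix.mul_assoc]
        _ = _ := by rw [hFE, Matrix.mul_one]
  rw [← key]
  exact (Matrix.rank_mul_le_left _ _).trans (Matrix.rank_mul_le_right _ _)

end Compression

section CyclicAlgebra

/-- The companion matrix of `T ^ (l + 1) - z`: a cyclic shift whose wrap-around entry is `z`. -/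
def twistedShift {R : Type*} [CommRing R] (l : ℕ) (z : R) : Matrix (Fin (l + 1)) (Fin (l + 1)) R :=
  Matrix.of fun i κ => if κ = i + 1 then if i + 1 = 0 then z else 1 else 0

lemma twistedShift_pow_apply {R : Type*} [CommRing R] (l : ℕ) (z : R) (b : ℕ)
    (i κ : Fin (l + 1)) : (twistedShift l z ^ b) i κ =
      if κ = Fin.ofNat (l + 1) (i + b) then z ^ ((i + b) / (l + 1)) else 0 := by
  induction b generalizing κ with
  | zero => simp [Matrix.one_apply, eq_comm, Nat.div_eq_of_lt i.2]
  | succ b ih =>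
    rw [pow_succ, Matrix.mul_apply]
    simp only [ih, ite_mul, zero_mul, Finset.sum_ite_eq', Finset.mem_univ,
      if_true]
    have hc : Fin.ofNat (l + 1) (i + b) + 1 = Fin.ofNat (l + 1) (i + (b + 1)) := by
      rw [Fin.ext_iff, Fin.val_add, Fin.val_ofNat, Fin.val_ofNat, Fin.val_one', ← Nat.add_mod,
        add_assoc]
    have h0 : Fin.ofNat (l + 1) (i + (b + 1)) = 0 ↔ l + 1 ∣ i + (b + 1) := by
      rw [Fin.ext_iff, Fin.val_ofNat, Nat.dvd_iff_mod_eq_zero, Fin.val_zero]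
    simp only [twistedShift, Matrix.of_apply, hc, h0]
    rw [← add_assoc, Nat.succ_div]
    split_ifs <;> simp [pow_succ]

lemma twistedShift_pow {R : Type*} [CommRing R] (l : ℕ) (z : R) :
    twistedShift l z ^ (l + 1) = z • (1 : Matrix (Fin (l + 1)) (Fin (l + 1)) R) := by
  ext i κ
  have hi : Fin.ofNat (l + 1) (i + (l + 1)) = i := by
    rw [Fin.ext_iff, Fin.val_ofNat, Nat.add_mod_right, Nat.mod_eq_of_lt i.2]
  rw [twistedShift_pow_apply, hi, Nat.add_div_right _ l.succ_pos, Nat.div_eq_of_lt i.2]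
  simp [Matrix.one_apply, eq_comm]

variable (k : Type*) [Field k] (g l : ℕ)

/-- Polynomials in the entries of the generic matrices and one further variable. -/
abbrev TwistRing : Type _ := Polynomial (MvPolynomial (Fin g × Fin (l + 1) × Fin (l + 1)) k)

/-- The field of fractions of `TwistRing`, which contains the entries of the twisted generic
matrices. -/
abbrev TwistField : Type _ := FractionRing (TwistRing k g l)

/-- The simultaneous cyclic shift of row and column indices. -/
def shiftIdx : Fin g × Fin (l + 1) × Fin (l + 1) → Fin g × Fin (l + 1) × Fin (l + 1) :=
  fun v => (v.1, v.2.1 + 1, v.2.2 + 1)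

lemma shiftIdx_injective : Function.Injective (shiftIdx g l) := by
  rintro ⟨a, b, c⟩ ⟨a', b', c'⟩ h
  simpa [shiftIdx] using h

lemma shiftIdx_iterate : (shiftIdx g l)^[l + 1] = id := by
  have : ∀ (b : ℕ) v, (shiftIdx g l)^[b] v = (v.1, v.2.1 + Fin.ofNat (l + 1) b,
      v.2.2 + Fin.ofNat (l + 1) b) := by
    intro b v
    induction b with
    | zero => simp
    | succ b ih =>
      have hb : Fin.ofNat (l + 1) b + 1 = Fin.ofNat (l + 1) (b + 1) := by
        rw [Fin.ext_iff, Fin.val_add, Fin.val_ofNat, Fin.val_ofNat, Fin.val_one', ← Nat.add_mod]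
      rw [Function.iterate_succ_apply', ih]
      simp only [shiftIdx, add_assoc, hb]
  funext v
  have h0 : Fin.ofNat (l + 1) (l + 1) = 0 := by simp
  rw [this, h0, add_zero, add_zero, id]

/-- The shift of indices on polynomials. -/
def shiftPoly : TwistRing k g l →+*
    TwistRing k g l :=
  Polynomial.mapRingHom (rename (shiftIdx g l)).toRingHom

lemma shiftPoly_injective : Function.Injective (shiftPoly k g l) :=
  Polynomial.map_injective _ (rename_injective _ (shiftIdx_injective g l))

lemma natDegree_shiftPoly_iterate (i : ℕ)
    (p : TwistRing k g l) :
    ((shiftPoly k g l)^[i] p).natDegree = p.natDegree := by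
  induction i with
  | zero => rfl
  | succ i ih =>
    rw [Function.iterate_succ_apply', ← ih]
    exact Polynomial.natDegree_map_eq_of_injective (rename_injective _ (shiftIdx_injective g l)) _

lemma shiftPoly_iterate (p : TwistRing k g l) :
    (shiftPoly k g l)^[l + 1] p = p := by
  have : ∀ i : ℕ, (shiftPoly k g l)^[i] p =
      Polynomial.map (rename ((shiftIdx g l)^[i]) : _ →ₐ[k] _).toRingHom p := by
    intro i
    induction i with
    | zero => ext1 n; simp
    | succ i ih =>
      rw [Function.iterate_succ_apply', ih, Function.iterate_succ']
      ext1 n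
      simp [shiftPoly, rename_rename]
  rw [this, shiftIdx_iterate]
  ext1 n
  simp

/-- The automorphism of order `l + 1` of the twist field. -/
def twist : TwistField k g l →+* TwistField k g l :=
  IsFractionRing.map (shiftPoly_injective k g l)

lemma twist_algebraMap (p : TwistRing k g l) :
    twist k g l (algebraMap (TwistRing k g l) (TwistField k g l) p) =
      algebraMap (TwistRing k g l) (TwistField k g l) (shiftPoly k g l p) :=
  IsLocalization.map_eq (nonZeroDivisors_le_comap_nonZeroDivisors_of_injective _
    (shiftPoly_injective k g l)) p

lemma twist_iterate_algebraMap (i : ℕ)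
    (p : TwistRing k g l) :
    (twist k g l)^[i] (algebraMap (TwistRing k g l) (TwistField k g l) p) =
      algebraMap (TwistRing k g l) (TwistField k g l) ((shiftPoly k g l)^[i] p) := by
  induction i with
  | zero => rfl
  | succ i ih => rw [Function.iterate_succ_apply', ih, twist_algebraMap,
      Function.iterate_succ_apply']

lemma twist_iterate_div (i : ℕ) (x y : TwistField k g l) :
    (twist k g l)^[i] (x / y) = (twist k g l)^[i] x / (twist k g l)^[i] y := by
  induction i with
  | zero => rfl
  | succ i ih => simp only [Function.iterate_succ_apply', ih, map_div₀]

lemma twist_iterate (x : TwistField k g l) : (twist k g l)^[l + 1] x = x := by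
  obtain ⟨p, q, hq, rfl⟩ := IsFractionRing.div_surjective
    (A := TwistRing k g l) x
  rw [twist_iterate_div, twist_iterate_algebraMap, twist_iterate_algebraMap, shiftPoly_iterate,
    shiftPoly_iterate]

lemma twist_algebraMap_base (a : k) :
    twist k g l (algebraMap k (TwistField k g l) a) = algebraMap k (TwistField k g l) a := by
  rw [IsScalarTower.algebraMap_apply k
    (TwistRing k g l), twist_algebraMap]
  congr 1
  simp [shiftPoly, Polynomial.algebraMap_apply, MvPolynomial.algebraMap_eq]

/-- The central variable of the twist field. -/
def twistVar : TwistField k g l := algebraMap (TwistRing k g l) (TwistField k g l) Polynomial.X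

lemma twistVar_ne_zero : twistVar k g l ≠ 0 := by
  simp [twistVar]

lemma twist_twistVar : twist k g l (twistVar k g l) = twistVar k g l := by
  simp [twistVar, twist_algebraMap, shiftPoly]

lemma dvd_of_norm_mul_pow_eq_one {w : ℕ} {a : TwistField k g l}
    (h : twistVar k g l ^ w * ∏ i ∈ Finset.range (l + 1), (twist k g l)^[i] a = 1) :
    l + 1 ∣ w := by
  obtain ⟨p, q, hq, rfl⟩ := IsFractionRing.div_surjective
    (A := TwistRing k g l) a
  have hq0 : q ≠ 0 := nonZeroDivisors.ne_zero hq
  have hs : ∀ (i : ℕ) {r}, r ≠ 0 → (shiftPoly k g l)^[i] r ≠ 0 := fun i r hr h0 =>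
    hr ((shiftPoly_injective k g l).iterate i (by rw [h0, iterate_map_zero]))
  have hp0 : p ≠ 0 := by
    rintro rfl
    rw [Finset.prod_eq_zero (Finset.mem_range.2 l.succ_pos) (by simp), mul_zero] at h
    exact zero_ne_one h
  simp only [twist_iterate_div, twist_iterate_algebraMap, Finset.prod_div_distrib, twistVar,
    ← map_prod, ← map_pow] at h
  have hQ : ∏ i ∈ Finset.range (l + 1), (shiftPoly k g l)^[i] q ≠ 0 :=
    Finset.prod_ne_zero_iff.2 fun i _ => hs i hq0
  have hP : ∏ i ∈ Finset.range (l + 1), (shiftPoly k g l)^[i] p ≠ 0 :=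
    Finset.prod_ne_zero_iff.2 fun i _ => hs i hp0
  have hinj := IsFractionRing.injective (TwistRing k g l) (TwistField k g l)
  rw [← mul_div_assoc, div_eq_one_iff_eq ((map_ne_zero_iff _ hinj).2 hQ), ← map_mul] at h
  have h' := congrArg Polynomial.natDegree (hinj h)
  rw [Polynomial.natDegree_mul (pow_ne_zero _ Polynomial.X_ne_zero) hP,
    Polynomial.natDegree_prod _ _ fun i _ => hs i hp0,
    Polynomial.natDegree_prod _ _ fun i _ => hs i hq0] at h'
  simp only [Polynomial.natDegree_X_pow, natDegree_shiftPoly_iterate, Finset.sum_const,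
    Finset.card_range, smul_eq_mul] at h'
  exact (Nat.dvd_add_left (dvd_mul_right _ _)).1 (h' ▸ dvd_mul_right _ _)

/-- Scaling the generic entries below the diagonal by a new variable. -/
def twistEval₀ : MvPolynomial (Fin g × Fin (l + 1) × Fin (l + 1)) k →ₐ[k]
    TwistRing k g l :=
  aeval fun v => Polynomial.C (X v) * if v.2.2 < v.2.1 then Polynomial.X else 1

/-- The substitution of the twisted generic matrices for the generic matrices. -/
def twistEval : MvPolynomial (Fin g × Fin (l + 1) × Fin (l + 1)) k →ₐ[k] TwistField k g l :=
  (IsScalarTower.toAlgHom k _ _).comp (twistEval₀ k g l)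

lemma twistEval_injective : Function.Injective (twistEval k g l) := by
  refine (IsFractionRing.injective (TwistRing k g l) (TwistField k g l)).comp
    (Function.LeftInverse.injective (g := Polynomial.eval 1) fun p => ?_)
  have : ((Polynomial.evalRingHom 1).comp (twistEval₀ k g l).toRingHom) = RingHom.id _ := by
    refine MvPolynomial.ringHom_ext (fun a => ?_) fun v => ?_
    · simp [twistEval₀, Polynomial.algebraMap_apply, MvPolynomial.algebraMap_eq]
    · simp only [twistEval₀, AlgHom.toRingHom_eq_coe, RingHom.comp_apply, RingHom.coe_coe, aeval_X,
        Polynomial.coe_evalRingHom, RingHom.id_apply]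
      split_ifs <;> simp
  exact congrArg (fun f : _ →+* _ => f p) this

/-- The generic matrices, twisted so as to lie in a cyclic division algebra. -/
def twistX : Fin g → Matrix (Fin (l + 1)) (Fin (l + 1)) (TwistField k g l) :=
  fun j => (genX k g (l + 1) j).map (twistEval k g l)

lemma twistX_apply (j : Fin g) (i κ : Fin (l + 1)) : twistX k g l j i κ =
    algebraMap (TwistRing k g l) (TwistField k g l)
      (Polynomial.C (X (j, i, κ)) * if κ < i then Polynomial.X else 1) := by
  simp [twistX, genX, twistEval, twistEval₀]

lemma twistedShift_mul_twistX (j : Fin g) :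
    twistedShift l (twistVar k g l) * twistX k g l j =
      (twistX k g l j).map (twist k g l) * twistedShift l (twistVar k g l) := by
  ext i κ'
  obtain ⟨κ, rfl⟩ : ∃ κ, κ' = κ + 1 := ⟨κ' - 1, (sub_add_cancel _ _).symm⟩
  rw [Matrix.mul_apply, Matrix.mul_apply]
  simp only [twistedShift, Matrix.of_apply, ite_mul, zero_mul, Finset.sum_ite_eq,
    Finset.sum_ite_eq', Finset.mem_univ, if_true, mul_ite, mul_zero, add_left_inj,
    Matrix.map_apply, twistX_apply, twist_algebraMap, one_mul, mul_one]
  have hX : ∀ q, shiftPoly k g l (Polynomial.C (X (j, i, κ)) * q) =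
      Polynomial.C (X (j, i + 1, κ + 1)) * shiftPoly k g l q := fun q => by
    simp [shiftPoly, shiftIdx]
  have h1 : shiftPoly k g l Polynomial.X = Polynomial.X := by simp [shiftPoly]
  have hC : shiftPoly k g l (Polynomial.C (X (j, i, κ))) = Polynomial.C (X (j, i + 1, κ + 1)) := by
    simp [shiftPoly, shiftIdx]
  simp only [hX, hC, apply_ite (shiftPoly k g l), h1, twistVar]
  have hlast : ∀ a : Fin (l + 1), a + 1 = 0 ↔ a = Fin.last l := fun a => by
    rw [Fin.ext_iff, Fin.val_add_one]; split_ifs with h <;> simp [h]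
  simp only [hlast, Fin.lt_def, Fin.val_add_one]
  have hval : ∀ a : Fin (l + 1), a ≠ Fin.last l → (a : ℕ) < l := fun a ha =>
    Fin.val_lt_last ha
  by_cases hi : i = Fin.last l <;> by_cases hκ : κ = Fin.last l
  · simp [hi, hκ]
    exact mul_comm _ _
  · simp [hi, hκ, hval κ hκ]
    exact mul_comm _ _
  · simp [hi, hκ, (hval i hi).le]
  · simp [hi, hκ]

end CyclicAlgebra

section Pencil

open scoped Kronecker

variable {k : Type*} [Field k] {g d : ℕ} (A : Fin g → Matrix (Fin d) (Fin d) k)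

/-- The homogeneous linear part of a monic linear pencil, evaluated at a tuple of matrices. -/
def pencilLin {R : Type*} [CommRing R] [Algebra k R] {n : Type*} (X : Fin g → Matrix n n R) :
    Matrix (Fin d × n) (Fin d × n) R :=
  ∑ j, (A j).map (algebraMap k R) ⊗ₖ X j

lemma pencilEval_eq_one_sub {R : Type*} [CommRing R] [Algebra k R] {n : ℕ}
    (X : Fin g → Matrix (Fin n) (Fin n) R) : pencilEval A X = 1 - pencilLin A X := rfl

lemma pencilLin_map {R S : Type*} [CommRing R] [Algebra k R] [CommRing S] [Algebra k S]
    {n : Type*} (φ : R →ₐ[k] S) (X : Fin g → Matrix n n R) :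
    pencilLin A (fun j => (X j).map φ) = (pencilLin A X).map φ := by
  ext ⟨a, i⟩ ⟨b, j⟩
  simp [pencilLin, Matrix.sum_apply]

lemma pencilLin_mul_mul {R : Type*} [CommRing R] [Algebra k R] {n p : Type*} [Fintype n]
    (X : Fin g → Matrix n n R) (F : Matrix p n R) (E : Matrix n p R) :
    ((1 : Matrix (Fin d) (Fin d) R) ⊗ₖ F) * pencilLin A X * ((1 : Matrix (Fin d) (Fin d) R) ⊗ₖ E) =
      pencilLin A fun j => F * X j * E := by
  simp only [pencilLin, Matrix.mul_sum, Matrix.sum_mul,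
    ← mul_kronecker_mul, Matrix.one_mul, Matrix.mul_one]

/-- The linear part of the pencil at the twisted generic matrices of size `l + 1`. -/
def twistPencil (l : ℕ) :
    Matrix (Fin d × Fin (l + 1)) (Fin d × Fin (l + 1)) (TwistField k g l) :=
  pencilLin A (twistX k g l)

lemma kronecker_twistedShift_mul_twistPencil (l : ℕ) :
    ((1 : Matrix (Fin d) (Fin d) _) ⊗ₖ twistedShift l (twistVar k g l)) * twistPencil A l =
      (twistPencil A l).map (twist k g l) *
        ((1 : Matrix (Fin d) (Fin d) _) ⊗ₖ twistedShift l (twistVar k g l)) := by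
  have hmap : (twistPencil A l).map (twist k g l) =
      pencilLin A fun j => (twistX k g l j).map (twist k g l) := by
    ext ⟨a, i⟩ ⟨b, j⟩
    simp [twistPencil, pencilLin, Matrix.sum_apply, twist_algebraMap_base]
  rw [hmap]
  simp only [twistPencil, pencilLin, Matrix.mul_sum, Matrix.sum_mul, ← mul_kronecker_mul,
    Matrix.one_mul, Matrix.mul_one, twistedShift_mul_twistX]

/-- The twisted generic matrices generate a division algebra, so ranks over it are multiples of
its degree. -/
lemma dvd_rank_twistPencil_pow (l a : ℕ) : l + 1 ∣ (twistPencil A l ^ a).rank := by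
  set Y := (1 : Matrix (Fin d) (Fin d) _) ⊗ₖ twistedShift l (twistVar k g l) with hY
  have hYσ : Y.map (twist k g l) = Y := by
    ext ⟨a, i⟩ ⟨b, j⟩
    simp only [hY, Matrix.map_apply, kroneckerMap_apply, twistedShift, Matrix.of_apply,
      Matrix.one_apply, map_mul, apply_ite (twist k g l), map_one, map_zero, twist_twistVar]
  have hYn : Y ^ (l + 1) = twistVar k g l • 1 := by
    have : ∀ b : ℕ, Y ^ b = (1 : Matrix (Fin d) (Fin d) _) ⊗ₖ
        (twistedShift l (twistVar k g l) ^ b) := by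
      intro b
      induction b with
      | zero => simp
      | succ b ih => rw [pow_succ, ih, hY, ← mul_kronecker_mul, Matrix.one_mul, pow_succ]
    rw [this, twistedShift_pow, kronecker_smul, one_kronecker_one]
  have hT : Y * twistPencil A l ^ a = (twistPencil A l ^ a).map (twist k g l) * Y := by
    induction a with
    | zero => simp
    | succ a ih =>
      rw [pow_succ, Matrix.map_mul, ← Matrix.mul_assoc, ih, Matrix.mul_assoc,
        kronecker_twistedShift_mul_twistPencil, Matrix.mul_assoc]
  obtain ⟨x, hx⟩ := exists_norm_mul_pow_eq_one (twist k g l) (twist_iterate k g l) Y hYσ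
    (twistVar_ne_zero k g l) l.succ_ne_zero hYn _ hT
  refine (Nat.dvd_add_right (dvd_of_norm_mul_pow_eq_one k g l hx)).1 ?_
  rw [finrank_ker_add_rank, Fintype.card_prod, Fintype.card_fin, Fintype.card_fin]
  exact dvd_mul_left _ _

lemma pencilLin_eq_map_genX {R : Type*} [CommRing R] [Algebra k R] {n : ℕ}
    (X : Fin g → Matrix (Fin n) (Fin n) R) : pencilLin A X =
      (pencilLin A (genX k g n)).map (aeval fun v => X v.1 v.2.1 v.2.2) := by
  rw [← pencilLin_map]
  congr 1
  ext j a b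
  simp [genX]

lemma twistPencil_eq_map (l : ℕ) :
    twistPencil A l = (pencilLin A (genX k g (l + 1))).map (twistEval k g l) :=
  pencilLin_map A (twistEval k g l) (genX k g (l + 1))

lemma rank_pencilLin_pow_le {F : Type*} [Field F] [Algebra k F] {l : ℕ}
    (X : Fin g → Matrix (Fin (l + 1)) (Fin (l + 1)) F) (N : ℕ) :
    (pencilLin A X ^ N).rank ≤ (twistPencil A l ^ N).rank := by
  rw [pencilLin_eq_map_genX, twistPencil_eq_map]
  have h := rank_map_pow_le_rank_map_pow (twistEval k g l).toRingHom (twistEval_injective k g l)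
    (aeval (R := k) fun v => X v.1 v.2.1 v.2.2).toRingHom (pencilLin A (genX k g (l + 1))) N
  simp only [AlgHom.toRingHom_eq_coe, RingHom.coe_coe] at h
  exact h

/-- The inclusion of the first `n` coordinates. -/
def inclMatrix (R : Type*) [CommRing R] (n : ℕ) : Matrix (Fin (n + 1)) (Fin n) R :=
  Matrix.of fun i j => if i = j.castSucc then 1 else 0

lemma transpose_inclMatrix_mul (R : Type*) [CommRing R] (n : ℕ) :
    (inclMatrix R n)ᵀ * inclMatrix R n = 1 := by
  ext i j
  simp [Matrix.mul_apply, inclMatrix, Matrix.one_apply, eq_comm]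

lemma one_sub_inclMatrix_mul_transpose (R : Type*) [CommRing R] (n : ℕ) :
    1 - inclMatrix R n * (inclMatrix R n)ᵀ = Matrix.single (Fin.last n) (Fin.last n) 1 := by
  ext i j
  induction i using Fin.lastCases <;> induction j using Fin.lastCases <;>
    simp [Matrix.mul_apply, inclMatrix, Matrix.one_apply, (Fin.castSucc_ne_last _).symm,
      eq_comm (a := Fin.castSucc _) (b := Fin.last n)]

lemma rank_one_kronecker_single_le {K n : Type*} [Field K] [Fintype n] [DecidableEq n] (i : n) :
    ((1 : Matrix (Fin d) (Fin d) K) ⊗ₖ Matrix.single i i (1 : K)).rank ≤ d := by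
  have : Matrix.single i i (1 : K) =
      (Matrix.single i () 1 : Matrix n Unit K) * (Matrix.single () i 1 : Matrix Unit n K) := by simp
  rw [this, ← Matrix.one_mul (1 : Matrix (Fin d) (Fin d) K), mul_kronecker_mul]
  refine (Matrix.rank_mul_le_left _ _).trans ((Matrix.rank_le_card_width _).trans ?_)
  simp

lemma rank_twistPencil_pow_le_succ (l N : ℕ) :
    (twistPencil A l ^ N).rank ≤ (twistPencil A (l + 1) ^ N).rank := by
  refine le_trans ?_ (rank_pencilLin_pow_le A (fun j => inclMatrix (TwistField k g l) (l + 1) *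
    twistX k g l j * (inclMatrix (TwistField k g l) (l + 1))ᵀ) N)
  rw [← pencilLin_mul_mul]
  refine rank_pow_le_rank_dilation_pow _ _ ?_ _ _
  rw [← mul_kronecker_mul, transpose_inclMatrix_mul, Matrix.one_mul, one_kronecker_one]

lemma rank_twistPencil_succ_pow_le (l N : ℕ) :
    (twistPencil A (l + 1) ^ N).rank ≤ (twistPencil A l ^ N).rank + (N + 1) * d := by
  refine (rank_pow_le_rank_compression_pow
    ((1 : Matrix (Fin d) (Fin d) (TwistField k g (l + 1))) ⊗ₖ inclMatrix _ (l + 1))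
    ((1 : Matrix (Fin d) (Fin d) (TwistField k g (l + 1))) ⊗ₖ (inclMatrix _ (l + 1))ᵀ) _
    (d := d) ?_ N).trans (Nat.add_le_add_right ?_ _)
  · rw [← mul_kronecker_mul, ← one_kronecker_one, Matrix.one_mul, sub_eq_add_neg,
      ← neg_one_smul (TwistField k g (l + 1)), ← kronecker_smul, ← kronecker_add, neg_one_smul,
      ← sub_eq_add_neg, one_sub_inclMatrix_mul_transpose]
    exact rank_one_kronecker_single_le _
  · rw [twistPencil, pencilLin_mul_mul]
    exact rank_pencilLin_pow_le A _ N

end Pencil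

section Degree

/-- Replacing every variable `x` by `t * x`, which grades polynomials by total degree. -/
def gradingHom (σ k : Type*) [CommRing k] :
    MvPolynomial σ k →ₐ[k] Polynomial (MvPolynomial σ k) :=
  aeval fun v => Polynomial.C (X v) * Polynomial.X

lemma coeff_gradingHom {σ k : Type*} [CommRing k] (p : MvPolynomial σ k) (m : ℕ) :
    (gradingHom σ k p).coeff m = homogeneousComponent m p := by
  classical
  induction p using MvPolynomial.induction_on' with
  | add p q hp hq => rw [map_add, Polynomial.coeff_add, hp, hq, map_add]
  | monomial s a =>
    have : gradingHom σ k (monomial s a) =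
        Polynomial.C (monomial s a) * Polynomial.X ^ s.degree := by
      have h : ∏ i ∈ s.support, (Polynomial.C (X i : MvPolynomial σ k) * Polynomial.X) ^ s i =
          Polynomial.C (∏ i ∈ s.support, X i ^ s i) * Polynomial.X ^ s.degree := by
        rw [Finset.prod_congr rfl fun i _ => mul_pow _ _ (s i), Finset.prod_mul_distrib,
          Finset.prod_pow_eq_pow_sum, map_prod, Finsupp.degree_apply]
        simp only [map_pow]
      rw [gradingHom, aeval_monomial, Finsupp.prod, h, monomial_eq, Finsupp.prod,
        Polynomial.algebraMap_apply, MvPolynomial.algebraMap_eq, Polynomial.C_mul, mul_assoc]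
    rw [this, Polynomial.coeff_C_mul_X_pow]
    ext t
    rw [coeff_homogeneousComponent]
    split_ifs with h1 h2 h2
    · rfl
    · rw [coeff_monomial, if_neg]
      rintro rfl
      exact h2 h1.symm
    · rw [coeff_zero, coeff_monomial, if_neg]
      rintro rfl
      exact h1 h2.symm
    · rfl

lemma natDegree_gradingHom {σ k : Type*} [CommRing k] (p : MvPolynomial σ k) :
    (gradingHom σ k p).natDegree = p.totalDegree := by
  apply le_antisymm
  · refine Polynomial.natDegree_le_iff_coeff_eq_zero.2 fun m hm => ?_
    rw [coeff_gradingHom]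
    exact homogeneousComponent_eq_zero _ _ hm
  · refine Finset.sup_le fun s hs => Polynomial.le_natDegree_of_ne_zero fun h0 => ?_
    change (gradingHom σ k p).coeff s.degree = 0 at h0
    have := congrArg (coeff s) h0
    rw [coeff_gradingHom, coeff_homogeneousComponent, if_pos rfl, coeff_zero] at this
    exact mem_support_iff.1 hs this

lemma charpolyRev_map {R S m : Type*} [CommRing R] [CommRing S] [Fintype m] [DecidableEq m]
    (f : R →+* S) (M : Matrix m m R) :
    (M.map f).charpolyRev = M.charpolyRev.map f := by
  rw [charpolyRev, charpolyRev, ← Polynomial.coe_mapRingHom, RingHom.map_det]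
  congr 1
  ext i j : 1
  simp [Matrix.one_apply, apply_ite (Polynomial.map f)]

lemma natDegree_charpolyRev {K m : Type*} [Field K] [Fintype m] [DecidableEq m]
    (M : Matrix m m K) : M.charpolyRev.natDegree = (M ^ Fintype.card m).rank := by
  have h1 := LinearMap.finrank_maxGenEigenspace_zero_eq M.toLin'
  rw [Module.End.maxGenEigenspace_eq_genEigenspace_finrank, Module.End.genEigenspace_nat,
    zero_smul, sub_zero, Module.finrank_fintype_fun_eq_card, ← Matrix.toLin'_pow,
    Matrix.charpoly_toLin'] at h1
  have h2 := finrank_ker_add_rank (M ^ Fintype.card m)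
  rw [← Matrix.reverse_charpoly, Polynomial.reverse_natDegree, Matrix.charpoly_natDegree_eq_dim,
    ← h1]
  exact Nat.sub_eq_of_eq_add (h2.symm.trans (Nat.add_comm _ _))

lemma totalDegree_det_pencilEval_genX {k : Type*} [Field k] {g d : ℕ}
    (A : Fin g → Matrix (Fin d) (Fin d) k) (l : ℕ) :
    (pencilEval A (genX k g (l + 1))).det.totalDegree =
      (twistPencil A l ^ (d * (l + 1))).rank := by
  have h1 : gradingHom _ k (pencilEval A (genX k g (l + 1))).det =
      (pencilLin A (genX k g (l + 1))).charpolyRev := by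
    rw [AlgHom.map_det, charpolyRev, pencilEval_eq_one_sub, map_sub, map_one]
    congr 2
    ext ⟨a, i⟩ ⟨b, j⟩ : 1
    rw [AlgHom.mapMatrix_apply, Matrix.map_apply, Matrix.smul_apply, Matrix.map_apply, pencilLin,
      Matrix.sum_apply, map_sum, map_sum, smul_eq_mul, Finset.mul_sum]
    refine Finset.sum_congr rfl fun c _ => ?_
    rw [kroneckerMap_apply, map_mul, Matrix.map_apply, AlgHom.commutes, genX, Matrix.of_apply,
      gradingHom, aeval_X, Polynomial.algebraMap_apply, map_mul]
    ring
  rw [← natDegree_gradingHom, h1, ← Polynomial.natDegree_map_eq_of_injective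
    (f := (twistEval k g l).toRingHom) (twistEval_injective k g l), ← charpolyRev_map]
  have h2 := natDegree_charpolyRev (twistPencil A l)
  rw [Fintype.card_prod, Fintype.card_fin, Fintype.card_fin, twistPencil_eq_map] at h2
  rw [twistPencil_eq_map]
  exact h2

end Degree

section Words

open scoped Kronecker

variable {k : Type*} [Field k] {g d : ℕ} (A : Fin g → Matrix (Fin d) (Fin d) k)

/-- The product of the coefficients of the pencil along the first `m` letters of a word. -/
def wordProd (w : ℕ → Fin g) (m : ℕ) : Matrix (Fin d) (Fin d) k :=
  ((List.range m).map fun i => A (w i)).prod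

lemma wordProd_succ (w : ℕ → Fin g) (m : ℕ) :
    wordProd A w (m + 1) = wordProd A w m * A (w m) := by
  simp [wordProd, List.range_succ]

lemma wordProd_succ' (w : ℕ → Fin g) (m : ℕ) :
    wordProd A w (m + 1) = A (w 0) * wordProd A (fun i => w (i + 1)) m := by
  simp [wordProd, List.range_succ_eq_map, Function.comp_def]

/-- The tuple of adjacency matrices of the directed cycle whose edges are labelled by a word. -/
def cyclicTuple (k : Type*) [CommRing k] (l : ℕ) (w : ℕ → Fin g) (j : Fin g) :
    Matrix (Fin (l + 1)) (Fin (l + 1)) k :=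
  Matrix.of fun i κ => if κ = i + 1 then if w i = j then 1 else 0 else 0

lemma pencilLin_cyclicTuple_pow_apply (l : ℕ) (w : ℕ → Fin g) {m : ℕ} (hm : m ≤ l + 1)
    (a b : Fin d) (κ : Fin (l + 1)) :
    (pencilLin A (cyclicTuple k l w) ^ m) (a, 0) (b, κ) =
      if κ = Fin.ofNat (l + 1) m then wordProd A w m a b else 0 := by
  induction m generalizing b κ with
  | zero =>
    simp only [pow_zero, Matrix.one_apply, Prod.mk.injEq, wordProd, List.range_zero, List.map_nil,
      List.prod_nil, eq_comm (a := κ)]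
    by_cases h1 : a = b <;> by_cases h2 : 0 = κ <;> simp [h1, h2]
  | succ m ih =>
    have hval : ((Fin.ofNat (l + 1) m : Fin (l + 1)) : ℕ) = m := Nat.mod_eq_of_lt hm
    have hc : Fin.ofNat (l + 1) m + 1 = Fin.ofNat (l + 1) (m + 1) := by
      rw [Fin.ext_iff, Fin.val_add, Fin.val_ofNat, Fin.val_ofNat, Fin.val_one', ← Nat.add_mod]
    have hlin : ∀ c i, pencilLin A (cyclicTuple k l w) (c, i) (b, κ) =
        if κ = i + 1 then A (w i) c b else 0 := fun c i => by
      simp [pencilLin, Matrix.sum_apply, cyclicTuple]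
    rw [pow_succ, Matrix.mul_apply, Fintype.sum_prod_type]
    simp only [ih (Nat.le_of_succ_le hm), hlin, ite_mul, zero_mul, Finset.sum_ite_eq',
      Finset.mem_univ, if_true, hval, hc, wordProd_succ, Matrix.mul_apply]
    split_ifs <;> simp

lemma kronecker_one_mul_pencilLin_pow_eq_zero {R : Type*} [CommRing R] [Algebra k R] {n : Type*}
    [Fintype n] [DecidableEq n] (X : Fin g → Matrix n n R) (m : ℕ) (C : Matrix (Fin d) (Fin d) R)
    (hC : ∀ w : ℕ → Fin g, C * (wordProd A w m).map (algebraMap k R) = 0) [Nonempty (Fin g)] :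
    (C ⊗ₖ (1 : Matrix n n R)) * pencilLin A X ^ m = 0 := by
  induction m generalizing C with
  | zero =>
    have : C = 0 := by simpa [wordProd] using hC fun _ => Classical.arbitrary _
    simp [this]
  | succ m ih =>
    rw [pow_succ', ← Matrix.mul_assoc, pencilLin, Matrix.mul_sum, Matrix.sum_mul]
    refine Finset.sum_eq_zero fun j _ => ?_
    have h := ih (C * (A j).map (algebraMap k R)) fun w => by
      have := hC fun i => Nat.casesOn i j w
      rw [wordProd_succ', Matrix.map_mul, ← Matrix.mul_assoc] at this
      exact this
    rw [← mul_kronecker_mul, Matrix.one_mul]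
    have hsplit : (C * (A j).map (algebraMap k R)) ⊗ₖ X j =
        ((1 : Matrix (Fin d) (Fin d) R) ⊗ₖ X j) *
          ((C * (A j).map (algebraMap k R)) ⊗ₖ (1 : Matrix n n R)) := by
      rw [← mul_kronecker_mul, Matrix.one_mul, Matrix.mul_one]
    rw [hsplit, Matrix.mul_assoc]
    exact (congrArg _ h).trans (Matrix.mul_zero _)

lemma twistPencil_succ_pow_eq_zero {l : ℕ} (h : twistPencil A l ^ (l + 1) = 0) :
    twistPencil A (l + 1) ^ (l + 1) = 0 := by
  rcases isEmpty_or_nonempty (Fin g) with hg | hg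
  · simp [twistPencil, pencilLin]
  have hw : ∀ w : ℕ → Fin g, wordProd A w (l + 1) = 0 := by
    intro w
    have h0 := rank_pencilLin_pow_le A (cyclicTuple k l w) (l + 1)
    rw [h, Matrix.rank_zero, Nat.le_zero, matrix_rank_eq_zero] at h0
    ext a b
    have := pencilLin_cyclicTuple_pow_apply A l w le_rfl a b 0
    rw [h0, if_pos (by simp)] at this
    exact this.symm
  have := kronecker_one_mul_pencilLin_pow_eq_zero A (twistX k g (l + 1)) (l + 1) 1 fun w => by
    simp [hw]
  rwa [one_kronecker_one, Matrix.one_mul] at this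

end Words

section StableRank

variable {k : Type*} [Field k] {g d : ℕ} (A : Fin g → Matrix (Fin d) (Fin d) k)

lemma card_fin_prod (d l : ℕ) : Fintype.card (Fin d × Fin (l + 1)) = d * (l + 1) := by simp

lemma exists_rank_twistPencil_eq (l : ℕ) :
    ∃ s ≤ d, (twistPencil A l ^ (d * (l + 1))).rank = s * (l + 1) := by
  obtain ⟨s, hs⟩ := dvd_rank_twistPencil_pow A l (d * (l + 1))
  refine ⟨s, ?_, hs.trans (mul_comm _ _)⟩
  have h := Matrix.rank_le_card_width (twistPencil A l ^ (d * (l + 1)))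
  rw [hs, card_fin_prod, mul_comm] at h
  exact Nat.le_of_mul_le_mul_right h l.succ_pos

lemma rank_twistPencil_le_rank_pow (l b : ℕ) :
    (twistPencil A l ^ (d * (l + 1))).rank ≤ (twistPencil A l ^ b).rank := by
  rcases Nat.eq_zero_or_pos (twistPencil A l ^ (d * (l + 1))).rank with h | h
  · simp [h]
  · refine rank_pow_le_of_dvd _ (dvd_rank_twistPencil_pow A l) ?_ b
    rw [card_fin_prod]
    have : d * (l + 1) ≤ (l + 1) * (d * (l + 1)) := Nat.le_mul_of_pos_left _ l.succ_pos
    omega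

lemma rank_twistPencil_le_succ (l : ℕ) : (twistPencil A l ^ (d * (l + 1))).rank ≤
    (twistPencil A (l + 1) ^ (d * (l + 1 + 1))).rank :=
  (rank_twistPencil_le_rank_pow A l _).trans (rank_twistPencil_pow_le_succ A l _)

lemma rank_twistPencil_succ_eq_zero {l : ℕ} (hd : d ≤ l + 1)
    (h : (twistPencil A l ^ (d * (l + 1))).rank = 0) :
    (twistPencil A (l + 1) ^ (d * (l + 1 + 1))).rank = 0 := by
  have hpow : (twistPencil A l ^ d).rank = 0 := by
    by_contra hne
    have := rank_pow_le_of_dvd _ (dvd_rank_twistPencil_pow A l) (N := d)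
      (by rw [card_fin_prod, mul_comm]; omega) (d * (l + 1))
    omega
  have h0 : twistPencil A l ^ (l + 1) = 0 := by
    rw [← matrix_rank_eq_zero]
    exact Nat.le_zero.1 ((rank_pow_anti _ hd).trans_eq hpow)
  have h1 := rank_twistPencil_le_rank_pow A (l + 1) (l + 1)
  rwa [twistPencil_succ_pow_eq_zero A h0, Matrix.rank_zero, Nat.le_zero] at h1

/-- The normalized stable rank of the pencil does not depend on the size of the generic matrices,
once this size is large. -/
lemma stableRank_succ {l s r : ℕ} (hl : d ^ 2 ≤ l + 2)
    (hs : (twistPencil A l ^ (d * (l + 1))).rank = s * (l + 1)) (hsd : s ≤ d)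
    (hr : (twistPencil A (l + 1) ^ (d * (l + 1 + 1))).rank = r * (l + 1 + 1)) (hrd : r ≤ d) :
    r = s := by
  have hd : d ≤ l + 1 := by
    rcases Nat.lt_or_ge d 2 with h | h
    · omega
    · nlinarith
  apply le_antisymm
  · rcases Nat.lt_or_ge r 2 with h | h
    · by_contra! hlt
      have hs0 : s = 0 := by omega
      have h0 := rank_twistPencil_succ_eq_zero A hd (by rw [hs, hs0, zero_mul])
      have hr0 : r = 0 := by simpa using hr.symm.trans h0
      omega
    · obtain ⟨c, rfl⟩ := Nat.exists_eq_add_of_le hrd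
      have h1 := rank_twistPencil_le_rank_pow A (l + 1) (c + 1)
      have h2 := rank_twistPencil_succ_pow_le A l (c + 1)
      obtain ⟨q, hq⟩ := dvd_rank_twistPencil_pow A l (c + 1)
      rw [hq] at h2
      have hqr : r ≤ q := by
        by_contra! hlt
        have h3 : (l + 1) * (q + 1) ≤ (l + 1) * r := Nat.mul_le_mul_left _ hlt
        have h4 : 2 * (r + c) ≤ r * (r + c) := Nat.mul_le_mul_right _ h
        nlinarith
      have h5 := rank_pow_le_of_dvd _ (dvd_rank_twistPencil_pow A l) (N := c + 1)
        (by rw [card_fin_prod, hq]; nlinarith) ((r + c) * (l + 1))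
      rw [hq, hs] at h5
      nlinarith
  · have h1 := rank_twistPencil_le_succ A l
    rw [hs, hr] at h1
    by_contra! hlt
    nlinarith

end StableRank

/-- For a monic linear pencil `L` of size `d` there is `d_L ≤ d` such that
`deg det L(gX⁽ⁿ⁾) = d_L * n` for all `n ≥ max (d² - 1) 1`. -/
theorem totalDegree_det_pencil_genericMatrices
    {k : Type*} [Field k] [IsAlgClosed k] [CharZero k]
    {g d : ℕ} (A : Fin g → Matrix (Fin d) (Fin d) k) :
    ∃ d_L : ℕ, d_L ≤ d ∧ ∀ n ≥ max (d ^ 2 - 1) 1,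
      (pencilEval A (genX k g n)).det.totalDegree = d_L * n := by
  obtain ⟨s, hsd, hs⟩ := exists_rank_twistPencil_eq A (max (d ^ 2 - 1) 1 - 1)
  refine ⟨s, hsd, fun n hn => ?_⟩
  obtain ⟨l, rfl⟩ := Nat.exists_eq_add_of_le' ((le_max_right _ _).trans hn)
  rw [totalDegree_det_pencilEval_genX]
  have hl : max (d ^ 2 - 1) 1 - 1 ≤ l := by omega
  clear hn
  induction l, hl using Nat.le_induction with
  | base => exact hs
  | succ l hl ih =>
    obtain ⟨r, hrd, hr⟩ := exists_rank_twistPencil_eq A (l + 1)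
    rw [hr, stableRank_succ A (by omega) ih hsd hr hrd]
end
end

section
/- Let k be an algebraically closed field of characteristic zero and n ∈ ℕ. Let p ∈ k[ξ] := MvPolynomial (Fin g × Fin n × Fin n) k be nonzero and invariant under simultaneous conjugation: for every invertible σ ∈ M_n(k) and every X ∈ M_n(k)^g, p(σX₁σ⁻¹,…,σX_gσ⁻¹) = p(X₁,…,X_g). Then every factor of p is invariant under simultaneous conjugation: if q ∈ k[ξ] divides p, then for every invertible σ ∈ M_n(k) and every X ∈ M_n(k)^g, q(σX₁σ⁻¹,…,σX_gσ⁻¹) = q(X₁,…,X_g). -/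
open Matrix MvPolynomial

/-- Along a polynomial curve on which `p` is a nonzero constant, every factor of `p` is constant. -/
theorem eval_curve_eq_of_dvd {τ k : Type*} [Field k] [Infinite k] {p q : MvPolynomial τ k}
    (hq : q ∣ p) (γ : τ → Polynomial k) {c : k} (hc : c ≠ 0)
    (hp : ∀ t, eval (fun v => (γ v).eval t) p = c) (s t : k) :
    eval (fun v => (γ v).eval s) q = eval (fun v => (γ v).eval t) q := by
  have key (r : MvPolynomial τ k) (u : k) :
      (aeval γ r).eval u = eval (fun v => (γ v).eval u) r := by
    rw [← Polynomial.coe_evalRingHom, MvPolynomial.map_aeval, coe_eval₂Hom, eval, coe_eval₂Hom]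
    congr 1
    ext a
    simp
  have hconst : aeval γ p = Polynomial.C c :=
    Polynomial.funext fun u => by rw [key, hp, Polynomial.eval_C]
  have hdeg : (aeval γ q).natDegree = 0 := by
    have hle := Polynomial.natDegree_le_of_dvd (hconst ▸ map_dvd (aeval γ) hq)
      (Polynomial.C_ne_zero.mpr hc)
    simpa using hle
  rw [← key, ← key, Polynomial.eq_C_of_natDegree_eq_zero hdeg, Polynomial.eval_C,
    Polynomial.eval_C]

/-- Two polynomials agreeing off the zero locus of a nonzero polynomial are equal. -/
theorem MvPolynomial.eq_of_eval_eq_of_eval_ne_zero {τ k : Type*} [Field k] [Infinite k]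
    {p q r : MvPolynomial τ k} (hp : p ≠ 0) (h : ∀ x, eval x p ≠ 0 → eval x q = eval x r) :
    q = r := by
  have hmul : p * (q - r) = 0 := MvPolynomial.funext fun x => by
    by_cases hx : eval x p = 0
    · simp [hx]
    · simp [h x hx]
  exact sub_eq_zero.mp ((mul_eq_zero.mp hmul).resolve_left hp)

/-- The diagonal matrix with entries `a` and `a⁻¹` is a product of four transvections. -/
theorem diag2n_eq_transvections {m k : Type*} [Fintype m] [DecidableEq m] [Field k] {i j : m}
    (hij : i ≠ j) (a : k) (ha : a ≠ 0) :
    (SpecialLinearGroup.diag2n hij a ha).1 = transvection i j (-a) * transvection j i (a⁻¹ - 1) *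
      transvection i j 1 * transvection j i (a - 1) := by
  have hdiag : (SpecialLinearGroup.diag2n hij a ha).1 =
      1 + single i i (a - 1) + single j j (a⁻¹ - 1) := by
    ext r s
    rw [SpecialLinearGroup.diag2n_coe]
    simp only [diagonal_apply, Matrix.add_apply, single_apply, Matrix.one_apply]
    grind
  rw [hdiag]
  simp only [transvection, Matrix.mul_add, Matrix.add_mul, Matrix.mul_one, Matrix.one_mul,
    single_mul_single_same, single_mul_single_of_ne _ _ _ _ hij,
    single_mul_single_of_ne _ _ _ _ hij.symm, add_zero]
  ext r s
  simp only [Matrix.add_apply, single_apply, Matrix.one_apply]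
  by_cases h1 : i = r <;> by_cases h2 : j = r <;> by_cases h3 : i = s <;> by_cases h4 : j = s <;>
    simp_all <;> field_simp <;> ring

/-- Invariance of `q` under simultaneous conjugation by `σ`. -/
def IsConjInvariant {ι m k : Type*} [Fintype m] [DecidableEq m] [Field k]
    (q : MvPolynomial (ι × m × m) k) (σ : Matrix m m k) : Prop :=
  ∀ X : ι → Matrix m m k,
    eval (fun v => (σ * X v.1 * σ⁻¹) v.2.1 v.2.2) q = eval (fun v => X v.1 v.2.1 v.2.2) q

namespace IsConjInvariant

variable {ι m k : Type*} [Fintype m] [DecidableEq m] [Field k]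
  {p q : MvPolynomial (ι × m × m) k} {σ τ : Matrix m m k}

theorem mul (hσ : IsConjInvariant q σ) (hτ : IsConjInvariant q τ) :
    IsConjInvariant q (σ * τ) := fun X => by
  rw [← hτ X, ← hσ fun i => τ * X i * τ⁻¹]
  simp only [Matrix.mul_inv_rev, Matrix.mul_assoc]

theorem smul (hσ : IsConjInvariant q σ) (hdet : IsUnit σ.det) {c : k} (hc : c ≠ 0) :
    IsConjInvariant q (c • σ) := fun X => by
  have hinv : (c • σ)⁻¹ = c⁻¹ • σ⁻¹ :=
    Matrix.inv_eq_left_inv (by simp [Matrix.nonsing_inv_mul _ hdet, smul_smul, hc])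
  rw [← hσ X, hinv]
  simp [hc]

theorem of_eval_ne_zero [Infinite k] (hp : p ≠ 0)
    (h : ∀ X : ι → Matrix m m k, eval (fun v => X v.1 v.2.1 v.2.2) p ≠ 0 →
      eval (fun v => (σ * X v.1 * σ⁻¹) v.2.1 v.2.2) q = eval (fun v => X v.1 v.2.1 v.2.2) q) :
    IsConjInvariant q σ := by
  let f (v : ι × m × m) : MvPolynomial (ι × m × m) k :=
    ∑ b, (∑ a, C (σ v.2.1 a) * X (v.1, a, b)) * C (σ⁻¹ b v.2.2)
  have hF (Y : ι → Matrix m m k) : eval (fun v => Y v.1 v.2.1 v.2.2) (bind₁ f q) =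
      eval (fun v => (σ * Y v.1 * σ⁻¹) v.2.1 v.2.2) q := by
    have hf : (fun v => eval (fun v => Y v.1 v.2.1 v.2.2) (f v)) =
        fun v => (σ * Y v.1 * σ⁻¹) v.2.1 v.2.2 := by
      funext v
      simp only [f, map_sum, map_mul, eval_C, eval_X, Matrix.mul_apply]
    rw [← hf]
    exact eval₂Hom_bind₁ _ _ _ _
  have hFq : bind₁ f q = q := MvPolynomial.eq_of_eval_eq_of_eval_ne_zero hp fun x hx =>
    (hF fun i => Matrix.of fun a b => x (i, a, b)).trans
      (h (fun i => Matrix.of fun a b => x (i, a, b)) hx)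
  exact fun Y => by rw [← hF, hFq]

theorem transvection_of_dvd [Infinite k] (hp : p ≠ 0) (hq : q ∣ p) {i j : m} (hij : i ≠ j)
    (hinv : ∀ c, IsConjInvariant p (transvection i j c)) (c : k) :
    IsConjInvariant q (transvection i j c) := by
  have inv_eq (t : k) : (transvection i j t)⁻¹ = transvection i j (-t) :=
    Matrix.inv_eq_left_inv (by simp [transvection_mul_transvection_same _ _ hij])
  refine of_eval_ne_zero hp fun Y hY => ?_
  let γ (v : ι × m × m) : Polynomial k :=
    (transvection i j Polynomial.X * (Y v.1).map Polynomial.C *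
      transvection i j (-Polynomial.X) : Matrix m m (Polynomial k)) v.2.1 v.2.2
  have hγ (t : k) (v : ι × m × m) : (γ v).eval t =
      (transvection i j t * Y v.1 * (transvection i j t)⁻¹) v.2.1 v.2.2 := by
    have map_tr (f : Polynomial k) : (Polynomial.evalRingHom t).mapMatrix (transvection i j f) =
        transvection i j (f.eval t) := by
      rw [transvection, map_add, map_one, RingHom.mapMatrix_apply, Matrix.map_single]
      rfl
    have map_Y : (Polynomial.evalRingHom t).mapMatrix ((Y v.1).map Polynomial.C) = Y v.1 := by
      ext; simp
    calc (γ v).eval t = (Polynomial.evalRingHom t).mapMatrix (transvection i j Polynomial.X *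
          (Y v.1).map Polynomial.C * transvection i j (-Polynomial.X)) v.2.1 v.2.2 := rfl
      _ = _ := by simp only [map_mul, map_tr, map_Y, inv_eq, Polynomial.eval_X, Polynomial.eval_neg]
  have h := eval_curve_eq_of_dvd hq γ hY (fun t => by simpa only [hγ] using hinv t Y) c 0
  simpa [hγ] using h

theorem of_isUnit_of_transvection [IsAlgClosed k]
    (h : ∀ i j, i ≠ j → ∀ c, IsConjInvariant q (transvection i j c)) (hσ : IsUnit σ) :
    IsConjInvariant q σ := by
  have hdet : IsUnit σ.det := (Matrix.isUnit_iff_isUnit_det σ).mp hσ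
  rcases subsingleton_or_nontrivial m with hm | hm
  · intro Y
    have hcomm (A B : Matrix m m k) : A * B = B * A := by
      ext a b
      obtain rfl := Subsingleton.elim a b
      rw [Matrix.mul_apply, Matrix.mul_apply]
      refine Finset.sum_congr rfl fun c _ => ?_
      rw [Subsingleton.elim c a, mul_comm]
    simp only [hcomm σ, Matrix.mul_assoc, Matrix.nonsing_inv_mul _ hdet, Matrix.mul_one]
  obtain ⟨c, hc⟩ := IsAlgClosed.exists_pow_nat_eq σ.det (Fintype.card_pos (α := m))
  have hc0 : c ≠ 0 := by
    rintro rfl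
    exact hdet.ne_zero (by rw [← hc, zero_pow Fintype.card_ne_zero])
  let A : SpecialLinearGroup m k := ⟨c⁻¹ • σ, by
    rw [Matrix.det_smul, inv_pow, hc, inv_mul_cancel₀ hdet.ne_zero]⟩
  have hA : IsConjInvariant q A.1 := by
    refine SpecialLinearGroup.diagonal_transvection_induction' (fun B => IsConjInvariant q B.1) A
      (fun i j hij a ha => ?_) (fun i j hij a => h i j hij a) (fun B D hB hD => hB.mul hD)
    rw [diag2n_eq_transvections]
    exact (((h i j hij _).mul (h j i hij.symm _)).mul (h i j hij _)).mul (h j i hij.symm _)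
  have hσA : σ = c • A.1 := by simp [A, smul_smul, hc0]
  rw [hσA]
  exact hA.smul (by rw [A.2]; exact isUnit_one) hc0

end IsConjInvariant

/-- If a nonzero polynomial in the entries of a `g`-tuple of `n × n` matrices is invariant
under simultaneous conjugation, then so is every factor of it. -/
theorem factor_of_conjugation_invariant_is_invariant
    {k : Type*} [Field k] [IsAlgClosed k] [CharZero k] {g n : ℕ}
    (p q : MvPolynomial (Fin g × Fin n × Fin n) k) (hp : p ≠ 0)
    (hinv : ∀ σ : Matrix (Fin n) (Fin n) k, IsUnit σ →
      ∀ X : Fin g → Matrix (Fin n) (Fin n) k,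
        MvPolynomial.eval (fun v => (σ * X v.1 * σ⁻¹) v.2.1 v.2.2) p =
          MvPolynomial.eval (fun v => X v.1 v.2.1 v.2.2) p)
    (hq : q ∣ p) :
    ∀ σ : Matrix (Fin n) (Fin n) k, IsUnit σ →
      ∀ X : Fin g → Matrix (Fin n) (Fin n) k,
        MvPolynomial.eval (fun v => (σ * X v.1 * σ⁻¹) v.2.1 v.2.2) q =
          MvPolynomial.eval (fun v => X v.1 v.2.1 v.2.2) q := by
  exact fun σ hσ => IsConjInvariant.of_isUnit_of_transvection (fun i j hij =>
    IsConjInvariant.transvection_of_dvd hp hq hij fun c => hinv _ <|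
      (Matrix.isUnit_iff_isUnit_det _).mpr (by simp [det_transvection_of_ne _ _ hij])) hσ
end

section
/- Let k be an algebraically closed field of characteristic zero, let L = I_d − Σ_{j=1}^g A_j x_j be a monic linear pencil of size d, and let n₀ ≥ max(d² − 1, 1). Fix indices j', j'' ∈ {1,…,g}. Suppose that for every n ≥ n₀ the polynomial det( L(gX^(n)) − (A_{j'}·A_{j''}) ⊗ gY^(n) ), an element of the polynomial ring in (g+1)n² variables, is irreducible. Then for every n ≥ 2n₀ the polynomial det L(gX^(n)) (in gn² variables) is irreducible. -/
open Matrix MvPolynomial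

noncomputable section

/-- The `g`-tuple of `n × n` generic matrices, over the larger polynomial ring that also
contains the fresh variables of `genY`. -/
def genX' (k : Type*) [CommRing k] (g n : ℕ) :
    Fin g → Matrix (Fin n) (Fin n) (MvPolynomial ((Fin g × Fin n × Fin n) ⊕ (Fin n × Fin n)) k) :=
  fun j => Matrix.of fun ι κ => MvPolynomial.X (Sum.inl (j, ι, κ))

/-- The additional `n × n` generic matrix in fresh variables. -/
def genY (k : Type*) [CommRing k] (g n : ℕ) :
    Matrix (Fin n) (Fin n) (MvPolynomial ((Fin g × Fin n × Fin n) ⊕ (Fin n × Fin n)) k) :=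
  Matrix.of fun ι κ => MvPolynomial.X (Sum.inr (ι, κ))

/-- If `dim V ≤ dim W`, then some unipotent `1 + E` with `E ^ 2 = 0` maps `V` into `W`. -/
theorem exists_sq_zero_add_mem {K M : Type*} [Field K] [AddCommGroup M] [Module K M]
    [FiniteDimensional K M] (V W : Submodule K M)
    (h : Module.finrank K V ≤ Module.finrank K W) :
    ∃ E : M →ₗ[K] M, E ∘ₗ E = 0 ∧ ∀ v ∈ V, v + E v ∈ W := by
  obtain ⟨C, hC⟩ := (V ⊓ W).exists_isCompl
  have key : ∀ U : Submodule K M, V ⊓ W ≤ U → (V ⊓ W) ⊔ (U ⊓ C) = U ∧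
      Module.finrank K (U ⊓ C : Submodule K M) + Module.finrank K (V ⊓ W : Submodule K M) =
        Module.finrank K U := by
    intro U hU
    have h1 : (V ⊓ W) ⊔ (U ⊓ C) = U := by
      rw [inf_comm U C, ← sup_inf_assoc_of_le C hU, hC.sup_eq_top, top_inf_eq]
    have h2 := Submodule.finrank_sup_add_finrank_inf_eq (V ⊓ W) (U ⊓ C)
    have h3 : (V ⊓ W) ⊓ (U ⊓ C) = ⊥ := by
      rw [eq_bot_iff, ← hC.inf_eq_bot]
      exact inf_le_inf_left _ inf_le_right
    rw [h1, h3, finrank_bot] at h2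
    exact ⟨h1, by omega⟩
  obtain ⟨hV, hVr⟩ := key V inf_le_left
  obtain ⟨-, hWr⟩ := key W inf_le_right
  obtain ⟨j, hj⟩ := finrank_le_iff_exists_linearMap.mp
    (show Module.finrank K (V ⊓ C : Submodule K M) ≤ Module.finrank K (W ⊓ C : Submodule K M)
      by omega)
  obtain ⟨r, hr⟩ := j.exists_leftInverse_of_injective (LinearMap.ker_eq_bot.2 hj)
  have hF : LinearMap.ker ((V ⊓ C).subtype.coprod (W ⊓ C).subtype) = ⊥ := by
    rw [LinearMap.ker_coprod_of_disjoint_range]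
    · simp
    · rw [Submodule.range_subtype, Submodule.range_subtype, disjoint_iff, eq_bot_iff,
        ← hC.inf_eq_bot]
      exact fun x hx => ⟨⟨hx.1.1, hx.2.1⟩, hx.1.2⟩
  obtain ⟨L, hL⟩ := LinearMap.exists_leftInverse_of_injective _ hF
  have hL' : ∀ (x : (V ⊓ C : Submodule K M)) (y : (W ⊓ C : Submodule K M)),
      L ((x : M) + (y : M)) = (x, y) := fun x y => by
    simpa using LinearMap.congr_fun hL (x, y)
  let P : M →ₗ[K] (V ⊓ C : Submodule K M) :=
    (LinearMap.fst K _ _ + r ∘ₗ LinearMap.snd K _ _) ∘ₗ L ∘ₗ Submodule.projection C (V ⊓ W) hC.symm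
  have hr' : ∀ x, r (j x) = x := fun x => LinearMap.congr_fun hr x
  have hPV : ∀ x : (V ⊓ C : Submodule K M), P x = x := fun x => by
    have h1 : Submodule.projection C (V ⊓ W) hC.symm (x : M) = x :=
      Submodule.projection_apply_of_mem_left hC.symm x.2.2
    have h2 := hL' x 0
    simp only [ZeroMemClass.coe_zero, add_zero] at h2
    simp [P, h1, h2]
  have hPj : ∀ x : (V ⊓ C : Submodule K M), P (j x) = x := fun x => by
    have h1 : Submodule.projection C (V ⊓ W) hC.symm (j x : M) = j x :=
      Submodule.projection_apply_of_mem_left hC.symm (j x).2.2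
    have h2 := hL' 0 (j x)
    simp only [ZeroMemClass.coe_zero, zero_add] at h2
    simp [P, h1, h2, hr']
  have hPI : ∀ x ∈ V ⊓ W, P x = 0 := fun x hx => by
    have h1 : Submodule.projection C (V ⊓ W) hC.symm x = 0 :=
      (Submodule.projection_apply_eq_zero_iff hC.symm).2 hx
    simp [P, h1]
  refine ⟨((W ⊓ C).subtype ∘ₗ j - (V ⊓ C).subtype) ∘ₗ P, ?_, ?_⟩
  · ext x
    simp [hPV, hPj]
  · intro v hv
    rw [← hV] at hv
    obtain ⟨a, ha, b, hb, rfl⟩ := Submodule.mem_sup.1 hv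
    have := hPV ⟨b, hb⟩
    simp only [LinearMap.comp_apply, LinearMap.sub_apply, map_add P, hPI a ha, zero_add,
      Submodule.subtype_apply, this]
    rw [add_add_sub_cancel]
    exact W.add_mem ha.2 (j _).2.1

theorem det_one_sub_sum_kronecker_conj {R ι d m n : Type*} [CommRing R] [Fintype ι] [Fintype d]
    [DecidableEq d] [Fintype m] [DecidableEq m] [Fintype n] [DecidableEq n]
    (B : ι → Matrix d d R) (S : Matrix m n R) (P : Matrix n m R) (X : ι → Matrix n n R) :
    (1 - ∑ j, kroneckerMap (· * ·) (B j) (S * X j * P)).det =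
      (1 - ∑ j, kroneckerMap (· * ·) (B j) (X j * (P * S))).det := by
  have h1 : ∑ j, kroneckerMap (· * ·) (B j) (S * X j * P) =
      kroneckerMap (· * ·) (1 : Matrix d d R) S *
        ∑ j, kroneckerMap (· * ·) (B j) (X j * P) := by
    simp only [Matrix.mul_sum, ← mul_kronecker_mul, Matrix.mul_assoc, Matrix.one_mul]
  have h2 : ∑ j, kroneckerMap (· * ·) (B j) (X j * (P * S)) =
      (∑ j, kroneckerMap (· * ·) (B j) (X j * P)) *
        kroneckerMap (· * ·) (1 : Matrix d d R) S := by
    simp only [Matrix.sum_mul, ← mul_kronecker_mul, Matrix.mul_assoc, Matrix.mul_one]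
  rw [h1, h2, Matrix.det_one_sub_mul_comm]

theorem det_one_sub_sum_kronecker_fromBlocks {R ι d n : Type*} [CommRing R] [Fintype ι]
    [DecidableEq ι] [Fintype d] [DecidableEq d] [Fintype n] [DecidableEq n]
    (B : ι → Matrix d d R) (X : ι → Matrix n n R) (Y : Matrix n n R) (i i' : ι) :
    (1 - ∑ j, kroneckerMap (· * ·) (B j) (fromBlocks (X j) (if j = i then Y else 0)
      (if j = i' then 1 else 0) 0)).det =
      (1 - ∑ j, kroneckerMap (· * ·) (B j) (X j) -
        kroneckerMap (· * ·) (B i * B i') Y).det := by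
  rw [← Matrix.det_reindex_self (Equiv.prodSumDistrib d n n)]
  have : reindex (Equiv.prodSumDistrib d n n) (Equiv.prodSumDistrib d n n)
      (1 - ∑ j, kroneckerMap (· * ·) (B j) (fromBlocks (X j) (if j = i then Y else 0)
      (if j = i' then 1 else 0) 0)) =
      fromBlocks (1 - ∑ j, kroneckerMap (· * ·) (B j) (X j)) (-kroneckerMap (· * ·) (B i) Y)
        (-kroneckerMap (· * ·) (B i') 1) 1 := by
    ext (⟨a, b⟩ | ⟨a, b⟩) (⟨a', b'⟩ | ⟨a', b'⟩)
    · simp [Matrix.one_apply, Matrix.sum_apply]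
    · simp [Matrix.sum_apply, Matrix.ite_apply]
    · by_cases hb : b = b' <;>
        simp [Matrix.sum_apply, Matrix.ite_apply, apply_ite, hb]
    · simp [Matrix.one_apply, Matrix.sum_apply]
  rw [this, det_fromBlocks_one₂₂, Matrix.neg_mul, Matrix.mul_neg, neg_neg, ← mul_kronecker_mul,
    Matrix.mul_one]

/-- A prime polynomial not dividing `q` has a zero at which `q` does not vanish. -/
theorem exists_aeval_eq_zero_and_ne_zero {k σ : Type*} [Field k] [IsAlgClosed k] [Finite σ]
    {p q : MvPolynomial σ k} (hp : Prime p) (h : ¬ p ∣ q) :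
    ∃ x : σ → k, aeval x p = 0 ∧ aeval x q ≠ 0 := by
  by_contra! H
  refine h (Ideal.mem_span_singleton.1 ?_)
  have hI : (Ideal.span {p}).IsPrime := (Ideal.span_singleton_prime hp.ne_zero).2 hp
  rw [← hI.isRadical.radical, ← vanishingIdeal_zeroLocus_eq_radical (K := k)]
  exact fun x hx => H x (hx p (Ideal.mem_span_singleton_self p))

/-- Evaluation of polynomials in the entries of generic matrices at a tuple of matrices. -/
def tupleAeval {k R : Type*} [CommRing k] [CommRing R] [Algebra k R] {g n : ℕ}
    (X : Fin g → Matrix (Fin n) (Fin n) R) :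
    MvPolynomial (Fin g × Fin n × Fin n) k →ₐ[k] R :=
  MvPolynomial.aeval fun i => X i.1 i.2.1 i.2.2

theorem map_tupleAeval {k R R' : Type*} [CommRing k] [CommRing R] [Algebra k R] [CommRing R']
    [Algebra k R'] {g n : ℕ} (φ : R →ₐ[k] R') (X : Fin g → Matrix (Fin n) (Fin n) R)
    (p : MvPolynomial (Fin g × Fin n × Fin n) k) :
    φ (tupleAeval X p) = tupleAeval (fun j => (X j).map φ) p := by
  rw [tupleAeval, tupleAeval, ← AlgHom.comp_apply, comp_aeval]
  rfl

theorem genX_map_tupleAeval {k R : Type*} [CommRing k] [CommRing R] [Algebra k R] {g n : ℕ}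
    (X : Fin g → Matrix (Fin n) (Fin n) R) (j : Fin g) :
    (genX k g n j).map (tupleAeval X) = X j := by
  ext a b
  exact aeval_X _ (j, a, b)

theorem tupleAeval_det_pencilEval {k R : Type*} [CommRing k] [CommRing R] [Algebra k R]
    {g d n : ℕ} (A : Fin g → Matrix (Fin d) (Fin d) k) (X : Fin g → Matrix (Fin n) (Fin n) R) :
    tupleAeval X (pencilEval A (genX k g n)).det = (pencilEval A X).det := by
  rw [AlgHom.map_det]
  congr 1
  ext ⟨a, b⟩ ⟨a', b'⟩
  simp [pencilEval, Matrix.sum_apply, tupleAeval, genX, Matrix.one_apply, apply_ite,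
    -Prod.mk.injEq, algebraMap_eq]

theorem det_pencilEval_genX_mul_ne_zero {k : Type*} [Field k] {g d n : ℕ}
    (A : Fin g → Matrix (Fin d) (Fin d) k)
    (K : Matrix (Fin n) (Fin n) (MvPolynomial (Fin g × Fin n × Fin n) k)) :
    (pencilEval A fun j => genX k g n j * K).det ≠ 0 := by
  intro h
  have h1 := congrArg (tupleAeval (k := k) (R := k) (fun _ => (0 : Matrix (Fin n) (Fin n) k))) h
  rw [← tupleAeval_det_pencilEval, map_tupleAeval] at h1
  have h2 : (fun j => (genX k g n j * K).map
      (tupleAeval (k := k) (R := k) (fun _ => (0 : Matrix (Fin n) (Fin n) k)))) =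
      fun _ => 0 := by
    funext j
    rw [Matrix.map_mul, genX_map_tupleAeval, Matrix.zero_mul]
  rw [h2, tupleAeval_det_pencilEval] at h1
  simp [pencilEval] at h1

theorem det_pencilEval_conj {k R : Type*} [CommRing k] [CommRing R] [Algebra k R] {g d n : ℕ}
    (A : Fin g → Matrix (Fin d) (Fin d) k) (S P : Matrix (Fin n) (Fin n) R)
    (X : Fin g → Matrix (Fin n) (Fin n) R) :
    (pencilEval A fun j => S * X j * P).det = (pencilEval A fun j => X j * (P * S)).det :=
  det_one_sub_sum_kronecker_conj _ S P X

theorem det_pencilEval_map {k R R' : Type*} [CommRing k] [CommRing R] [Algebra k R] [CommRing R']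
    [Algebra k R'] {g d n : ℕ} (A : Fin g → Matrix (Fin d) (Fin d) k) (φ : R →ₐ[k] R')
    (X : Fin g → Matrix (Fin n) (Fin n) R) :
    (pencilEval A fun j => (X j).map φ).det = φ (pencilEval A X).det := by
  rw [← tupleAeval_det_pencilEval, ← tupleAeval_det_pencilEval A X, map_tupleAeval]

/-- A divisor of `det L` is constant along a polynomial path `t ↦ S(t) X P(t)` of tuples for which
`P(t) S(t)` does not depend on `t`. -/
theorem tupleAeval_conj_eq_of_dvd {k : Type*} [Field k] {g d n : ℕ}
    (A : Fin g → Matrix (Fin d) (Fin d) k) {p : MvPolynomial (Fin g × Fin n × Fin n) k}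
    (hp : p ∣ (pencilEval A (genX k g n)).det)
    (S P : Matrix (Fin n) (Fin n) (Polynomial k)) (K : Matrix (Fin n) (Fin n) k)
    (hPS : P * S = K.map Polynomial.C) (X : Fin g → Matrix (Fin n) (Fin n) k) (s t : k) :
    tupleAeval (fun j => S.map (Polynomial.eval s) * X j * P.map (Polynomial.eval s)) p =
      tupleAeval (fun j => S.map (Polynomial.eval t) * X j * P.map (Polynomial.eval t)) p := by
  let R := MvPolynomial (Fin g × Fin n × Fin n) k
  let ι : Polynomial k →ₐ[k] Polynomial R := Polynomial.mapAlgHom (Algebra.ofId k R)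
  let Cₐ : R →ₐ[k] Polynomial R := Polynomial.CAlgHom
  let G : Fin g → Matrix (Fin n) (Fin n) (Polynomial R) := fun j =>
    S.map ι * (genX k g n j).map Cₐ * P.map ι
  have hK : P.map ι * S.map ι = (K.map (algebraMap k R)).map Cₐ := by
    rw [← Matrix.map_mul, hPS]
    ext a b : 2
    simp [ι, Cₐ]
  have hdet : (pencilEval A G).det =
      Polynomial.C (pencilEval A fun j => genX k g n j * K.map (algebraMap k R)).det := by
    rw [det_pencilEval_conj, hK]
    simp only [← Matrix.map_mul]
    exact det_pencilEval_map A Cₐ _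
  obtain ⟨r, hr⟩ : ∃ r, tupleAeval G p = Polynomial.C r := by
    have h1 : tupleAeval G p ∣ (pencilEval A G).det := by
      rw [← tupleAeval_det_pencilEval]
      exact map_dvd _ hp
    rw [hdet] at h1
    have h2 := Polynomial.natDegree_le_of_dvd h1
      (Polynomial.C_ne_zero.2 (det_pencilEval_genX_mul_ne_zero A _))
    rw [Polynomial.natDegree_C] at h2
    exact ⟨_, Polynomial.eq_C_of_natDegree_le_zero h2⟩
  have key : ∀ u : k,
      tupleAeval (fun j => S.map (Polynomial.eval u) * X j * P.map (Polynomial.eval u)) p =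
        tupleAeval X r := by
    intro u
    let θ : Polynomial R →ₐ[k] k :=
      (Polynomial.aeval u).comp (Polynomial.mapAlgHom (tupleAeval X))
    have h1 : θ (Polynomial.C r) = tupleAeval X r := by simp [θ]
    rw [← h1, ← hr, map_tupleAeval]
    congr 2
    funext j
    have e1 : ∀ M : Matrix (Fin n) (Fin n) (Polynomial k),
        (M.map ι).map θ = M.map (Polynomial.eval u) := by
      intro M
      ext a b
      have : θ.comp ι = Polynomial.aeval u := by
        ext
        simp [θ, ι]
      simpa [Polynomial.aeval_def] using DFunLike.congr_fun this (M a b)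
    have e2 : ((genX k g n j).map Cₐ).map θ = X j := by
      rw [← genX_map_tupleAeval (k := k) X j]
      ext a b
      simp [θ, Cₐ]
    rw [Matrix.map_mul, Matrix.map_mul, e1, e1, e2]
  rw [key, key]

/-- A divisor of `det L` takes the same value at `X Q` and at `Q X Q` for an idempotent `Q`. -/
theorem tupleAeval_mul_idempotent {k : Type*} [Field k] {g d n : ℕ}
    (A : Fin g → Matrix (Fin d) (Fin d) k) {p : MvPolynomial (Fin g × Fin n × Fin n) k}
    (hp : p ∣ (pencilEval A (genX k g n)).det) {Q : Matrix (Fin n) (Fin n) k} (hQ : Q * Q = Q)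
    (X : Fin g → Matrix (Fin n) (Fin n) k) :
    tupleAeval (fun j => X j * Q) p = tupleAeval (fun j => Q * X j * Q) p := by
  have h := tupleAeval_conj_eq_of_dvd A hp
    (Q.map Polynomial.C + (Polynomial.X : Polynomial k) • (1 - Q).map Polynomial.C)
    (Q.map Polynomial.C) Q ?_ X 1 0
  · have h1 : ∀ c : k, (Q.map Polynomial.C + (Polynomial.X : Polynomial k) •
        (1 - Q).map Polynomial.C).map (Polynomial.eval c) = Q + c • (1 - Q) := fun c => by
      ext a b
      simp
    have h2 : ∀ c : k, (Q.map Polynomial.C).map (Polynomial.eval c) = Q := fun c => by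
      ext a b
      simp
    simpa only [h1, h2, one_smul, zero_smul, add_zero, add_sub_cancel, Matrix.one_mul] using h
  · rw [Matrix.mul_add, Matrix.mul_smul, ← Matrix.map_mul, ← Matrix.map_mul, Matrix.mul_sub,
      Matrix.mul_one, hQ, sub_self]
    ext a b
    simp

/-- A divisor of `det L` is invariant under conjugation by `1 + E` with `E ^ 2 = 0`. -/
theorem tupleAeval_one_add_conj {k : Type*} [Field k] {g d n : ℕ}
    (A : Fin g → Matrix (Fin d) (Fin d) k) {p : MvPolynomial (Fin g × Fin n × Fin n) k}
    (hp : p ∣ (pencilEval A (genX k g n)).det) {E : Matrix (Fin n) (Fin n) k} (hE : E * E = 0)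
    (X : Fin g → Matrix (Fin n) (Fin n) k) :
    tupleAeval (fun j => (1 + E) * X j * (1 - E)) p = tupleAeval X p := by
  have h := tupleAeval_conj_eq_of_dvd A hp
    (1 + (Polynomial.X : Polynomial k) • E.map Polynomial.C)
    (1 - (Polynomial.X : Polynomial k) • E.map Polynomial.C) 1 ?_ X 1 0
  · have h1 : ∀ c : k, (1 + (Polynomial.X : Polynomial k) • E.map Polynomial.C).map
        (Polynomial.eval c) = 1 + c • E := fun c => by
      ext a b
      simp [Matrix.one_apply, apply_ite, mul_comm c]
    have h2 : ∀ c : k, (1 - (Polynomial.X : Polynomial k) • E.map Polynomial.C).map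
        (Polynomial.eval c) = 1 - c • E := fun c => by
      ext a b
      simp [Matrix.one_apply, apply_ite, mul_comm c]
    simpa [h1, h2] using h
  · have h0 : E.map Polynomial.C * E.map Polynomial.C = 0 := by
      rw [← Matrix.map_mul, hE]
      ext a b
      simp
    simp only [Matrix.sub_mul, Matrix.mul_add, Matrix.one_mul, Matrix.mul_one, Matrix.smul_mul,
      Matrix.mul_smul, h0, smul_zero]
    simp [Matrix.map_one]

theorem pencilEval_mul_mul {k R : Type*} [CommRing k] [CommRing R] [Algebra k R] {g d n : ℕ}
    (A : Fin g → Matrix (Fin d) (Fin d) k) (S P : Matrix (Fin n) (Fin n) R)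
    (X : Fin g → Matrix (Fin n) (Fin n) R) :
    (pencilEval A fun j => S * X j * P) =
      1 - kroneckerMap (· * ·) (1 : Matrix (Fin d) (Fin d) R) S * (1 - pencilEval A X) *
        kroneckerMap (· * ·) (1 : Matrix (Fin d) (Fin d) R) P := by
  simp only [pencilEval, sub_sub_cancel, Matrix.mul_sum, Matrix.sum_mul, ← mul_kronecker_mul,
    Matrix.one_mul, Matrix.mul_one]

theorem one_kronecker_mulVec_apply {R d n : Type*} [CommRing R] [Fintype d] [DecidableEq d]
    [Fintype n] (Q : Matrix n n R) (v : d × n → R) (l : d) (i : n) :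
    (kroneckerMap (· * ·) (1 : Matrix d d R) Q *ᵥ v) (l, i) =
      (Q *ᵥ fun a => v (l, a)) i := by
  simp [mulVec, dotProduct, Fintype.sum_prod_type, Matrix.one_apply]

theorem pencilEval_mul_mulVec {k R : Type*} [CommRing k] [CommRing R] [Algebra k R] {g d n : ℕ}
    (A : Fin g → Matrix (Fin d) (Fin d) k) (Q : Matrix (Fin n) (Fin n) R)
    (X : Fin g → Matrix (Fin n) (Fin n) R) (v : Fin d × Fin n → R)
    (hv : ∀ l, (Q *ᵥ fun a => v (l, a)) = fun a => v (l, a)) :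
    (pencilEval A fun j => X j * Q) *ᵥ v = pencilEval A X *ᵥ v := by
  have h := pencilEval_mul_mul A 1 Q X
  simp only [Matrix.one_mul] at h
  have hv' : kroneckerMap (· * ·) (1 : Matrix (Fin d) (Fin d) R) Q *ᵥ v = v := by
    ext ⟨l, i⟩
    rw [one_kronecker_mulVec_apply, hv]
  rw [h, one_kronecker_one, Matrix.one_mul, sub_mulVec, ← mulVec_mulVec, hv', sub_mulVec,
    sub_sub_cancel]

theorem pencilEval_conj_mulVec_eq_zero {k : Type*} [CommRing k] {g d n : ℕ}
    (A : Fin g → Matrix (Fin d) (Fin d) k) {S P : Matrix (Fin n) (Fin n) k} (hPS : P * S = 1)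
    (X : Fin g → Matrix (Fin n) (Fin n) k) (v : Fin d × Fin n → k)
    (hv : pencilEval A X *ᵥ v = 0) :
    (pencilEval A fun j => S * X j * P) *ᵥ
      (kroneckerMap (· * ·) (1 : Matrix (Fin d) (Fin d) k) S *ᵥ v) = 0 := by
  rw [pencilEval_mul_mul, sub_mulVec, one_mulVec, mulVec_mulVec, Matrix.mul_assoc,
    ← mul_kronecker_mul, hPS, Matrix.one_mul, one_kronecker_one, Matrix.mul_one, ← mulVec_mulVec,
    sub_mulVec, hv, one_mulVec, sub_zero, sub_self]

/-- If a divisor `p` of `det L` vanishes at a point `X` where the cofactor does not, and the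
kernel vector `v` of `L(X)` has coefficients fixed by `Q`, then `p` vanishes at `X Q`. -/
theorem tupleAeval_mul_eq_zero_of_mulVec_eq_zero {k : Type*} [Field k] {g d n e : ℕ}
    (A : Fin g → Matrix (Fin d) (Fin d) k) {p q : MvPolynomial (Fin g × Fin n × Fin n) k}
    (hf : (pencilEval A (genX k g n)).det = p ^ e * q) (Q : Matrix (Fin n) (Fin n) k)
    (X : Fin g → Matrix (Fin n) (Fin n) k) {v : Fin d × Fin n → k} (hv0 : v ≠ 0)
    (hv : pencilEval A X *ᵥ v = 0) (hQ : ∀ l, (Q *ᵥ fun a => v (l, a)) = fun a => v (l, a))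
    (hq : tupleAeval X q ≠ 0) : tupleAeval (fun j => X j * Q) p = 0 := by
  let c : k →ₐ[k] Polynomial k := Polynomial.CAlgHom
  let T : Matrix (Fin n) (Fin n) (Polynomial k) :=
    Q.map c + (Polynomial.X : Polynomial k) • (1 - Q).map c
  have hT : ∀ t : k, T.map (Polynomial.aeval t : Polynomial k →ₐ[k] k) = Q + t • (1 - Q) := by
    intro t
    ext a b
    simp [T, c]
  have hX : ∀ (t : k) (j : Fin g), ((X j).map c * T).map (Polynomial.aeval t) =
      X j * (Q + t • (1 - Q)) := by
    intro t j
    rw [Matrix.map_mul, hT]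
    congr 1
    ext a b
    simp [c]
  have hw : ∀ l, (T *ᵥ fun a => (c ∘ v) (l, a)) = fun a => (c ∘ v) (l, a) := by
    intro l
    have h1 : ∀ M : Matrix (Fin n) (Fin n) k, M.map c *ᵥ (fun a => (c ∘ v) (l, a)) =
        c ∘ (M *ᵥ fun a => v (l, a)) := by
      intro M
      ext1 i
      exact (RingHom.map_mulVec c.toRingHom M _ i).symm
    rw [add_mulVec, smul_mulVec, h1, h1, sub_mulVec, one_mulVec, hQ, sub_self]
    ext1 i
    simp
  have hdet : (pencilEval A fun j => (X j).map c * T).det = 0 := by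
    rw [← exists_mulVec_eq_zero_iff]
    refine ⟨c ∘ v, ?_, ?_⟩
    · intro h
      refine hv0 (funext fun i => ?_)
      simpa [c] using congrFun h i
    · rw [pencilEval_mul_mulVec A T _ _ hw]
      have h2 : (pencilEval A fun j => (X j).map c) = (pencilEval A X).map c := by
        ext ⟨a, b⟩ ⟨a', b'⟩
        simp [pencilEval, Matrix.sum_apply, Matrix.one_apply, apply_ite, -Prod.mk.injEq, c]
      ext1 i
      rw [h2]
      refine (RingHom.map_mulVec c.toRingHom (pencilEval A X) v i).symm.trans ?_
      rw [hv]
      simp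
  rw [← tupleAeval_det_pencilEval, hf, map_mul, map_pow] at hdet
  have hq' : tupleAeval (fun j => (X j).map c * T) q ≠ 0 := by
    intro h
    have h1 := congrArg (Polynomial.aeval (1 : k)) h
    rw [map_tupleAeval, map_zero] at h1
    simp only [hX, one_smul, add_sub_cancel, Matrix.mul_one] at h1
    exact hq h1
  have h1 := congrArg (Polynomial.aeval (0 : k)) (eq_zero_of_pow_eq_zero
    ((mul_eq_zero.1 hdet).resolve_right hq'))
  rw [map_tupleAeval, map_zero] at h1
  simpa only [hX, zero_smul, add_zero] using h1

theorem tupleAeval_fromBlocks_eq {k : Type*} [Field k] {g d n m : ℕ}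
    (A : Fin g → Matrix (Fin d) (Fin d) k) {p : MvPolynomial (Fin g × Fin n × Fin n) k}
    (hp : p ∣ (pencilEval A (genX k g n)).det) {S : Matrix (Fin n) (Fin m ⊕ Fin m) k}
    (hS : Sᵀ * S = 1) (Z C : Fin g → Matrix (Fin m) (Fin m) k) :
    tupleAeval (fun j => S * (fromBlocks (Z j) 0 (C j) 0 :
        Matrix (Fin m ⊕ Fin m) (Fin m ⊕ Fin m) k) * Sᵀ) p =
      tupleAeval (fun j => S * (fromBlocks (Z j) 0 0 0 :
        Matrix (Fin m ⊕ Fin m) (Fin m ⊕ Fin m) k) * Sᵀ) p := by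
  have hcancel : ∀ M N : Matrix (Fin m ⊕ Fin m) (Fin m ⊕ Fin m) k,
      (S * M * Sᵀ) * (S * N * Sᵀ) = S * (M * N) * Sᵀ := fun M N => by
    rw [Matrix.mul_assoc (S * M), ← Matrix.mul_assoc Sᵀ, ← Matrix.mul_assoc Sᵀ, hS]
    simp only [Matrix.one_mul, Matrix.mul_assoc]
  have h := tupleAeval_mul_idempotent A hp
    (Q := S * (fromBlocks 1 0 0 0 : Matrix (Fin m ⊕ Fin m) (Fin m ⊕ Fin m) k) * Sᵀ)
    (by simp [hcancel, fromBlocks_multiply])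
    (fun j => S * (fromBlocks (Z j) 0 (C j) 0 : Matrix (Fin m ⊕ Fin m) (Fin m ⊕ Fin m) k) * Sᵀ)
  simpa [hcancel, fromBlocks_multiply] using h

/-- An irreducible factor of `det L` vanishes at some tuple supported on the upper left corner of
size `m ≥ d`. -/
theorem exists_tupleAeval_fromBlocks_eq_zero {k : Type*} [Field k] [IsAlgClosed k] {g d n m : ℕ}
    (A : Fin g → Matrix (Fin d) (Fin d) k) {p : MvPolynomial (Fin g × Fin n × Fin n) k}
    (hp : Irreducible p) (hdvd : p ∣ (pencilEval A (genX k g n)).det)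
    {S : Matrix (Fin n) (Fin m ⊕ Fin m) k} (hS : Sᵀ * S = 1) (hdm : d ≤ m) :
    ∃ Z : Fin g → Matrix (Fin m) (Fin m) k,
      tupleAeval (fun j => S * (fromBlocks (Z j) 0 0 0 :
        Matrix (Fin m ⊕ Fin m) (Fin m ⊕ Fin m) k) * Sᵀ) p = 0 := by
  have hf0 : (pencilEval A (genX k g n)).det ≠ 0 := by
    simpa using det_pencilEval_genX_mul_ne_zero A (g := g) (n := n) 1
  obtain ⟨q, hf, hpq⟩ := (FiniteMultiplicity.of_not_isUnit hp.not_isUnit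
    hf0).exists_eq_pow_mul_and_not_dvd
  have hq : q ∣ (pencilEval A (genX k g n)).det := Dvd.intro_left _ hf.symm
  obtain ⟨x, hpx, hqx⟩ := exists_aeval_eq_zero_and_ne_zero hp.prime hpq
  let X : Fin g → Matrix (Fin n) (Fin n) k := fun j => Matrix.of fun a b => x (j, a, b)
  have hpX : tupleAeval X p = 0 := hpx
  have hqX : tupleAeval X q ≠ 0 := hqx
  obtain ⟨v, hv0, hv⟩ : ∃ v, v ≠ 0 ∧ pencilEval A X *ᵥ v = 0 := by
    rw [exists_mulVec_eq_zero_iff, ← tupleAeval_det_pencilEval]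
    obtain ⟨r, hr⟩ := hdvd
    rw [hr, map_mul, hpX, zero_mul]
  let U : Matrix (Fin n) (Fin m) k := S * (fromRows 1 0 : Matrix (Fin m ⊕ Fin m) (Fin m) k)
  let Q : Matrix (Fin n) (Fin n) k :=
    S * (fromBlocks 1 0 0 0 : Matrix (Fin m ⊕ Fin m) (Fin m ⊕ Fin m) k) * Sᵀ
  have hQQ : Q * Q = Q := by
    simp only [Q]
    rw [Matrix.mul_assoc (S * _), ← Matrix.mul_assoc Sᵀ, ← Matrix.mul_assoc Sᵀ, hS,
      Matrix.one_mul, ← Matrix.mul_assoc, Matrix.mul_assoc S, fromBlocks_multiply]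
    simp
  have hQU : Q * U = U := by
    simp only [Q, U]
    rw [Matrix.mul_assoc, ← Matrix.mul_assoc Sᵀ, hS, Matrix.one_mul, Matrix.mul_assoc]
    congr 1
    ext (i | i) j <;> simp [fromBlocks_mul_fromRows]
  have hU : Function.Injective U.mulVecLin := by
    have : (fromCols (1 : Matrix (Fin m) (Fin m) k) (0 : Matrix (Fin m) (Fin m) k) * Sᵀ) * U =
        1 := by
      simp only [U]
      rw [Matrix.mul_assoc, ← Matrix.mul_assoc Sᵀ, hS, Matrix.one_mul, fromCols_mul_fromRows]
      simp
    refine Function.LeftInverse.injective (g := fun w =>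
      (fromCols (1 : Matrix (Fin m) (Fin m) k) (0 : Matrix (Fin m) (Fin m) k) * Sᵀ) *ᵥ w)
      fun w => ?_
    simp only [mulVecLin_apply, mulVec_mulVec, this, one_mulVec]
  let V : Submodule k (Fin n → k) := Submodule.span k (Set.range fun l a => v (l, a))
  have hVW : Module.finrank k V ≤ Module.finrank k (LinearMap.range U.mulVecLin) := by
    rw [LinearMap.finrank_range_of_inj hU]
    have h1 : Module.finrank k V ≤ d := by
      refine (finrank_range_le_card (R := k) fun (l : Fin d) a => v (l, a)).trans_eq ?_
      simp
    simpa using h1.trans hdm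
  obtain ⟨E', hE', hEV⟩ := exists_sq_zero_add_mem V _ hVW
  let E := LinearMap.toMatrix' E'
  have hE : E * E = 0 := by
    rw [← LinearMap.toMatrix'_comp, hE', map_zero]
  have hinv : (1 - E) * (1 + E) = 1 := by
    rw [Matrix.sub_mul, Matrix.mul_add E, hE, Matrix.one_mul, Matrix.mul_one, add_zero,
      add_sub_cancel_right]
  let X₁ : Fin g → Matrix (Fin n) (Fin n) k := fun j => (1 + E) * X j * (1 - E)
  let v₁ := kroneckerMap (· * ·) (1 : Matrix (Fin d) (Fin d) k) (1 + E) *ᵥ v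
  have hv₁0 : v₁ ≠ 0 := by
    intro h
    refine hv0 ?_
    have h1 := congrArg
      (fun w => kroneckerMap (· * ·) (1 : Matrix (Fin d) (Fin d) k) (1 - E) *ᵥ w) h
    simpa [v₁, ← mul_kronecker_mul, hinv] using h1
  have hQv : ∀ l, (Q *ᵥ fun a => v₁ (l, a)) = fun a => v₁ (l, a) := by
    intro l
    have h1 : (fun a => v₁ (l, a)) ∈ LinearMap.range U.mulVecLin := by
      convert hEV (fun a => v (l, a)) (Submodule.subset_span ⟨l, rfl⟩) using 1
      ext a
      simp only [v₁]
      rw [one_kronecker_mulVec_apply, add_mulVec, one_mulVec, LinearMap.toMatrix'_mulVec]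
    obtain ⟨w, hw⟩ := h1
    rw [← hw, mulVecLin_apply, mulVec_mulVec, hQU]
  have hqX₁ : tupleAeval X₁ q ≠ 0 := by rwa [tupleAeval_one_add_conj A hq hE]
  have key := tupleAeval_mul_eq_zero_of_mulVec_eq_zero A hf Q X₁ hv₁0
    (pencilEval_conj_mulVec_eq_zero A hinv X v hv) hQv hqX₁
  rw [tupleAeval_mul_idempotent A hdvd hQQ] at key
  refine ⟨fun j => (Sᵀ * X₁ j * S).toBlocks₁₁, ?_⟩
  convert key using 3 with j
  have h2 : ∀ M : Matrix (Fin m ⊕ Fin m) (Fin m ⊕ Fin m) k,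
      fromBlocks M.toBlocks₁₁ 0 0 0 = fromBlocks 1 0 0 0 * M * fromBlocks 1 0 0 0 := by
    intro M
    conv_rhs => rw [← fromBlocks_toBlocks M, fromBlocks_multiply, fromBlocks_multiply]
    simp
  simp only [h2, Q, Matrix.mul_assoc]

/-- If `det (L(gX⁽ⁿ⁾) - A_{j'} A_{j''} ⊗ gY⁽ⁿ⁾)` is irreducible for all `n ≥ n₀`, where
`n₀ ≥ max (d² - 1) 1`, then `det L(gX⁽ⁿ⁾)` is irreducible for all `n ≥ 2 n₀`. -/
theorem det_pencil_irreducible_of_perturbed_irreducible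
    {k : Type*} [Field k] [IsAlgClosed k] [CharZero k]
    {g d : ℕ} (A : Fin g → Matrix (Fin d) (Fin d) k) (j' j'' : Fin g)
    (n₀ : ℕ) (hn₀ : max (d ^ 2 - 1) 1 ≤ n₀)
    (hirr : ∀ n ≥ n₀,
      Irreducible
        (pencilEval A (genX' k g n) -
          Matrix.kroneckerMap (· * ·)
            ((A j' * A j'').map fun a =>
              algebraMap k (MvPolynomial ((Fin g × Fin n × Fin n) ⊕ (Fin n × Fin n)) k) a)
            (genY k g n)).det) :
    ∀ n ≥ 2 * n₀, Irreducible (pencilEval A (genX k g n)).det := by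
  intro n hn
  let R := MvPolynomial ((Fin g × Fin n₀ × Fin n₀) ⊕ (Fin n₀ × Fin n₀)) k
  have hd : d ≤ n₀ := by
    obtain ⟨h1, h2⟩ := max_le_iff.1 hn₀
    rcases Nat.lt_or_ge d 2 with h | h
    · omega
    · have : d ^ 2 ≤ n₀ + 1 := by omega
      nlinarith
  obtain ⟨f⟩ : Nonempty (Fin n₀ ⊕ Fin n₀ ↪ Fin n) := by
    apply Function.Embedding.nonempty_of_card_le
    simp
    omega
  let S : Matrix (Fin n) (Fin n₀ ⊕ Fin n₀) k := (1 : Matrix (Fin n) (Fin n) k).submatrix id f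
  have hS : Sᵀ * S = 1 := by
    ext a b
    simp [S, Matrix.mul_apply, Matrix.one_apply, f.injective.eq_iff, eq_comm]
  let c : k →+* R := algebraMap k R
  have hSc : (S.map c)ᵀ * S.map c = 1 := by
    rw [← Matrix.transpose_map, ← Matrix.map_mul, hS, Matrix.map_one _ (map_zero c) (map_one c)]
  let M : Fin g → Matrix (Fin n₀ ⊕ Fin n₀) (Fin n₀ ⊕ Fin n₀) R := fun j =>
    fromBlocks (genX' k g n₀ j) (if j = j' then genY k g n₀ else 0) (if j = j'' then 1 else 0) 0
  let Φ : MvPolynomial (Fin g × Fin n × Fin n) k →ₐ[k] R :=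
    tupleAeval fun j => S.map c * M j * (S.map c)ᵀ
  have hΦ : Irreducible (Φ (pencilEval A (genX k g n)).det) := by
    convert hirr n₀ le_rfl using 1
    rw [tupleAeval_det_pencilEval]
    refine (det_one_sub_sum_kronecker_conj _ _ _ _).trans ?_
    simp only [hSc, Matrix.mul_one]
    refine (det_one_sub_sum_kronecker_fromBlocks _ _ _ _ _).trans ?_
    rw [← Matrix.map_mul]
    rfl
  have hunit : ∀ a, a ∣ (pencilEval A (genX k g n)).det → IsUnit (Φ a) → IsUnit a := by
    intro a ha hΦa
    by_contra hau
    have ha0 : a ≠ 0 := by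
      rintro rfl
      exact not_isUnit_zero (map_zero Φ ▸ hΦa)
    obtain ⟨p, hp, hpa⟩ := WfDvdMonoid.exists_irreducible_factor hau ha0
    have hpf := hpa.trans ha
    obtain ⟨Z, hZ⟩ := exists_tupleAeval_fromBlocks_eq_zero A hp hpf hS hd
    rw [← tupleAeval_fromBlocks_eq A hpf hS Z fun j => if j = j'' then 1 else 0] at hZ
    let ρ : R →ₐ[k] k := MvPolynomial.aeval (Sum.elim (fun i => Z i.1 i.2.1 i.2.2) 0)
    have hρS : (S.map c).map ρ = S := by
      ext a b
      simp [c, AlgHom.commutes]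
    have hρM : ∀ j, (M j).map ρ =
        fromBlocks (Z j) 0 (if j = j'' then 1 else 0) 0 := by
      intro j
      simp only [M, fromBlocks_map]
      congr 1
      · ext a b
        exact aeval_X _ (Sum.inl (j, a, b))
      · split_ifs
        · ext a b
          exact aeval_X _ (Sum.inr (a, b))
        · exact Matrix.map_zero _ (map_zero ρ)
      · split_ifs
        · exact Matrix.map_one _ (map_zero ρ) (map_one ρ)
        · exact Matrix.map_zero _ (map_zero ρ)
    have hρ : ρ (Φ p) = 0 := by
      simp only [Φ]
      rw [map_tupleAeval, ← hZ]
      congr 2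
      funext j
      rw [Matrix.map_mul, Matrix.map_mul, Matrix.transpose_map, hρS, hρM]
    have hΦp : IsUnit (Φ p) := isUnit_of_dvd_unit (map_dvd Φ hpa) hΦa
    exact not_isUnit_zero (hρ ▸ hΦp.map ρ)
  refine ⟨fun h => hΦ.not_isUnit (h.map Φ), fun a b hab => ?_⟩
  rcases hΦ.isUnit_or_isUnit (by rw [hab, map_mul]) with h | h
  · exact Or.inl (hunit a (hab ▸ dvd_mul_right a b) h)
  · exact Or.inr (hunit b (hab ▸ dvd_mul_left b a) h)
end
end

section
/- Let k be an algebraically closed field of characteristic zero. For t ∈ k let φ_t : k⟨x₁,…,x_g⟩ → k⟨x₁,…,x_g⟩ be the unital k-algebra endomorphism with φ_t(x_j) = t·x_j for all j; call h ∈ k⟨x⟩ homogeneous of degree δ if φ_t(h) = t^δ·h for all t ∈ k. If h₁, h₂ ∈ k⟨x₁,…,x_g⟩ are nonzero, h₁ is homogeneous of degree δ₁, h₂ is homogeneous of degree δ₂, and h₁ and h₂ are stably associated, then there exists λ ∈ k∖{0} with h₂ = λ·h₁. -/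
open Matrix MvPolynomial

noncomputable section

/-- Evaluation of a noncommutative polynomial at a `g`-tuple of matrices. -/
def scalarEval {k : Type*} [CommRing k] {g n : ℕ} {R : Type*} [CommRing R] [Algebra k R]
    (f : FreeAlgebra k (Fin g)) (X : Fin g → Matrix (Fin n) (Fin n) R) :
    Matrix (Fin n) (Fin n) R :=
  FreeAlgebra.lift k X f

/-- A constant (scalar) element of the free algebra. -/
def IsConstant {k : Type*} [CommRing k] {g : ℕ} (p : FreeAlgebra k (Fin g)) : Prop :=
  ∃ c : k, p = algebraMap k (FreeAlgebra k (Fin g)) c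

/-- An atom of the free algebra: a nonconstant element that is not a product of two
nonconstant elements. -/
def ScalarAtom {k : Type*} [CommRing k] {g : ℕ} (p : FreeAlgebra k (Fin g)) : Prop :=
  ¬IsConstant p ∧ ∀ u v : FreeAlgebra k (Fin g), p = u * v → IsConstant u ∨ IsConstant v

/-- The block-diagonal sum `p ⊕ I_e ∈ M_{1+e}(k⟨x⟩)`. -/
def scalarDSum {k : Type*} [CommRing k] {g : ℕ} (p : FreeAlgebra k (Fin g)) (e : ℕ) :
    Matrix (Fin (1 + e)) (Fin (1 + e)) (FreeAlgebra k (Fin g)) :=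
  Matrix.reindex finSumFinEquiv finSumFinEquiv
    (Matrix.fromBlocks (Matrix.diagonal fun _ : Fin 1 => p) 0 0 1)

/-- Stable associativity of elements of the free algebra: `p ⊕ I_e = P (q ⊕ I_e) Q` for some
`e` and invertible `P, Q ∈ M_{1+e}(k⟨x⟩)`. -/
def StablyAssociatedScalar {k : Type*} [CommRing k] {g : ℕ}
    (p q : FreeAlgebra k (Fin g)) : Prop :=
  ∃ (e : ℕ) (P Q : Matrix (Fin (1 + e)) (Fin (1 + e)) (FreeAlgebra k (Fin g))),
    IsUnit P ∧ IsUnit Q ∧ scalarDSum p e = P * scalarDSum q e * Q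

/-- The algebra homomorphism `x_j ↦ x_j T` into polynomials over the free algebra; its
coefficients are the homogeneous components. -/
def homogenization (k : Type*) [Field k] (g : ℕ) :
    FreeAlgebra k (Fin g) →ₐ[k] Polynomial (FreeAlgebra k (Fin g)) :=
  FreeAlgebra.lift k fun j => Polynomial.C (FreeAlgebra.ι k j) * Polynomial.X

section Homogenization

variable {k : Type*} [Field k] {g : ℕ}

theorem homogenization_ι (j : Fin g) :
    homogenization k g (FreeAlgebra.ι k j) =
      Polynomial.C (FreeAlgebra.ι k j) * Polynomial.X := by
  simp [homogenization]

theorem homogenization_coeff_zero (a : FreeAlgebra k (Fin g)) :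
    (homogenization k g a).coeff 0 =
      algebraMap k _ (FreeAlgebra.algebraMapInv a) := by
  induction a using FreeAlgebra.induction with
  | grade0 r => simp [Polynomial.algebraMap_apply, FreeAlgebra.algebraMapInv]
  | grade1 j => simp [homogenization_ι, FreeAlgebra.algebraMapInv]
  | mul a b ha hb => simp [Polynomial.mul_coeff_zero, ha, hb]
  | add a b ha hb => simp [ha, hb]

theorem homogenization_coeff_scale (t : k) (a : FreeAlgebra k (Fin g)) (i : ℕ) :
    (homogenization k g (FreeAlgebra.lift k (fun j => t • FreeAlgebra.ι k j) a)).coeff i =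
      t ^ i • (homogenization k g a).coeff i := by
  induction a using FreeAlgebra.induction generalizing i with
  | grade0 r =>
    rcases i with _ | i <;> simp [Polynomial.algebraMap_apply, Polynomial.coeff_C]
  | grade1 j =>
    simp only [FreeAlgebra.lift_ι_apply, map_smul, homogenization_ι, Polynomial.coeff_smul,
      Polynomial.coeff_C_mul, Polynomial.coeff_X]
    by_cases h : 1 = i
    · subst h; simp
    · simp [h]
  | mul a b ha hb =>
    simp only [map_mul, Polynomial.coeff_mul, Finset.smul_sum, ha, hb]
    refine Finset.sum_congr rfl fun x hx => ?_
    rw [← Finset.HasAntidiagonal.mem_antidiagonal.mp hx, smul_mul_smul_comm, pow_add]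
  | add a b ha hb => simp [ha, hb]

theorem homogenization_eval_one (a : FreeAlgebra k (Fin g)) :
    (homogenization k g a).eval 1 = a := by
  change Polynomial.eval₂RingHom' (RingHom.id _) 1 (fun _ => Commute.one_right _)
    (homogenization k g a) = a
  induction a using FreeAlgebra.induction with
  | grade0 r => simp [Polynomial.algebraMap_apply, Polynomial.eval₂RingHom']
  | grade1 j => simp [homogenization_ι, Polynomial.eval₂RingHom']
  | mul a b ha hb => rw [map_mul, map_mul, ha, hb]
  | add a b ha hb => rw [map_add, map_add, ha, hb]

theorem homogenization_of_homogeneous [CharZero k] {p : FreeAlgebra k (Fin g)} {δ : ℕ}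
    (hp : ∀ t : k, FreeAlgebra.lift k (fun j => t • FreeAlgebra.ι k j) p = t ^ δ • p) :
    homogenization k g p = Polynomial.C p * Polynomial.X ^ δ := by
  have hcoeff : ∀ i, i ≠ δ → (homogenization k g p).coeff i = 0 := by
    intro i hi
    have h := homogenization_coeff_scale 2 p i
    rw [hp, map_smul, Polynomial.coeff_smul, ← sub_eq_zero, ← sub_smul, smul_eq_zero] at h
    refine h.resolve_left fun h2 => hi ?_
    have h3 : (2 : k) ^ δ = 2 ^ i := sub_eq_zero.mp h2
    exact (Nat.pow_right_injective le_rfl (by exact_mod_cast h3)).symm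
  have hmon : homogenization k g p =
      Polynomial.C ((homogenization k g p).coeff δ) * Polynomial.X ^ δ := by
    ext1 i
    rw [Polynomial.coeff_C_mul, Polynomial.coeff_X_pow]
    by_cases hi : i = δ
    · simp [hi]
    · simp [hi, hcoeff i hi]
  have heval := homogenization_eval_one p
  rw [hmon, Polynomial.C_mul_X_pow_eq_monomial, Polynomial.eval_monomial, one_pow, mul_one]
    at heval
  rw [hmon, heval]

theorem homogeneous_eq_algebraMap_of_algebraMapInv_ne_zero [CharZero k]
    {p : FreeAlgebra k (Fin g)} {δ : ℕ}
    (hp : ∀ t : k, FreeAlgebra.lift k (fun j => t • FreeAlgebra.ι k j) p = t ^ δ • p)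
    (h0 : FreeAlgebra.algebraMapInv p ≠ 0) :
    p = algebraMap k _ (FreeAlgebra.algebraMapInv p) := by
  have h := homogenization_coeff_zero p
  rw [homogenization_of_homogeneous hp, Polynomial.coeff_C_mul, Polynomial.coeff_X_pow] at h
  by_cases hδ : 0 = δ
  · simpa [hδ] using h
  · rw [if_neg hδ, mul_zero] at h
    exact absurd (FreeAlgebra.algebraMap_leftInverse.injective (h.symm.trans (map_zero _).symm)) h0

/-- The homogeneous component of lowest degree in a relation `a q = p b`. -/
theorem homogeneous_lowest_component [CharZero k] {p q a b : FreeAlgebra k (Fin g)} {m n : ℕ}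
    (hp : ∀ t : k, FreeAlgebra.lift k (fun j => t • FreeAlgebra.ι k j) p = t ^ m • p)
    (hq : ∀ t : k, FreeAlgebra.lift k (fun j => t • FreeAlgebra.ι k j) q = t ^ n • q)
    (hq0 : q ≠ 0) (hab : a * q = p * b) (ha : FreeAlgebra.algebraMapInv a ≠ 0) :
    m ≤ n ∧ (m = n →
      FreeAlgebra.algebraMapInv a • q = FreeAlgebra.algebraMapInv b • p) := by
  have h := congrArg (fun x => (homogenization k g x).coeff n) hab
  simp only [map_mul, homogenization_of_homogeneous hp, homogenization_of_homogeneous hq] at h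
  rw [← mul_assoc, Polynomial.coeff_mul_X_pow', if_pos le_rfl, Nat.sub_self,
    Polynomial.coeff_mul_C, homogenization_coeff_zero, ← Algebra.smul_def, mul_assoc,
    Polynomial.coeff_C_mul, Polynomial.coeff_X_pow_mul'] at h
  constructor
  · by_contra hmn
    rw [if_neg hmn, mul_zero] at h
    exact (smul_ne_zero ha hq0) h
  · rintro rfl
    rw [if_pos le_rfl, Nat.sub_self, homogenization_coeff_zero, ← Algebra.commutes,
      ← Algebra.smul_def] at h
    exact h

theorem scalarDSum_eq_diagonal (p : FreeAlgebra k (Fin g)) (e : ℕ) :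
    scalarDSum p e = Matrix.diagonal fun i => if i = Fin.castAdd e 0 then p else 1 := by
  have h : ∀ j : Fin e, Fin.natAdd 1 j ≠ Fin.castAdd e 0 := fun j hj => by
    have := congrArg Fin.val hj
    simp at this
  ext i j
  induction i using Fin.addCases <;> induction j using Fin.addCases <;>
    simp [scalarDSum, Matrix.diagonal_apply, h, (h _).symm, Matrix.one_apply,
      Subsingleton.elim _ (0 : Fin 1)]

/-- Stable association yields a comaximal relation: `a q = p b`, `a c ≡ 1` modulo `p A`. -/
theorem exists_comaximal_of_intertwining {e : ℕ} {p q : FreeAlgebra k (Fin g)}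
    {P P' Q' : Matrix (Fin (1 + e)) (Fin (1 + e)) (FreeAlgebra k (Fin g))} (hP : P * P' = 1)
    (h : P * scalarDSum q e = scalarDSum p e * Q') :
    P (Fin.castAdd e 0) (Fin.castAdd e 0) * q = p * Q' (Fin.castAdd e 0) (Fin.castAdd e 0) ∧
    ∃ s, P (Fin.castAdd e 0) (Fin.castAdd e 0) * P' (Fin.castAdd e 0) (Fin.castAdd e 0) +
      p * s = 1 := by
  set z : Fin (1 + e) := Fin.castAdd e 0 with hz
  have hent : ∀ j, P z j * (if j = z then q else 1) = p * Q' z j := fun j => by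
    have := congrFun (congrFun h z) j
    simpa [scalarDSum_eq_diagonal, Matrix.mul_diagonal, Matrix.diagonal_mul, ← hz] using this
  refine ⟨by simpa using hent z, ∑ j ∈ Finset.univ.erase z, Q' z j * P' j z, ?_⟩
  have h1 := congrFun (congrFun hP z) z
  rw [Matrix.mul_apply, Matrix.one_apply_eq, ← Finset.add_sum_erase _ _ (Finset.mem_univ z)] at h1
  rw [← h1, Finset.mul_sum]
  congr 1
  refine Finset.sum_congr rfl fun j hj => ?_
  have hj' := hent j
  rw [if_neg (Finset.ne_of_mem_erase hj), mul_one] at hj'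
  rw [hj', mul_assoc]

end Homogenization

/-- If two nonzero homogeneous elements of the free algebra are stably associated, then they
differ by a nonzero scalar multiple. -/
theorem homogeneous_stablyAssociated
    {k : Type*} [Field k] [IsAlgClosed k] [CharZero k] {g : ℕ}
    (h₁ h₂ : FreeAlgebra k (Fin g)) (hne₁ : h₁ ≠ 0) (hne₂ : h₂ ≠ 0)
    (δ₁ δ₂ : ℕ)
    (hhom₁ : ∀ t : k,
      FreeAlgebra.lift k (fun j => t • FreeAlgebra.ι k j) h₁ = t ^ δ₁ • h₁)
    (hhom₂ : ∀ t : k,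
      FreeAlgebra.lift k (fun j => t • FreeAlgebra.ι k j) h₂ = t ^ δ₂ • h₂)
    (hsa : StablyAssociatedScalar h₁ h₂) :
    ∃ lam : k, lam ≠ 0 ∧ h₂ = lam • h₁ := by
  obtain ⟨e, P, Q, ⟨P, rfl⟩, ⟨Q, rfl⟩, hPQ⟩ := hsa
  have hl : P.1 * scalarDSum h₂ e = scalarDSum h₁ e * (Q⁻¹).1 := by
    rw [hPQ, mul_assoc _ Q.1, Q.mul_inv, mul_one]
  have hr : (P⁻¹).1 * scalarDSum h₁ e = scalarDSum h₂ e * Q.1 := by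
    rw [hPQ, mul_assoc, ← mul_assoc, P.inv_mul, one_mul]
  obtain ⟨hab, s, hs⟩ := exists_comaximal_of_intertwining P.mul_inv hl
  obtain ⟨hcd, s', hs'⟩ := exists_comaximal_of_intertwining P.inv_mul hr
  generalize P.1 (Fin.castAdd e 0) (Fin.castAdd e 0) = a at *
  generalize (P⁻¹).1 (Fin.castAdd e 0) (Fin.castAdd e 0) = c at *
  suffices h : ∃ lam : k, h₂ = lam • h₁ by
    obtain ⟨lam, h⟩ := h
    exact ⟨lam, fun h0 => hne₂ (by rw [h, h0, zero_smul]), h⟩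
  have hε := congrArg FreeAlgebra.algebraMapInv hs
  have hε' := congrArg FreeAlgebra.algebraMapInv hs'
  simp only [map_add, map_mul, map_one] at hε hε'
  by_cases hunit : FreeAlgebra.algebraMapInv h₁ ≠ 0 ∧ FreeAlgebra.algebraMapInv h₂ ≠ 0
  · have e₁ := homogeneous_eq_algebraMap_of_algebraMapInv_ne_zero hhom₁ hunit.1
    have e₂ := homogeneous_eq_algebraMap_of_algebraMapInv_ne_zero hhom₂ hunit.2
    refine ⟨FreeAlgebra.algebraMapInv h₂ / FreeAlgebra.algebraMapInv h₁, ?_⟩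
    conv_rhs => rw [e₁]
    rw [Algebra.smul_def, ← map_mul, FreeAlgebra.algebraMap_leftInverse,
      div_mul_cancel₀ _ hunit.1, ← e₂]
  · have hac : FreeAlgebra.algebraMapInv a * FreeAlgebra.algebraMapInv c = 1 := by
      by_cases h0 : FreeAlgebra.algebraMapInv h₁ = 0
      · simpa [h0] using hε
      · have h0' : FreeAlgebra.algebraMapInv h₂ = 0 := by
          by_contra h
          exact hunit ⟨h0, h⟩
        rw [mul_comm]
        simpa [h0'] using hε'
    have ha := left_ne_zero_of_mul_eq_one hac
    have hc := right_ne_zero_of_mul_eq_one hac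
    obtain ⟨hle, heq⟩ := homogeneous_lowest_component hhom₁ hhom₂ hne₂ hab ha
    obtain ⟨hge, -⟩ := homogeneous_lowest_component hhom₂ hhom₁ hne₁ hcd hc
    refine ⟨(FreeAlgebra.algebraMapInv a)⁻¹ * FreeAlgebra.algebraMapInv
      ((Q⁻¹).1 (Fin.castAdd e 0) (Fin.castAdd e 0)), ?_⟩
    rw [mul_smul, ← heq (le_antisymm hle hge), inv_smul_smul₀ ha]
end
end

section
/- Let k be an algebraically closed field of characteristic zero and let f ∈ M_d(k⟨x₁,…,x_g⟩) be an atom with f(0) = I_d (evaluation at the zero scalar tuple). Then there exist d' ∈ ℕ and an irreducible monic linear pencil L = I_{d'} − Σ_{j=1}^g A_j x_j (i.e. A₁,…,A_g ∈ M_{d'}(k) generate M_{d'}(k) as a unital k-algebra), regarded as an element of M_{d'}(k⟨x⟩), such that f and L are stably associated. -/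
open Matrix MvPolynomial

noncomputable section

/-- Entrywise evaluation of a `d × d` matrix over the free algebra at a `g`-tuple of
`n × n` matrices over a commutative `k`-algebra `R`, as a `(dn) × (dn)` matrix. -/
def matEval {k : Type*} [CommRing k] {g d n : ℕ} {R : Type*} [CommRing R] [Algebra k R]
    (f : Matrix (Fin d) (Fin d) (FreeAlgebra k (Fin g)))
    (X : Fin g → Matrix (Fin n) (Fin n) R) :
    Matrix (Fin d × Fin n) (Fin d × Fin n) R :=
  Matrix.of fun p q => (FreeAlgebra.lift k X (f p.1 q.1)) p.2 q.2

/-- An atom of a matrix ring: a non-invertible element that is not a product of two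
non-invertible elements. -/
def MatAtom {R : Type*} [Ring R] {d : ℕ} (f : Matrix (Fin d) (Fin d) R) : Prop :=
  ¬IsUnit f ∧ ∀ u v : Matrix (Fin d) (Fin d) R, f = u * v → IsUnit u ∨ IsUnit v

/-- The block-diagonal sum `f ⊕ I_e`. -/
def dSum {R : Type*} [Ring R] {d : ℕ} (f : Matrix (Fin d) (Fin d) R) (e : ℕ) :
    Matrix (Fin (d + e)) (Fin (d + e)) R :=
  Matrix.reindex finSumFinEquiv finSumFinEquiv (Matrix.fromBlocks f 0 0 1)

/-- Stable associativity of square matrices over a ring. -/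
def StablyAssociated {R : Type*} [Ring R] {d₁ d₂ : ℕ}
    (f₁ : Matrix (Fin d₁) (Fin d₁) R) (f₂ : Matrix (Fin d₂) (Fin d₂) R) : Prop :=
  ∃ (e₁ e₂ : ℕ) (h : d₁ + e₁ = d₂ + e₂)
    (P Q : Matrix (Fin (d₁ + e₁)) (Fin (d₁ + e₁)) R),
    IsUnit P ∧ IsUnit Q ∧
      dSum f₁ e₁ = P * Matrix.reindex (finCongr h).symm (finCongr h).symm (dSum f₂ e₂) * Q

/-- A monic linear pencil as a matrix over the free algebra. -/
def pencilMat {k : Type*} [CommRing k] {g d : ℕ} (A : Fin g → Matrix (Fin d) (Fin d) k) :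
    Matrix (Fin d) (Fin d) (FreeAlgebra k (Fin g)) :=
  1 - ∑ j, (A j).map fun a => a • FreeAlgebra.ι k j

theorem Matrix.isUnit_one_add_vecMulVec {R α : Type*} [Ring R] [Fintype α] [DecidableEq α]
    {u v : α → R} (h : v ⬝ᵥ u = 0) : IsUnit (1 + vecMulVec u v) := by
  refine IsNilpotent.isUnit_one_add ⟨2, ?_⟩
  rw [pow_two, vecMulVec_mul_vecMulVec, h]
  ext
  simp [vecMulVec_apply]

theorem Matrix.vecMul_one_add_vecMulVec {R α : Type*} [Ring R] [Fintype α] [DecidableEq α]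
    (a u v : α → R) : a ᵥ* (1 + vecMulVec u v) = a + fun q => (a ⬝ᵥ u) * v q := by
  rw [vecMul_add, vecMul_one]
  congr 1
  ext q
  simp [vecMul, dotProduct, vecMulVec_apply, Finset.sum_mul, mul_assoc]

/-- A row with an entry equal to one is equivalent to a coordinate row. -/
theorem Matrix.exists_isUnit_vecMul_eq_single_of_eq_one {R α : Type*} [Ring R] [Fintype α]
    [DecidableEq α] (o i : α) (a : α → R) (ha : a i = 1) :
    ∃ W : Matrix α α R, IsUnit W ∧ a ᵥ* W = Pi.single o 1 := by
  have key : ∀ a : α → R, a o = 1 →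
      ∃ W : Matrix α α R, IsUnit W ∧ a ᵥ* W = Pi.single o 1 := fun a ha =>
    ⟨1 + vecMulVec (Pi.single o 1) (Pi.single o 1 - a),
      isUnit_one_add_vecMulVec (by simp [ha]), by
        rw [vecMul_one_add_vecMulVec]
        ext q
        simp [ha]⟩
  by_cases hio : i = o
  · exact key a (hio ▸ ha)
  · have hW₁ : IsUnit (1 + vecMulVec (Pi.single i (1 - a o)) (Pi.single o 1) : Matrix α α R) :=
      isUnit_one_add_vecMulVec (by simp [Ne.symm hio])
    obtain ⟨W, hW, h⟩ := key (a ᵥ* (1 + vecMulVec (Pi.single i (1 - a o)) (Pi.single o 1)))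
      (by rw [vecMul_one_add_vecMulVec]; simp [ha])
    exact ⟨_, hW₁.mul hW, by rw [← vecMul_vecMul, h]⟩

namespace FreeAlgebra

variable {k : Type*} [Field k] {g : ℕ}

/-- Evaluation of a noncommutative polynomial at the zero tuple. -/
abbrev evalZero (k : Type*) [Field k] (g : ℕ) : FreeAlgebra k (Fin g) →ₐ[k] k :=
  FreeAlgebra.lift k fun _ : Fin g => (0 : k)

/-- The representation `a ↦ !![a, ∂ⱼ a; 0, a(0)]` of the free algebra. -/
def transductionRep (j : Fin g) :
    FreeAlgebra k (Fin g) →ₐ[k] Matrix (Fin 2) (Fin 2) (FreeAlgebra k (Fin g)) :=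
  FreeAlgebra.lift k fun i => !![ι k i, if i = j then 1 else 0; 0, 0]

/-- The right transduction `∂ⱼ` of the free algebra: the linear map which sends a word `w xⱼ`
to `w` and every word not ending in `xⱼ` to `0`. -/
def transduction (j : Fin g) : FreeAlgebra k (Fin g) →ₗ[k] FreeAlgebra k (Fin g) where
  toFun a := transductionRep j a 0 1
  map_add' a b := by simp
  map_smul' c a := by simp

theorem transductionRep_eq (j : Fin g) (a : FreeAlgebra k (Fin g)) :
    transductionRep j a =
      !![a, transduction j a; 0, algebraMap k _ (evalZero k g a)] := by
  have h : transductionRep j a 0 0 = a ∧ transductionRep j a 1 0 = 0 ∧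
      transductionRep j a 1 1 = algebraMap k _ (evalZero k g a) := by
    induction a using FreeAlgebra.induction with
    | grade0 r => simp [Matrix.algebraMap_matrix_apply]
    | grade1 i => simp [transductionRep]
    | mul a b ha hb =>
      obtain ⟨a0, a1, a2⟩ := ha
      obtain ⟨b0, b1, b2⟩ := hb
      simp [Matrix.mul_apply, Fin.sum_univ_two, *]
    | add a b ha hb => simp [*]
  ext p q
  fin_cases p <;> fin_cases q <;> simp [h, transduction]

@[simp]
theorem transduction_algebraMap (j : Fin g) (r : k) :
    transduction j (algebraMap k (FreeAlgebra k (Fin g)) r) = 0 := by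
  simp [transduction, Matrix.algebraMap_matrix_apply]

@[simp]
theorem transduction_ι (j i : Fin g) :
    transduction j (ι k i) = if i = j then 1 else 0 := by
  simp [transduction, transductionRep]

theorem transduction_mul (j : Fin g) (a b : FreeAlgebra k (Fin g)) :
    transduction j (a * b) =
      a * transduction j b + transduction j a * algebraMap k _ (evalZero k g b) := by
  have h := congrFun (congrFun (map_mul (transductionRep j) a b) 0) 1
  rw [transductionRep_eq, transductionRep_eq, transductionRep_eq] at h
  simpa [Matrix.mul_apply, Fin.sum_univ_two] using h

theorem eq_evalZero_add_sum (a : FreeAlgebra k (Fin g)) :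
    a = algebraMap k _ (evalZero k g a) + ∑ j, transduction j a * ι k j := by
  induction a using FreeAlgebra.induction with
  | grade0 r => simp
  | grade1 i => simp
  | mul a b ha hb =>
    simp only [transduction_mul, map_mul, add_mul, Finset.sum_add_distrib, mul_assoc]
    conv_lhs => rw [hb, mul_add, Finset.mul_sum]
    conv_lhs => enter [1]; rw [ha]
    simp only [add_mul, Finset.sum_mul, mul_assoc, (Algebra.commutes _ _ : _ = ι k _ * _)]
    abel
  | add a b ha hb =>
    simp only [map_add, add_mul, Finset.sum_add_distrib]
    conv_lhs => rw [ha, hb]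
    abel

/-- The subspace of noncommutative polynomials of degree less than `n`. -/
def degLT (k : Type*) [Field k] (g : ℕ) : ℕ → Submodule k (FreeAlgebra k (Fin g))
  | 0 => ⊥
  | n + 1 => ⨅ j, (degLT k g n).comap (transduction j)

theorem mem_degLT_zero {a : FreeAlgebra k (Fin g)} : a ∈ degLT k g 0 ↔ a = 0 := by
  simp [degLT]

theorem mem_degLT_succ {n : ℕ} {a : FreeAlgebra k (Fin g)} :
    a ∈ degLT k g (n + 1) ↔ ∀ j, transduction j a ∈ degLT k g n := by
  simp [degLT]

theorem degLT_le_succ (n : ℕ) : degLT k g n ≤ degLT k g (n + 1) := by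
  induction n with
  | zero => simp [degLT]
  | succ n ih =>
    intro a ha
    rw [mem_degLT_succ] at ha ⊢
    exact fun j => ih (ha j)

theorem degLT_mono : Monotone (degLT k g) := monotone_nat_of_le_succ degLT_le_succ

theorem transduction_mem_degLT {n : ℕ} {a : FreeAlgebra k (Fin g)} (j : Fin g)
    (ha : a ∈ degLT k g n) : transduction j a ∈ degLT k g (n - 1) := by
  cases n with
  | zero => simp_all [mem_degLT_zero]
  | succ n => exact mem_degLT_succ.1 ha j

theorem mem_degLT_one {a : FreeAlgebra k (Fin g)} :
    a ∈ degLT k g 1 ↔ a = algebraMap k _ (evalZero k g a) := by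
  rw [mem_degLT_succ]
  simp only [mem_degLT_zero]
  constructor
  · intro h
    conv_lhs => rw [eq_evalZero_add_sum a]
    simp [h]
  · intro h j
    rw [h, transduction_algebraMap]

theorem algebraMap_mem_degLT_one (r : k) : algebraMap k _ r ∈ degLT k g 1 := by
  simp [mem_degLT_one]

theorem ι_mem_degLT_two (i : Fin g) : ι k i ∈ degLT k g 2 := by
  rw [mem_degLT_succ]
  intro j
  rw [transduction_ι]
  split_ifs
  · simpa using algebraMap_mem_degLT_one (g := g) (1 : k)
  · exact zero_mem _

theorem mul_algebraMap_mem_degLT {n : ℕ} {a : FreeAlgebra k (Fin g)} (ha : a ∈ degLT k g n)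
    (r : k) : a * algebraMap k _ r ∈ degLT k g n := by
  rw [← Algebra.commutes, ← Algebra.smul_def]
  exact Submodule.smul_mem _ _ ha

theorem mul_mem_degLT {m n : ℕ} {a b : FreeAlgebra k (Fin g)} (ha : a ∈ degLT k g m)
    (hb : b ∈ degLT k g n) : a * b ∈ degLT k g (m + n) := by
  induction n generalizing b with
  | zero => rw [mem_degLT_zero] at hb; simp [hb]
  | succ n ih =>
    rw [← add_assoc, mem_degLT_succ]
    intro j
    rw [transduction_mul]
    refine add_mem (ih (mem_degLT_succ.1 hb j)) (mul_algebraMap_mem_degLT ?_ _)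
    exact degLT_mono (by omega) (transduction_mem_degLT j ha)

theorem exists_mem_degLT (a : FreeAlgebra k (Fin g)) : ∃ n, a ∈ degLT k g n := by
  induction a using FreeAlgebra.induction with
  | grade0 r => exact ⟨1, algebraMap_mem_degLT_one r⟩
  | grade1 i => exact ⟨2, ι_mem_degLT_two i⟩
  | mul a b ha hb =>
    obtain ⟨m, hm⟩ := ha
    obtain ⟨n, hn⟩ := hb
    exact ⟨m + n, mul_mem_degLT hm hn⟩
  | add a b ha hb =>
    obtain ⟨m, hm⟩ := ha
    obtain ⟨n, hn⟩ := hb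
    exact ⟨m + n, add_mem (degLT_mono (by omega) hm) (degLT_mono (by omega) hn)⟩

theorem exists_forall_mem_degLT {α : Type*} [Finite α] (a : α → FreeAlgebra k (Fin g)) :
    ∃ n, ∀ i, a i ∈ degLT k g n := by
  cases nonempty_fintype α
  choose n hn using fun i => exists_mem_degLT (a i)
  exact ⟨∑ i, n i, fun i =>
    degLT_mono (Finset.single_le_sum (fun _ _ => Nat.zero_le _) (Finset.mem_univ i)) (hn i)⟩

/-- Cohn's weak algorithm: if the leading terms of `∑ aᵢ bᵢ` cancel, then some `aᵢ` is, up to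
terms of lower degree, a right combination of the others. -/
theorem exists_sum_mul_mem_degLT {α : Type*} [Fintype α] (a : α → FreeAlgebra k (Fin g))
    (r : α → ℕ) (ha : ∀ i, a i ∈ degLT k g (r i + 1)) (m : ℕ)
    (b : α → FreeAlgebra k (Fin g)) (hb : ∀ i, b i ∈ degLT k g (m + 1 - r i))
    (htight : ∃ i, b i ∉ degLT k g (m - r i)) (hsum : ∑ i, a i * b i ∈ degLT k g m) :
    ∃ (i : α) (c : α → FreeAlgebra k (Fin g)), b i ≠ 0 ∧ c i = 1 ∧
      ∑ l, a l * c l ∈ degLT k g (r i) := by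
  induction m using Nat.strong_induction_on generalizing b with
  | _ m ih =>
  by_cases hex : ∃ i, b i ∉ degLT k g (m - r i) ∧ m ≤ r i
  · obtain ⟨i, hi, hle⟩ := hex
    have hrm : r i = m := by
      by_contra h
      exact hi (degLT_mono (by omega) (hb i))
    have hc : b i = algebraMap k _ (evalZero k g (b i)) :=
      mem_degLT_one.1 (by simpa [hrm] using hb i)
    have hne : b i ≠ 0 := fun h => hi (h ▸ zero_mem _)
    have hne' : evalZero k g (b i) ≠ 0 := fun h => hne (by rw [hc, h, map_zero])
    refine ⟨i, fun l => b l * algebraMap k _ (evalZero k g (b i))⁻¹, hne, ?_, ?_⟩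
    · change b i * _ = 1
      conv_lhs => enter [1]; rw [hc]
      rw [← map_mul, mul_inv_cancel₀ hne', map_one]
    · simp only [← mul_assoc, ← Finset.sum_mul]
      rw [hrm]
      exact mul_algebraMap_mem_degLT hsum _
  · push Not at hex
    obtain ⟨i, hi⟩ := htight
    have hri := hex i hi
    obtain ⟨m, rfl⟩ : ∃ m', m = m' + 1 := ⟨m - 1, by omega⟩
    obtain ⟨j, hj⟩ : ∃ j, transduction j (b i) ∉ degLT k g (m - r i) := by
      rw [show m + 1 - r i = m - r i + 1 by omega, mem_degLT_succ] at hi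
      simpa using hi
    have hsum' : ∑ l, a l * transduction j (b l) ∈ degLT k g m := by
      have h1 := mem_degLT_succ.1 hsum j
      simp only [map_sum, transduction_mul, Finset.sum_add_distrib] at h1
      refine (Submodule.add_mem_iff_left _ (Submodule.sum_mem _ fun l _ => ?_)).1 h1
      by_cases hl : b l ∈ degLT k g (m + 1 - r l)
      · rcases lt_or_ge (r l) (m + 1) with hlt | hge
        · exact mul_algebraMap_mem_degLT
            (degLT_mono (by omega) (mem_degLT_succ.1 (ha l) j)) _
        · rw [Nat.sub_eq_zero_of_le hge, mem_degLT_zero] at hl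
          simp [hl]
      · exact mul_algebraMap_mem_degLT
          (degLT_mono (by have := hex l hl; omega) (mem_degLT_succ.1 (ha l) j)) _
    obtain ⟨l, c, hl, hc⟩ := ih m (Nat.lt_succ_self m) (fun l => transduction j (b l))
      (fun l => degLT_mono (by omega) (transduction_mem_degLT j (hb l))) ⟨i, hj⟩ hsum'
    exact ⟨l, c, fun h => hl (by simp [h]), hc⟩

/-- Over a free algebra every unimodular row is the last row of the identity, up to invertible
column operations. -/
theorem exists_isUnit_vecMul_eq_single {α : Type*} [Fintype α] [DecidableEq α] (o : α)
    (a b : α → FreeAlgebra k (Fin g)) (hab : a ⬝ᵥ b = 1) :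
    ∃ W : Matrix α α (FreeAlgebra k (Fin g)), IsUnit W ∧ a ᵥ* W = Pi.single o 1 := by
  obtain ⟨N, hN⟩ : ∃ N : ℕ, ∃ s : α → ℕ, (∀ i, a i ∈ degLT k g (s i)) ∧ ∑ i, s i = N := by
    choose s hs using fun i => exists_mem_degLT (a i)
    exact ⟨_, s, hs, rfl⟩
  induction N using Nat.strong_induction_on generalizing a b with
  | _ N ih =>
  obtain ⟨s, hs, rfl⟩ := hN
  obtain ⟨b, hab, hbs⟩ : ∃ b' : α → FreeAlgebra k (Fin g), a ⬝ᵥ b' = 1 ∧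
      ∀ i, b' i ≠ 0 → s i ≠ 0 := by
    refine ⟨fun i => if s i = 0 then 0 else b i, ?_, fun i hi h => hi (by simp [h])⟩
    rw [← hab]
    refine Finset.sum_congr rfl fun i _ => ?_
    by_cases hi : s i = 0
    · have := hs i
      rw [hi, mem_degLT_zero] at this
      simp [this]
    · simp [hi]
  have ha : ∀ i, a i ∈ degLT k g (s i - 1 + 1) := fun i => degLT_mono (by omega) (hs i)
  have hex : ∃ m, ∀ i, b i ∈ degLT k g (m + 1 - (s i - 1)) := by
    obtain ⟨n, hn⟩ := exists_forall_mem_degLT b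
    refine ⟨n + ∑ i, s i, fun i => degLT_mono ?_ (hn i)⟩
    have := Finset.single_le_sum (f := s) (fun _ _ => Nat.zero_le _) (Finset.mem_univ i)
    omega
  classical
  have hm := Nat.find_spec hex
  rcases hm0 : Nat.find hex with _ | m
  · rw [hm0] at hm
    obtain ⟨i, -, hi⟩ : ∃ i ∈ Finset.univ, a i * b i ≠ 0 :=
      Finset.exists_ne_zero_of_sum_ne_zero (by
        change a ⬝ᵥ b ≠ 0
        rw [hab]
        exact one_ne_zero)
    have hbi := right_ne_zero_of_mul hi
    have hsi : s i ≤ 1 := by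
      by_contra h
      refine hbi (mem_degLT_zero.1 ?_)
      simpa [show 0 + 1 - (s i - 1) = 0 by omega] using hm i
    have hai := mem_degLT_one.1 (degLT_mono hsi (hs i))
    have hne : evalZero k g (a i) ≠ 0 := fun h => left_ne_zero_of_mul hi (by rw [hai, h, map_zero])
    obtain ⟨W, hW, h⟩ := Matrix.exists_isUnit_vecMul_eq_single_of_eq_one o i
      ((evalZero k g (a i))⁻¹ • a) (by
        rw [Pi.smul_apply]
        conv_lhs => enter [2]; rw [hai]
        rw [Algebra.smul_def, ← map_mul, inv_mul_cancel₀ hne, map_one])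
    refine ⟨(evalZero k g (a i))⁻¹ • W, ?_, ?_⟩
    · exact hW.smul (Units.mk0 _ (inv_ne_zero hne))
    · rw [vecMul_smul, ← smul_vecMul, h]
  · have htight : ∃ i, b i ∉ degLT k g (m + 1 - (s i - 1)) := by
      simpa using Nat.find_min hex (m := m) (by omega)
    rw [hm0] at hm
    obtain ⟨i, c, hbi, hci, hc⟩ := exists_sum_mul_mem_degLT a (fun i => s i - 1) ha (m + 1) b hm
      htight (by
        change a ⬝ᵥ b ∈ _
        rw [hab, ← map_one (algebraMap k (FreeAlgebra k (Fin g)))]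
        exact degLT_mono (by omega) (algebraMap_mem_degLT_one 1))
    have hW₁ : IsUnit (1 + vecMulVec (c - Pi.single i 1) (Pi.single i 1) :
        Matrix α α (FreeAlgebra k (Fin g))) :=
      Matrix.isUnit_one_add_vecMulVec (by simp [hci])
    obtain ⟨V, hV⟩ := hW₁
    have haV : a ᵥ* V.val = Function.update a i (a ⬝ᵥ c) := by
      rw [hV, Matrix.vecMul_one_add_vecMulVec]
      ext q
      by_cases hq : q = i
      · subst hq
        simp [dotProduct_sub]
      · simp [hq]
    have hsi := hbs i hbi
    have hlt : ∑ l, Function.update s i (s i - 1) l < ∑ l, s l := by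
      refine Finset.sum_lt_sum (fun l _ => ?_) ⟨i, Finset.mem_univ i, ?_⟩
      · by_cases hl : l = i
        · subst hl; simp
        · simp [hl]
      · simp; omega
    have hone : a ᵥ* V.val ⬝ᵥ V⁻¹.val *ᵥ b = 1 := by
      rw [← dotProduct_mulVec, mulVec_mulVec]
      simp [hab]
    obtain ⟨W, hW, h⟩ := ih _ hlt _ _ hone ⟨Function.update s i (s i - 1), fun l => by
      rw [haV]
      by_cases hl : l = i
      · subst hl; simpa [dotProduct] using hc
      · simpa [hl] using hs l, rfl⟩
    exact ⟨V * W, V.isUnit.mul hW, by rw [← vecMul_vecMul, h]⟩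

end FreeAlgebra

namespace Matrix

section RectAssociated

variable {R : Type*} [Ring R]
variable {l m n p q : Type*} [Fintype l] [Fintype m] [Fintype n] [Fintype p] [Fintype q]
  [DecidableEq l] [DecidableEq m] [DecidableEq n] [DecidableEq p] [DecidableEq q]

/-- A possibly rectangular matrix with a two-sided inverse. -/
def IsInvertible (P : Matrix m n R) : Prop :=
  ∃ P' : Matrix n m R, P * P' = 1 ∧ P' * P = 1

theorem isInvertible_iff_isUnit {P : Matrix m m R} : P.IsInvertible ↔ IsUnit P :=
  isUnit_iff_exists.symm

theorem IsInvertible.mul {P : Matrix l m R} {Q : Matrix m n R} (hP : P.IsInvertible)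
    (hQ : Q.IsInvertible) : (P * Q).IsInvertible := by
  obtain ⟨P', h1, h2⟩ := hP
  obtain ⟨Q', h3, h4⟩ := hQ
  refine ⟨Q' * P', ?_, ?_⟩
  · rw [Matrix.mul_assoc, ← Matrix.mul_assoc Q, h3, Matrix.one_mul, h1]
  · rw [Matrix.mul_assoc, ← Matrix.mul_assoc P', h2, Matrix.one_mul, h4]

theorem isInvertible_one : (1 : Matrix m m R).IsInvertible := ⟨1, by simp, by simp⟩

theorem isInvertible_one_submatrix_left (σ : n ≃ m) :
    ((1 : Matrix m m R).submatrix id σ).IsInvertible :=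
  ⟨(1 : Matrix m m R).submatrix σ id, by rw [submatrix_mul_equiv]; simp, by
    rw [← Equiv.coe_refl, submatrix_mul_equiv, Matrix.one_mul, submatrix_one_equiv]⟩

theorem isInvertible_one_submatrix_right (σ : n ≃ m) :
    ((1 : Matrix m m R).submatrix σ id).IsInvertible :=
  ⟨(1 : Matrix m m R).submatrix id σ, by
    rw [← Equiv.coe_refl, submatrix_mul_equiv, Matrix.one_mul, submatrix_one_equiv], by
    rw [submatrix_mul_equiv]; simp⟩

theorem IsInvertible.fromBlocks_diag {P : Matrix l m R} {Q : Matrix p q R} (hP : P.IsInvertible)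
    (hQ : Q.IsInvertible) : (fromBlocks P 0 0 Q).IsInvertible := by
  obtain ⟨P', h1, h2⟩ := hP
  obtain ⟨Q', h3, h4⟩ := hQ
  exact ⟨fromBlocks P' 0 0 Q', by simp [fromBlocks_multiply, h1, h3],
    by simp [fromBlocks_multiply, h2, h4]⟩

theorem isInvertible_fromBlocks_one_upper (B : Matrix m n R) :
    (fromBlocks (1 : Matrix m m R) B 0 (1 : Matrix n n R)).IsInvertible :=
  ⟨fromBlocks 1 (-B) 0 1, by simp [fromBlocks_multiply], by simp [fromBlocks_multiply]⟩

theorem isInvertible_fromBlocks_one_lower (B : Matrix n m R) :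
    (fromBlocks (1 : Matrix m m R) 0 B (1 : Matrix n n R)).IsInvertible :=
  ⟨fromBlocks 1 0 (-B) 1, by simp [fromBlocks_multiply], by simp [fromBlocks_multiply]⟩

theorem IsInvertible.map {S : Type*} [Ring S] {P : Matrix m n R} (hP : P.IsInvertible)
    (φ : R →+* S) : (P.map φ).IsInvertible := by
  obtain ⟨P', h1, h2⟩ := hP
  exact ⟨P'.map φ, by rw [← Matrix.map_mul, h1]; simp, by rw [← Matrix.map_mul, h2]; simp⟩

/-- Two square matrices, possibly with different index types, are associated if they agree up to
multiplication by invertible matrices on both sides. -/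
def RectAssociated (X : Matrix m m R) (Y : Matrix n n R) : Prop :=
  ∃ (P : Matrix m n R) (Q : Matrix n m R), P.IsInvertible ∧ Q.IsInvertible ∧ X = P * Y * Q

theorem RectAssociated.trans {X : Matrix l l R} {Y : Matrix m m R} {Z : Matrix n n R}
    (h₁ : RectAssociated X Y) (h₂ : RectAssociated Y Z) : RectAssociated X Z := by
  obtain ⟨P, Q, hP, hQ, rfl⟩ := h₁
  obtain ⟨P', Q', hP', hQ', rfl⟩ := h₂
  exact ⟨P * P', Q' * Q, hP.mul hP', hQ'.mul hQ, by simp only [Matrix.mul_assoc]⟩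

theorem RectAssociated.symm {X : Matrix m m R} {Y : Matrix n n R}
    (h : RectAssociated X Y) : RectAssociated Y X := by
  obtain ⟨P, Q, ⟨P', h1, h2⟩, ⟨Q', h3, h4⟩, rfl⟩ := h
  refine ⟨P', Q', ⟨P, h2, h1⟩, ⟨Q, h4, h3⟩, ?_⟩
  rw [← Matrix.mul_assoc, ← Matrix.mul_assoc, h2, Matrix.one_mul, Matrix.mul_assoc, h3,
    Matrix.mul_one]

theorem rectAssociated_submatrix (X : Matrix m m R) (σ : n ≃ m) :
    RectAssociated X (X.submatrix σ σ) :=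
  ⟨_, _, isInvertible_one_submatrix_left σ, isInvertible_one_submatrix_right σ, by
    simp [submatrix_mul_equiv]⟩

theorem RectAssociated.fromBlocks_one {X : Matrix m m R} {Y : Matrix n n R}
    (h : RectAssociated X Y) (e : Type*) [Fintype e] [DecidableEq e] :
    RectAssociated (fromBlocks X 0 0 (1 : Matrix e e R)) (fromBlocks Y 0 0 (1 : Matrix e e R)) := by
  obtain ⟨P, Q, hP, hQ, rfl⟩ := h
  exact ⟨_, _, hP.fromBlocks_diag (isInvertible_one (m := e)),
    hQ.fromBlocks_diag (isInvertible_one (m := e)), by simp [fromBlocks_multiply]⟩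

theorem fromBlocks_one_eq_submatrix {ι : Type*} (X : Matrix ι ι R) {e e' r : Type*}
    [DecidableEq e] [DecidableEq e'] [DecidableEq r] (σ : r ≃ e ⊕ e') :
    fromBlocks X 0 0 (1 : Matrix r r R) =
      (fromBlocks (fromBlocks X 0 0 (1 : Matrix e e R)) 0 0 (1 : Matrix e' e' R)).submatrix
        (((Equiv.refl ι).sumCongr σ).trans (Equiv.sumAssoc ι e e').symm)
        (((Equiv.refl ι).sumCongr σ).trans (Equiv.sumAssoc ι e e').symm) := by
  ext (i | i) (j | j)
  · simp
  · rcases h : σ j with a | a <;> simp [h]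
  · rcases h : σ i with a | a <;> simp [h]
  · rw [fromBlocks_apply₂₂, one_apply]
    simp only [← σ.injective.eq_iff (a := i)]
    rcases h : σ i with a | a <;> rcases h' : σ j with b | b <;> simp [h, h', one_apply]

theorem rectAssociated_fromBlocks_fromBlocks_one (X : Matrix m m R) {e e' r : Type*} [Fintype e]
    [DecidableEq e] [Fintype e'] [DecidableEq e'] [Fintype r] [DecidableEq r] (σ : r ≃ e ⊕ e') :
    RectAssociated (fromBlocks (fromBlocks X 0 0 (1 : Matrix e e R)) 0 0 (1 : Matrix e' e' R))
      (fromBlocks X 0 0 (1 : Matrix r r R)) := by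
  rw [fromBlocks_one_eq_submatrix X σ]
  exact rectAssociated_submatrix _ _

theorem isUnit_of_isUnit_fromBlocks_upper {X : Matrix m m R} {B : Matrix m n R}
    (h : IsUnit (fromBlocks X B 0 (1 : Matrix n n R))) : IsUnit X := by
  obtain ⟨V, h1, h2⟩ := isUnit_iff_exists.1 h
  rw [← fromBlocks_toBlocks V, fromBlocks_multiply, ← fromBlocks_one, fromBlocks_inj] at h1 h2
  obtain ⟨a1, -, a3, -⟩ := h1
  obtain ⟨b1, -, -, -⟩ := h2
  simp only [Matrix.zero_mul, Matrix.one_mul, zero_add, Matrix.mul_zero, add_zero] at a1 a3 b1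
  rw [a3, Matrix.mul_zero, add_zero] at a1
  exact isUnit_iff_exists.2 ⟨_, a1, b1⟩

theorem isUnit_of_isUnit_fromBlocks_lower {X : Matrix n n R} {B : Matrix m n R}
    (h : IsUnit (fromBlocks (1 : Matrix m m R) B 0 X)) : IsUnit X := by
  obtain ⟨V, h1, h2⟩ := isUnit_iff_exists.1 h
  rw [← fromBlocks_toBlocks V, fromBlocks_multiply, ← fromBlocks_one, fromBlocks_inj] at h1 h2
  obtain ⟨-, -, -, a4⟩ := h1
  obtain ⟨-, -, b3, b4⟩ := h2
  simp only [Matrix.zero_mul, Matrix.mul_one, zero_add, Matrix.mul_zero, add_zero] at a4 b3 b4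
  rw [b3, Matrix.zero_mul, zero_add] at b4
  exact isUnit_iff_exists.2 ⟨_, a4, b4⟩

theorem isUnit_fromBlocks_upper {X : Matrix m m R} {B : Matrix m n R} {Y : Matrix n n R}
    (hX : IsUnit X) (hY : IsUnit Y) : IsUnit (fromBlocks X B 0 Y) := by
  obtain ⟨X', h1, h2⟩ := isUnit_iff_exists.1 hX
  obtain ⟨Y', h3, h4⟩ := isUnit_iff_exists.1 hY
  refine isUnit_iff_exists.2 ⟨fromBlocks X' (-(X' * B * Y')) 0 Y', ?_, ?_⟩
  · simp [fromBlocks_multiply, h1, h3, ← Matrix.mul_assoc]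
  · simp [fromBlocks_multiply, h2, h4, Matrix.mul_assoc]

/-- An atom of a matrix ring with an arbitrary finite index type. -/
def IsAtomic (f : Matrix m m R) : Prop :=
  ¬IsUnit f ∧ ∀ u v : Matrix m m R, f = u * v → IsUnit u ∨ IsUnit v

theorem IsAtomic.submatrix {f : Matrix m m R} (hf : f.IsAtomic) (σ : n ≃ m) :
    (f.submatrix σ σ).IsAtomic := by
  have key : ∀ u : Matrix n n R, IsUnit (u.submatrix σ.symm σ.symm) ↔ IsUnit u := fun u =>
    MulEquiv.isUnit_map (reindexRingEquiv R σ)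
  refine ⟨fun h => hf.1 ?_, fun u v huv => ?_⟩
  · simpa using (key _).2 h
  · rw [← key u, ← key v]
    refine hf.2 _ _ ?_
    rw [submatrix_mul_equiv, ← huv]
    simp

end RectAssociated

end Matrix

namespace FreeAlgebra

variable {k : Type*} [Field k] {g : ℕ} {m : Type*} [Fintype m] [DecidableEq m]

theorem isAtomic_fromBlocks_unit {f : Matrix m m (FreeAlgebra k (Fin g))} (hf : f.IsAtomic) :
    (fromBlocks f 0 0 (1 : Matrix Unit Unit (FreeAlgebra k (Fin g)))).IsAtomic := by
  refine ⟨fun h => hf.1 (isUnit_of_isUnit_fromBlocks_upper h), fun u v huv => ?_⟩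
  obtain ⟨W, ⟨V, rfl⟩, hW⟩ := exists_isUnit_vecMul_eq_single (Sum.inr ()) (u (Sum.inr ()))
    (fun i => v i (Sum.inr ())) (by
      have := congrFun (congrFun huv (Sum.inr ())) (Sum.inr ())
      simpa [Matrix.mul_apply, dotProduct] using this.symm)
  obtain ⟨u', hu'⟩ : ∃ u', u' = u * V.val := ⟨_, rfl⟩
  obtain ⟨v', hv'⟩ : ∃ v', v' = V⁻¹.val * v := ⟨_, rfl⟩
  have huv' : fromBlocks f 0 0 1 = u' * v' := by
    rw [huv, hu', hv', mul_assoc, Units.mul_inv_cancel_left]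
  have hul : ∀ i, u' (Sum.inr ()) i = (1 : Matrix (m ⊕ Unit) (m ⊕ Unit) _) (Sum.inr ()) i := by
    intro i
    rw [hu', mul_apply_eq_vecMul, hW, Pi.single_apply, one_apply]
    simp [eq_comm]
  have hvl : ∀ i, v' (Sum.inr ()) i = (1 : Matrix (m ⊕ Unit) (m ⊕ Unit) _) (Sum.inr ()) i := by
    intro i
    have := congrFun (congrFun huv' (Sum.inr ())) i
    rw [mul_apply] at this
    simp only [hul, one_apply, ite_mul, one_mul, zero_mul] at this
    simp only [Finset.sum_ite_eq, Finset.mem_univ, if_true] at this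
    rw [← this]
    rcases i with i | i <;> simp [one_apply]
  have hu'' : u' = fromBlocks u'.toBlocks₁₁ u'.toBlocks₁₂ 0 1 := by
    conv_lhs => rw [← fromBlocks_toBlocks u']
    congr 1
    · ext i j; simp [toBlocks₂₁, hul]
    · ext i j; simp [toBlocks₂₂, hul]
  have hv'' : v' = fromBlocks v'.toBlocks₁₁ v'.toBlocks₁₂ 0 1 := by
    conv_lhs => rw [← fromBlocks_toBlocks v']
    congr 1
    · ext i j; simp [toBlocks₂₁, hvl]
    · ext i j; simp [toBlocks₂₂, hvl]
  have hf' : f = u'.toBlocks₁₁ * v'.toBlocks₁₁ := by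
    rw [hu'', hv'', fromBlocks_multiply, fromBlocks_inj] at huv'
    simpa using huv'.1
  rcases hf.2 _ _ hf' with h | h
  · left
    have : IsUnit u' := by rw [hu'']; exact isUnit_fromBlocks_upper h isUnit_one
    rw [hu'] at this
    exact (Units.isUnit_mul_units u V).1 this
  · right
    have : IsUnit v' := by rw [hv'']; exact isUnit_fromBlocks_upper h isUnit_one
    rw [hv'] at this
    exact (Units.isUnit_units_mul V⁻¹ v).1 this

theorem isAtomic_fromBlocks_one {f : Matrix m m (FreeAlgebra k (Fin g))} (hf : f.IsAtomic)
    (e : ℕ) : (fromBlocks f 0 0 (1 : Matrix (Fin e) (Fin e) (FreeAlgebra k (Fin g)))).IsAtomic := by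
  induction e with
  | zero =>
    convert hf.submatrix (Equiv.sumEmpty m (Fin 0)) using 1
    ext (i | i) (j | j)
    · simp
    · exact j.elim0
    · exact i.elim0
    · exact i.elim0
  | succ e ih =>
    rw [fromBlocks_one_eq_submatrix f ((finSumFinEquiv (m := e) (n := 1)).symm.trans
      ((Equiv.refl _).sumCongr (Equiv.ofUnique (Fin 1) Unit)))]
    exact (isAtomic_fromBlocks_unit ih).submatrix _

end FreeAlgebra

section Linearization

open FreeAlgebra

variable {k : Type*} [Field k] {g : ℕ}
variable {m n : Type*} [Fintype m] [DecidableEq m] [Fintype n] [DecidableEq n]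

theorem FreeAlgebra.one_apply_mem_degLT {ι : Type*} [DecidableEq ι] {r : ℕ} (hr : 1 ≤ r)
    (i j : ι) :
    (1 : Matrix ι ι (FreeAlgebra k (Fin g))) i j ∈ degLT k g r := by
  rw [one_apply]
  split_ifs
  · rw [← map_one (algebraMap k (FreeAlgebra k (Fin g)))]
    exact degLT_mono hr (algebraMap_mem_degLT_one 1)
  · exact zero_mem _

/-- One step of Higman's linearization, lowering the degree of the entries. -/
theorem Matrix.exists_rectAssociated_fromBlocks_of_degLT {r : ℕ}
    (Y : Matrix m m (FreeAlgebra k (Fin g))) (hY : ∀ i j, Y i j ∈ degLT k g (r + 3)) :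
    ∃ Z : Matrix (m ⊕ Fin g × m) (m ⊕ Fin g × m) (FreeAlgebra k (Fin g)),
      (∀ i j, Z i j ∈ degLT k g (r + 2)) ∧ RectAssociated
        (fromBlocks Y 0 0 (1 : Matrix (Fin g × m) (Fin g × m) (FreeAlgebra k (Fin g)))) Z := by
  obtain ⟨C, hC⟩ : ∃ C : Matrix m (Fin g × m) (FreeAlgebra k (Fin g)),
      ∀ i j, C i j = transduction j.1 (Y i j.2) := ⟨Matrix.of fun i j => _, fun _ _ => rfl⟩
  obtain ⟨B, hB⟩ : ∃ B : Matrix (Fin g × m) m (FreeAlgebra k (Fin g)),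
      ∀ i j, B i j = if i.2 = j then ι k i.1 else 0 := ⟨Matrix.of fun i j => _, fun _ _ => rfl⟩
  obtain ⟨Y₀, hY₀⟩ : ∃ Y₀ : Matrix m m (FreeAlgebra k (Fin g)),
      ∀ i j, Y₀ i j = algebraMap k _ (evalZero k g (Y i j)) :=
    ⟨Matrix.of fun i j => _, fun _ _ => rfl⟩
  have hYC : Y = Y₀ + C * B := by
    ext i j
    rw [add_apply, mul_apply, Fintype.sum_prod_type]
    simp only [hC, hB, hY₀, mul_ite, mul_zero, Finset.sum_ite_eq', Finset.mem_univ, if_true]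
    exact eq_evalZero_add_sum _
  refine ⟨fromBlocks Y₀ (-C) B 1, ?_, fromBlocks 1 C 0 1, fromBlocks 1 0 (-B) 1,
    isInvertible_fromBlocks_one_upper C, isInvertible_fromBlocks_one_lower (-B), ?_⟩
  · rintro (i | i) (j | j)
    · simp only [fromBlocks_apply₁₁, hY₀]
      exact degLT_mono (by omega) (algebraMap_mem_degLT_one _)
    · simp only [fromBlocks_apply₁₂, neg_apply, hC]
      exact neg_mem (mem_degLT_succ.1 (hY _ _) _)
    · simp only [fromBlocks_apply₂₁, hB]
      split_ifs
      · exact degLT_mono (by omega) (ι_mem_degLT_two _)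
      · exact zero_mem _
    · exact one_apply_mem_degLT (by omega) _ _
  · simp [fromBlocks_multiply, hYC]

/-- Higman's linearization: every matrix over a free algebra is stably associated to one with
entries of degree at most one. -/
theorem Matrix.exists_rectAssociated_degLT_two (r : ℕ) {m : Type} [Fintype m] [DecidableEq m]
    (Y : Matrix m m (FreeAlgebra k (Fin g))) (hY : ∀ i j, Y i j ∈ degLT k g (r + 2)) :
    ∃ (e n : ℕ) (Z : Matrix (Fin n) (Fin n) (FreeAlgebra k (Fin g))),
      (∀ i j, Z i j ∈ degLT k g 2) ∧
        RectAssociated (fromBlocks Y 0 0 (1 : Matrix (Fin e) (Fin e) _)) Z := by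
  induction r generalizing m with
  | zero =>
    refine ⟨0, _, _, ?_, rectAssociated_submatrix _ (Fintype.equivFin (m ⊕ Fin 0)).symm⟩
    intro i j
    rw [submatrix_apply]
    rcases (Fintype.equivFin (m ⊕ Fin 0)).symm i with i | i
    · rcases (Fintype.equivFin (m ⊕ Fin 0)).symm j with j | j
      · exact hY i j
      · exact j.elim0
    · exact i.elim0
  | succ r ih =>
    obtain ⟨Z', hZ', hYZ'⟩ := exists_rectAssociated_fromBlocks_of_degLT Y hY
    obtain ⟨e, n, Z, hZ, h⟩ := ih Z' hZ'
    refine ⟨Fintype.card ((Fin g × m) ⊕ Fin e), n, Z, hZ,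
      RectAssociated.trans ?_ ((hYZ'.fromBlocks_one (Fin e)).trans h)⟩
    exact (rectAssociated_fromBlocks_fromBlocks_one Y
      (Fintype.equivFin ((Fin g × m) ⊕ Fin e)).symm).symm

/-- A monic linear pencil with an arbitrary finite index type. -/
def monicPencil {n : Type*} [DecidableEq n] (A : Fin g → Matrix n n k) :
    Matrix n n (FreeAlgebra k (Fin g)) :=
  1 - ∑ j, (A j).map fun a => a • FreeAlgebra.ι k j

theorem monicPencil_eq (A : Fin g → Matrix n n k) :
    monicPencil A =
      1 - ∑ j, (A j).map (algebraMap k (FreeAlgebra k (Fin g))) * scalar n (FreeAlgebra.ι k j) := by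
  rw [monicPencil]
  congr 1
  refine Finset.sum_congr rfl fun j _ => ?_
  ext i l
  simp [Algebra.smul_def]

theorem monicPencil_fromBlocks {p q : Type*} [DecidableEq p] [DecidableEq q]
    (B : Fin g → Matrix p p k) (C : Fin g → Matrix p q k) (D : Fin g → Matrix q q k) : ∃ E,
    monicPencil (fun j => fromBlocks (B j) (C j) 0 (D j)) =
      fromBlocks (monicPencil B) E 0 (monicPencil D) := by
  refine ⟨-∑ j, (C j).map fun a => a • FreeAlgebra.ι k j, ?_⟩
  ext (i | i) (j | j) <;> simp [monicPencil, Matrix.sum_apply, one_apply]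

theorem monicPencil_mul_eq {A : Fin g → Matrix m m k} {A' : Fin g → Matrix n n k}
    {T : Matrix m n k} (hT : ∀ j, A j * T = T * A' j) :
    monicPencil A * T.map (algebraMap k (FreeAlgebra k (Fin g))) =
      T.map (algebraMap k (FreeAlgebra k (Fin g))) * monicPencil A' := by
  simp only [monicPencil_eq, Matrix.sub_mul, Matrix.mul_sub, Matrix.one_mul, Matrix.mul_one,
    Matrix.sum_mul, Matrix.mul_sum]
  congr 1
  refine Finset.sum_congr rfl fun j _ => ?_
  have : scalar m (FreeAlgebra.ι k j) * T.map (algebraMap k (FreeAlgebra k (Fin g))) =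
      T.map (algebraMap k (FreeAlgebra k (Fin g))) * scalar n (FreeAlgebra.ι k j) := by
    ext a b
    simp [Algebra.commutes]
  rw [Matrix.mul_assoc, this, ← Matrix.mul_assoc, ← Matrix.map_mul, hT, Matrix.map_mul,
    Matrix.mul_assoc]

theorem rectAssociated_monicPencil {A : Fin g → Matrix m m k} {A' : Fin g → Matrix n n k}
    {T : Matrix m n k} (hT : T.IsInvertible) (h : ∀ j, A j * T = T * A' j) :
    RectAssociated (monicPencil A) (monicPencil A') := by
  have hT' := hT.map (algebraMap k (FreeAlgebra k (Fin g)))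
  obtain ⟨S, h1, h2⟩ := hT'
  refine ⟨_, S, ⟨S, h1, h2⟩, ⟨_, h2, h1⟩, ?_⟩
  rw [← monicPencil_mul_eq h, Matrix.mul_assoc, h1, Matrix.mul_one]

/-- A matrix of noncommutative polynomials with `f(0) = I` is stably associated to a monic linear
pencil. -/
theorem exists_rectAssociated_monicPencil {m : Type} [Fintype m] [DecidableEq m]
    (f : Matrix m m (FreeAlgebra k (Fin g))) (h0 : f.map (evalZero k g) = 1) :
    ∃ (e n : ℕ) (A : Fin g → Matrix (Fin n) (Fin n) k),
      RectAssociated (fromBlocks f 0 0 (1 : Matrix (Fin e) (Fin e) _)) (monicPencil A) := by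
  obtain ⟨r, hr⟩ := exists_forall_mem_degLT fun i : m × m => f i.1 i.2
  obtain ⟨e, n, Z, hZ, P, Q, hP, hQ, hPQ⟩ := exists_rectAssociated_degLT_two r f fun i j =>
    degLT_mono (by omega) (hr (i, j))
  obtain ⟨P', hP1, hP2⟩ := hP.map (evalZero k g : FreeAlgebra k (Fin g) →+* k)
  obtain ⟨Q', hQ1, hQ2⟩ := hQ.map (evalZero k g : FreeAlgebra k (Fin g) →+* k)
  obtain ⟨P₀, hP₀⟩ : ∃ P₀, P₀ = P.map (evalZero k g : FreeAlgebra k (Fin g) →+* k) := ⟨_, rfl⟩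
  obtain ⟨Q₀, hQ₀⟩ : ∃ Q₀, Q₀ = Q.map (evalZero k g : FreeAlgebra k (Fin g) →+* k) := ⟨_, rfl⟩
  obtain ⟨Z₀, hZ₀⟩ : ∃ Z₀, Z₀ = Z.map (evalZero k g : FreeAlgebra k (Fin g) →+* k) := ⟨_, rfl⟩
  rw [← hP₀] at hP1 hP2
  rw [← hQ₀] at hQ1 hQ2
  have h1 : P₀ * Z₀ * Q₀ = 1 := by
    rw [hP₀, hQ₀, hZ₀, ← Matrix.map_mul, ← Matrix.map_mul, ← hPQ, fromBlocks_map]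
    simp only [RingHom.coe_coe] at h0 ⊢
    simp [h0]
  have hZinv : Z₀ * (Q₀ * P₀) = 1 := by
    have : Z₀ = P' * Q' := by
      calc Z₀ = (P' * P₀) * Z₀ * (Q₀ * Q') := by rw [hP2, hQ1, Matrix.one_mul, Matrix.mul_one]
        _ = P' * (P₀ * Z₀ * Q₀) * Q' := by simp only [Matrix.mul_assoc]
        _ = P' * Q' := by rw [h1, Matrix.mul_one]
    rw [this, Matrix.mul_assoc, ← Matrix.mul_assoc Q', hQ2, Matrix.one_mul, hP2]
  obtain ⟨D, hD⟩ : ∃ D : Fin g → Matrix (Fin n) (Fin n) k,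
      ∀ j i l, D j i l = evalZero k g (transduction j (Z i l)) :=
    ⟨fun j => Matrix.of fun i l => _, fun _ _ _ => rfl⟩
  refine ⟨e, n, fun j => -(Q₀ * P₀ * D j), RectAssociated.trans ⟨P, Q, hP, hQ, hPQ⟩
    ⟨Z₀.map (algebraMap k _), 1, ?_, isInvertible_one, ?_⟩⟩
  · exact IsInvertible.map (isInvertible_iff_isUnit.2
      (isUnit_iff_exists.2 ⟨_, hZinv, mul_eq_one_comm.1 hZinv⟩)) _
  · have hj : ∀ j, Z₀.map (algebraMap k (FreeAlgebra k (Fin g))) *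
        ((-(Q₀ * P₀ * D j)).map (algebraMap k (FreeAlgebra k (Fin g))) *
          scalar (Fin n) (FreeAlgebra.ι k j)) =
        -((D j).map (algebraMap k (FreeAlgebra k (Fin g))) *
          scalar (Fin n) (FreeAlgebra.ι k j)) := by
      intro j
      rw [← Matrix.mul_assoc, ← Matrix.map_mul, Matrix.mul_neg, ← Matrix.mul_assoc, hZinv,
        Matrix.one_mul, Matrix.map_neg _ (map_neg _), Matrix.neg_mul]
    rw [monicPencil_eq, Matrix.mul_one, Matrix.mul_sub, Matrix.mul_sum, Matrix.mul_one,
      Finset.sum_congr rfl fun j _ => hj j, Finset.sum_neg_distrib, sub_neg_eq_add]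
    ext i l
    rw [Matrix.add_apply, Matrix.sum_apply]
    conv_lhs => rw [eq_evalZero_add_sum (Z i l)]
    congr 1
    · rw [hZ₀]
      rfl
    · refine Finset.sum_congr rfl fun j _ => ?_
      rw [scalar_apply, mul_diagonal, map_apply, hD]
      rw [← mem_degLT_one.1 (mem_degLT_succ.1 (hZ i l) j)]

end Linearization

section Burnside

variable {k V : Type*} [Field k] [IsAlgClosed k] [AddCommGroup V] [Module k V]
  [FiniteDimensional k V]

/-- **Burnside's theorem** on matrix algebras: a proper subalgebra of the endomorphism algebra of a
finite-dimensional vector space over an algebraically closed field has a nontrivial invariant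
subspace. -/
theorem Subalgebra.exists_invariant_submodule (S : Subalgebra k (Module.End k V)) (hS : S ≠ ⊤) :
    ∃ W : Submodule k V, W ≠ ⊥ ∧ W ≠ ⊤ ∧ ∀ a ∈ S, ∀ w ∈ W, a w ∈ W := by
  by_contra! hcon
  refine hS (eq_top_iff.2 fun f _ => ?_)
  rcases subsingleton_or_nontrivial V with hV | hV
  · rw [Subsingleton.elim f 0]
    exact zero_mem S
  have hsimple : IsSimpleModule S V := by
    refine (isSimpleModule_iff ..).2 { eq_bot_or_eq_top := fun U => ?_ }
    by_contra! hU
    obtain ⟨a, ha, w, hw, h⟩ := hcon (U.restrictScalars k) (by simpa using hU.1)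
      (by simpa using hU.2)
    exact h (U.smul_mem (⟨a, ha⟩ : S) hw)
  obtain ⟨s, hs⟩ := Module.Finite.fg_top (R := k) (M := V)
  let F : Module.End (Module.End S V) V :=
    { f with
      map_smul' := fun φ v => by
        obtain ⟨c, rfl⟩ :=
          (IsSimpleModule.algebraMap_end_bijective_of_isAlgClosed (A := S) (V := V) k).2 φ
        simp }
  obtain ⟨r, hr⟩ := jacobson_density F s
  have : f = r.1 := LinearMap.ext_on hs fun x hx => hr x hx
  exact this ▸ r.2

end Burnside

section Reduction

open FreeAlgebra

variable {k : Type*} [Field k] {g : ℕ}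

/-- A tuple of matrices which does not generate the full matrix algebra is simultaneously similar to
a block upper triangular one. -/
theorem exists_similar_fromBlocks_of_adjoin_ne_top [IsAlgClosed k] {n : ℕ}
    (A : Fin g → Matrix (Fin n) (Fin n) k) (hA : Algebra.adjoin k (Set.range A) ≠ ⊤) :
    ∃ (p q : ℕ) (T : Matrix (Fin n) (Fin p ⊕ Fin q) k) (B : Fin g → Matrix (Fin p) (Fin p) k)
      (C : Fin g → Matrix (Fin p) (Fin q) k) (D : Fin g → Matrix (Fin q) (Fin q) k),
      p < n ∧ q < n ∧ T.IsInvertible ∧ ∀ j, A j * T = T * fromBlocks (B j) (C j) 0 (D j) := by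
  have hS : (Algebra.adjoin k (Set.range A)).map
      (Matrix.toLinAlgEquiv' : Matrix (Fin n) (Fin n) k ≃ₐ[k] _).toAlgHom ≠ ⊤ := by
    refine fun h => hA (eq_top_iff.2 fun M _ => ?_)
    obtain ⟨N, hN, hNM⟩ : Matrix.toLinAlgEquiv' M ∈ (Algebra.adjoin k (Set.range A)).map
      (Matrix.toLinAlgEquiv' : Matrix (Fin n) (Fin n) k ≃ₐ[k] _).toAlgHom := h ▸ Algebra.mem_top
    rw [← Matrix.toLinAlgEquiv'.injective hNM]
    exact hN
  obtain ⟨W, hbot, htop, hW⟩ := Subalgebra.exists_invariant_submodule _ hS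
  obtain ⟨W', hWW'⟩ := W.exists_isCompl
  have hAW : ∀ j, ∀ w ∈ W, Matrix.toLin' (A j) w ∈ W := fun j =>
    hW _ ⟨A j, Algebra.subset_adjoin ⟨j, rfl⟩, rfl⟩
  have hsum := Submodule.finrank_add_eq_of_isCompl hWW'
  rw [Module.finrank_fin_fun] at hsum
  have hp : 0 < Module.finrank k W :=
    Nat.pos_of_ne_zero fun h => hbot (Submodule.finrank_eq_zero.1 h)
  have hp' : Module.finrank k W < n := by
    simpa using Submodule.finrank_lt htop
  let b : Module.Basis (Fin (Module.finrank k W) ⊕ Fin (Module.finrank k W')) k (Fin n → k) :=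
    ((Module.finBasis k W).prod (Module.finBasis k W')).map (W.prodEquivOfIsCompl W' hWW')
  have hb : ∀ j c a, LinearMap.toMatrix b b (Matrix.toLin' (A j)) (Sum.inr c) (Sum.inl a) = 0 := by
    intro j c a
    have hmem := hAW j (b (Sum.inl a)) (by simp [b])
    rw [LinearMap.toMatrix_apply]
    have := Submodule.prodEquivOfIsCompl_symm_apply_left W W' hWW' ⟨_, hmem⟩
    simp only [b, Module.Basis.map_repr, LinearEquiv.trans_apply] at this ⊢
    rw [this]
    simp
  refine ⟨_, _, (Pi.basisFun k (Fin n)).toMatrix b,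
    fun j => (LinearMap.toMatrix b b (Matrix.toLin' (A j))).toBlocks₁₁,
    fun j => (LinearMap.toMatrix b b (Matrix.toLin' (A j))).toBlocks₁₂,
    fun j => (LinearMap.toMatrix b b (Matrix.toLin' (A j))).toBlocks₂₂, hp', by omega,
    ⟨b.toMatrix (Pi.basisFun k (Fin n)), Module.Basis.toMatrix_mul_toMatrix_flip _ _,
      Module.Basis.toMatrix_mul_toMatrix_flip _ _⟩, fun j => ?_⟩
  have : fromBlocks (LinearMap.toMatrix b b (Matrix.toLin' (A j))).toBlocks₁₁
      (LinearMap.toMatrix b b (Matrix.toLin' (A j))).toBlocks₁₂ 0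
      (LinearMap.toMatrix b b (Matrix.toLin' (A j))).toBlocks₂₂ =
      LinearMap.toMatrix b b (Matrix.toLin' (A j)) := by
    conv_rhs => rw [← fromBlocks_toBlocks (LinearMap.toMatrix b b (Matrix.toLin' (A j)))]
    congr 1
    ext c a
    exact (hb j c a).symm
  rw [this, basis_toMatrix_mul_linearMap_toMatrix]
  conv_lhs => rw [← LinearMap.toMatrix'_toLin' (A j), ← LinearMap.toMatrix_eq_toMatrix']
  exact linearMap_toMatrix_mul_basis_toMatrix _ _ _ _

theorem Matrix.IsAtomic.of_rectAssociated {R m n : Type*} [Ring R] [Fintype m] [DecidableEq m]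
    [Fintype n] [DecidableEq n] {X : Matrix m m R} {Y : Matrix n n R} (hX : X.IsAtomic)
    (h : RectAssociated X Y) : Y.IsAtomic := by
  obtain ⟨P, Q, hP, hQ, rfl⟩ := h
  obtain ⟨P', h1, h2⟩ := id hP
  obtain ⟨Q', h3, h4⟩ := id hQ
  have hP' : P'.IsInvertible := ⟨P, h2, h1⟩
  have hQ' : Q'.IsInvertible := ⟨Q, h4, h3⟩
  refine ⟨fun hY => hX.1 ?_, fun u v huv => ?_⟩
  · exact isInvertible_iff_isUnit.1 ((hP.mul (isInvertible_iff_isUnit.2 hY)).mul hQ)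
  · have key : P * Y * Q = (P * u * P') * (P * v * Q) := by
      calc P * Y * Q = P * u * (v * Q) := by rw [huv]; simp only [Matrix.mul_assoc]
        _ = P * u * ((P' * P) * (v * Q)) := by rw [h2, Matrix.one_mul]
        _ = _ := by simp only [Matrix.mul_assoc]
    refine (hX.2 _ _ key).imp (fun h => ?_) fun h => ?_
    · have := (hP'.mul (isInvertible_iff_isUnit.2 h)).mul hP
      rwa [← Matrix.mul_assoc, ← Matrix.mul_assoc, h2, Matrix.one_mul, Matrix.mul_assoc, h2,
        Matrix.mul_one, isInvertible_iff_isUnit] at this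
    · have := (hP'.mul (isInvertible_iff_isUnit.2 h)).mul hQ'
      rwa [← Matrix.mul_assoc, ← Matrix.mul_assoc, h2, Matrix.one_mul, Matrix.mul_assoc, h3,
        Matrix.mul_one, isInvertible_iff_isUnit] at this

/-- If a block upper triangular matrix, stabilized by an identity, is an atom, then one of its
diagonal blocks can be split off. -/
theorem Matrix.IsAtomic.rectAssociated_or {R : Type*} [Ring R] {p q e : ℕ}
    {L₁ : Matrix (Fin p) (Fin p) R} {E : Matrix (Fin p) (Fin q) R} {L₂ : Matrix (Fin q) (Fin q) R}
    (h : (fromBlocks (fromBlocks L₁ E 0 L₂) 0 0 (1 : Matrix (Fin e) (Fin e) R)).IsAtomic) :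
    RectAssociated (fromBlocks L₁ E 0 L₂) (fromBlocks L₁ 0 0 (1 : Matrix (Fin q) (Fin q) R)) ∨
      RectAssociated (fromBlocks L₁ E 0 L₂) (fromBlocks L₂ 0 0 (1 : Matrix (Fin p) (Fin p) R)) := by
  rcases h.2 (fromBlocks (fromBlocks 1 0 0 L₂) 0 0 1) (fromBlocks (fromBlocks L₁ E 0 1) 0 0 1)
    (by simp [fromBlocks_multiply]) with hu | hu
  · have hL₂ := isUnit_of_isUnit_fromBlocks_lower (isUnit_of_isUnit_fromBlocks_upper hu)
    exact Or.inl ⟨fromBlocks 1 E 0 L₂, 1,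
      isInvertible_iff_isUnit.2 (isUnit_fromBlocks_upper isUnit_one hL₂), isInvertible_one,
      by simp [fromBlocks_multiply]⟩
  · have hL₁ := isUnit_of_isUnit_fromBlocks_upper (isUnit_of_isUnit_fromBlocks_upper hu)
    have h₁ : RectAssociated (fromBlocks L₁ E 0 L₂) (fromBlocks 1 0 0 L₂) :=
      ⟨1, fromBlocks L₁ E 0 1, isInvertible_one,
        isInvertible_iff_isUnit.2 (isUnit_fromBlocks_upper hL₁ isUnit_one),
        by simp [fromBlocks_multiply]⟩
    refine Or.inr (h₁.trans ?_)
    convert rectAssociated_submatrix _ (Equiv.sumComm (Fin q) (Fin p)) using 1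
    exact (fromBlocks_submatrix_sum_swap_sum_swap _ _ _ _).symm

/-- An atom stably associated to a monic linear pencil is stably associated to an irreducible
monic linear pencil. -/
theorem exists_irreducible_of_rectAssociated_monicPencil [IsAlgClosed k] {m : Type*} [Fintype m]
    [DecidableEq m] {F : Matrix m m (FreeAlgebra k (Fin g))} (hF : F.IsAtomic) {n : ℕ}
    (A : Fin g → Matrix (Fin n) (Fin n) k) {e : ℕ}
    (h : RectAssociated F (fromBlocks (monicPencil A) 0 0 (1 : Matrix (Fin e) (Fin e) _))) :
    ∃ (n' : ℕ) (A' : Fin g → Matrix (Fin n') (Fin n') k) (e' : ℕ),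
      Algebra.adjoin k (Set.range A') = ⊤ ∧
      RectAssociated F (fromBlocks (monicPencil A') 0 0 (1 : Matrix (Fin e') (Fin e') _)) := by
  induction n using Nat.strong_induction_on generalizing e with
  | _ n ih =>
  by_cases hA : Algebra.adjoin k (Set.range A) = ⊤
  · exact ⟨n, A, e, hA, h⟩
  obtain ⟨p, q, T, B, C, D, hp, hq, hT, hAT⟩ := exists_similar_fromBlocks_of_adjoin_ne_top A hA
  obtain ⟨E, hE⟩ := monicPencil_fromBlocks B C D
  have h₁ := rectAssociated_monicPencil hT hAT
  rw [hE] at h₁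
  have h₂ := h.trans (h₁.fromBlocks_one (Fin e))
  rcases (hF.of_rectAssociated h₂).rectAssociated_or with h₃ | h₃
  · exact ih p hp B ((h₂.trans (h₃.fromBlocks_one (Fin e))).trans
      (rectAssociated_fromBlocks_fromBlocks_one _ finSumFinEquiv.symm))
  · exact ih q hq D ((h₂.trans (h₃.fromBlocks_one (Fin e))).trans
      (rectAssociated_fromBlocks_fromBlocks_one _ finSumFinEquiv.symm))

theorem stablyAssociated_of_rectAssociated {d₁ d₂ e₁ e₂ : ℕ}
    {f₁ : Matrix (Fin d₁) (Fin d₁) (FreeAlgebra k (Fin g))}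
    {f₂ : Matrix (Fin d₂) (Fin d₂) (FreeAlgebra k (Fin g))}
    (h : RectAssociated (fromBlocks f₁ 0 0 (1 : Matrix (Fin e₁) (Fin e₁) _))
      (fromBlocks f₂ 0 0 (1 : Matrix (Fin e₂) (Fin e₂) _))) : StablyAssociated f₁ f₂ := by
  have hcard : d₁ + e₁ = d₂ + e₂ := by
    obtain ⟨P, -, hP, -⟩ := h
    obtain ⟨P', h1, h2⟩ := hP.map (evalZero k g : FreeAlgebra k (Fin g) →+* k)
    simpa using Matrix.square_of_invertible _ _ h1 h2
  have h₁ : RectAssociated (dSum f₁ e₁) (fromBlocks f₁ 0 0 (1 : Matrix (Fin e₁) (Fin e₁) _)) :=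
    (rectAssociated_submatrix _ finSumFinEquiv.symm).symm
  have h₂ : RectAssociated (fromBlocks f₂ 0 0 (1 : Matrix (Fin e₂) (Fin e₂) _))
      (Matrix.reindex (finCongr hcard).symm (finCongr hcard).symm (dSum f₂ e₂)) :=
    (rectAssociated_submatrix _ finSumFinEquiv.symm).trans
      (rectAssociated_submatrix _ (finCongr hcard))
  obtain ⟨P, Q, hP, hQ, hPQ⟩ := (h₁.trans h).trans h₂
  exact ⟨e₁, e₂, hcard, P, Q, isInvertible_iff_isUnit.1 hP, isInvertible_iff_isUnit.1 hQ, hPQ⟩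

end Reduction

/-- Every atom `f ∈ M_d(k⟨x⟩)` with `f(0) = I` is stably associated to an irreducible monic
linear pencil. -/
theorem atom_stablyAssociated_irreducible_pencil
    {k : Type*} [Field k] [IsAlgClosed k] [CharZero k] {g d : ℕ}
    (f : Matrix (Fin d) (Fin d) (FreeAlgebra k (Fin g)))
    (hatom : MatAtom f)
    (h0 : f.map ⇑(FreeAlgebra.lift k (fun _ : Fin g => (0 : k))) = 1) :
    ∃ (d' : ℕ) (A : Fin g → Matrix (Fin d') (Fin d') k),
      Algebra.adjoin k (Set.range A) = ⊤ ∧ StablyAssociated f (pencilMat A) := by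
  obtain ⟨e, n, A, hA⟩ := exists_rectAssociated_monicPencil f h0
  have hA' := hA.trans (rectAssociated_submatrix _ (Equiv.sumEmpty (Fin n) (Fin 0)))
  obtain ⟨n', A', e', htop, h⟩ := exists_irreducible_of_rectAssociated_monicPencil
    (FreeAlgebra.isAtomic_fromBlocks_one hatom e) A (e := 0) (by
      convert hA' using 1
      ext (i | i) (j | j)
      · simp
      · exact j.elim0
      · exact i.elim0
      · exact i.elim0)
  exact ⟨n', A', htop, stablyAssociated_of_rectAssociated h⟩
end
end

section
/- Let k be an algebraically closed field of characteristic zero and let f ∈ k⟨x₁,…,x_g⟩ have degree δ ≥ 2 and constant term f(0) = 1. If there exists n ≥ ⌈δ/2⌉ such that det f(gX^(n)) ∈ k[ξ] is an irreducible polynomial, then f is an atom. -/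
open Matrix MvPolynomial

noncomputable section

/-- `f` has degree at most `δ`: it is a `k`-linear combination of products of at most `δ`
generators. -/
def DegLE {k : Type*} [CommRing k] {g : ℕ} (f : FreeAlgebra k (Fin g)) (δ : ℕ) : Prop :=
  f ∈ Submodule.span k {w : FreeAlgebra k (Fin g) |
    ∃ l : List (Fin g), l.length ≤ δ ∧ w = (l.map (FreeAlgebra.ι k)).prod}


open FreeAlgebra in
/-- The coefficients of an element of the free algebra in the basis of words. -/
def wordCoeff {k : Type*} [CommRing k] {g : ℕ} (f : FreeAlgebra k (Fin g)) :
    FreeMonoid (Fin g) →₀ k :=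
  (equivMonoidAlgebraFreeMonoid f).coeff

section wordCoeff

variable {k : Type*} [CommRing k] {g : ℕ}

theorem freeAlgebra_lift_eq_sum {A : Type*} [Ring A] [Algebra k A] (X : Fin g → A)
    (f : FreeAlgebra k (Fin g)) :
    FreeAlgebra.lift k X f = (wordCoeff f).sum fun w c => c • (w.toList.map X).prod := by
  have h := MonoidAlgebra.lift_unique ((FreeAlgebra.lift k X).comp
    (FreeAlgebra.equivMonoidAlgebraFreeMonoid (R := k) (X := Fin g)).symm.toAlgHom)
    (FreeAlgebra.equivMonoidAlgebraFreeMonoid f)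
  have h' : ∀ w : FreeMonoid (Fin g), FreeAlgebra.lift k X
      ((FreeAlgebra.equivMonoidAlgebraFreeMonoid (R := k) (X := Fin g)).symm
        (MonoidAlgebra.single w 1)) = (w.toList.map X).prod := by
    intro w
    simp [FreeAlgebra.equivMonoidAlgebraFreeMonoid, FreeMonoid.lift_apply, map_list_prod,
      Function.comp_def]
  simpa [h', wordCoeff] using h

theorem isConstant_of_wordCoeff (f : FreeAlgebra k (Fin g))
    (h : ∀ w ∈ (wordCoeff f).support, w = 1) : IsConstant f := by
  refine ⟨wordCoeff f 1, ?_⟩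
  have hf := freeAlgebra_lift_eq_sum (FreeAlgebra.ι k) f
  have hid : FreeAlgebra.lift k (FreeAlgebra.ι k) = AlgHom.id k (FreeAlgebra k (Fin g)) := by
    ext; simp
  rw [hid, Finsupp.sum, Finset.sum_subset (s₂ := {1}) (fun w hw => by simp [h w hw])] at hf
  · simpa [Algebra.algebraMap_eq_smul_one] using hf
  · intro w _ hw
    rw [Finsupp.notMem_support_iff.1 hw, zero_smul]

theorem length_le_of_mem_support {f : FreeAlgebra k (Fin g)} {δ : ℕ} (hf : DegLE f δ)
    {w : FreeMonoid (Fin g)} (hw : w ∈ (wordCoeff f).support) : w.length ≤ δ := by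
  rw [Finsupp.mem_support_iff] at hw
  contrapose! hw
  induction hf using Submodule.span_induction with
  | mem x hx =>
    obtain ⟨l, hl, rfl⟩ := hx
    have : FreeAlgebra.equivMonoidAlgebraFreeMonoid ((l.map (FreeAlgebra.ι k)).prod) =
        MonoidAlgebra.of k _ (FreeMonoid.ofList l) := by
      induction l with
      | nil => simp; rfl
      | cons a l ih =>
        rw [List.map_cons, List.prod_cons, map_mul, ih (by simp at hl; omega),
          FreeMonoid.ofList_cons, map_mul]
        simp [FreeAlgebra.equivMonoidAlgebraFreeMonoid]
    rw [wordCoeff, this, MonoidAlgebra.of_apply, MonoidAlgebra.coeff_single,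
      Finsupp.single_eq_of_ne]
    rintro rfl
    exact hw.not_ge hl
  | zero => simp [wordCoeff]
  | add x y _ _ hx hy => simp_all [wordCoeff]
  | smul a x _ hx => simp_all [wordCoeff]

theorem exists_length_max {f : FreeAlgebra k (Fin g)} (hf : ¬IsConstant f) :
    ∃ w ∈ (wordCoeff f).support, 1 ≤ w.length ∧
      ∀ w' ∈ (wordCoeff f).support, w'.length ≤ w.length := by
  have h1 : ∃ w ∈ (wordCoeff f).support, w ≠ 1 := by
    contrapose! hf
    exact isConstant_of_wordCoeff f hf
  obtain ⟨w₁, hw₁, hne⟩ := h1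
  obtain ⟨w, hw, hmax⟩ := (wordCoeff f).support.exists_max_image FreeMonoid.length ⟨w₁, hw₁⟩
  refine ⟨w, hw, le_trans ?_ (hmax _ hw₁), hmax⟩
  rw [Nat.one_le_iff_ne_zero]
  exact fun h => hne (FreeMonoid.length_eq_zero.1 h)

theorem exists_length_add_le [NoZeroDivisors k] {u v : FreeAlgebra k (Fin g)} {δ : ℕ}
    (h : DegLE (u * v) δ) (hu : ¬IsConstant u) (hv : ¬IsConstant v) :
    ∃ w ∈ (wordCoeff u).support, ∃ w' ∈ (wordCoeff v).support,
      1 ≤ w.length ∧ 1 ≤ w'.length ∧ w.length + w'.length ≤ δ := by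
  obtain ⟨w, hw, h1, hmax⟩ := exists_length_max hu
  obtain ⟨w', hw', h1', hmax'⟩ := exists_length_max hv
  refine ⟨w, hw, w', hw', h1, h1', ?_⟩
  rw [← FreeMonoid.length_mul]
  apply length_le_of_mem_support h
  have huniq : UniqueMul (wordCoeff u).support (wordCoeff v).support w w' := by
    intro a b ha hb hab
    have hlen := congrArg FreeMonoid.length hab
    rw [FreeMonoid.length_mul, FreeMonoid.length_mul] at hlen
    have := hmax a ha
    have := hmax' b hb
    exact List.append_inj hab (show a.length = w.length by omega)
  rw [Finsupp.mem_support_iff] at hw hw' ⊢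
  rw [wordCoeff, map_mul FreeAlgebra.equivMonoidAlgebraFreeMonoid,
    MonoidAlgebra.coeff_mul_mul_of_uniqueMul huniq]
  exact mul_ne_zero hw hw'

end wordCoeff

section PolynomialMatrix

variable {R : Type*} [CommRing R] {n : ℕ}

theorem coeff_det_of_natDegree_le (M : Matrix (Fin n) (Fin n) (Polynomial R)) (e : ℕ)
    (h : ∀ s t, (M s t).natDegree ≤ e) :
    M.det.coeff (n * e) = (Matrix.of fun s t => (M s t).coeff e).det := by
  rw [Matrix.det_apply, Matrix.det_apply, Polynomial.finsetSum_coeff]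
  refine Finset.sum_congr rfl fun σ _ => ?_
  have := Polynomial.coeff_prod_of_natDegree_le (s := Finset.univ) (fun i => M (σ i) i) e
    fun i _ => h _ _
  rw [Finset.card_univ, Fintype.card_fin] at this
  rw [Polynomial.coeff_smul, this]
  rfl

theorem det_ne_zero_of_shifted_diagonal [IsDomain R] [NeZero n] (L : Matrix (Fin n) (Fin n) R)
    (c : Fin n) (h0 : ∀ s t, L s t ≠ 0 → t = s + c) (h1 : ∀ s, L s (s + c) ≠ 0) : L.det ≠ 0 := by
  have h : L.submatrix id (Equiv.addRight c) = Matrix.diagonal fun s => L s (s + c) := by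
    ext s t
    by_cases hst : s = t
    · subst hst; simp
    · rw [Matrix.diagonal_apply_ne _ hst]
      by_contra hL
      exact hst (add_right_cancel (h0 _ _ hL)).symm
  intro hdet
  have h2 := Matrix.det_permute' (Equiv.addRight c) L
  rw [h, hdet, mul_zero, Matrix.det_diagonal] at h2
  exact Finset.prod_ne_zero_iff.2 (fun s _ => h1 s) h2

/-- If the coefficients of `M` are graded by the cyclic shift and are permuted transitively,
up to injective maps, then `M.det` has positive degree as soon as `M` does. -/
theorem natDegree_det_pos [IsDomain R] [NeZero n] (M : Matrix (Fin n) (Fin n) (Polynomial R))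
    (hgr : ∀ s t e, (M s t).coeff e ≠ 0 → t = s + Fin.ofNat n e)
    (hsh : ∀ s t c e, (M s t).coeff e ≠ 0 → (M (s + c) (t + c)).coeff e ≠ 0)
    {s₀ t₀ : Fin n} {e₀ : ℕ} (he₀ : 1 ≤ e₀) (h₀ : (M s₀ t₀).coeff e₀ ≠ 0) :
    0 < M.det.natDegree := by
  obtain ⟨⟨s, t⟩, -, hmax⟩ := Finset.univ.exists_max_image
    (fun p : Fin n × Fin n => (M p.1 p.2).natDegree) ⟨(s₀, t₀), Finset.mem_univ _⟩
  set e := (M s t).natDegree with he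
  have hle : ∀ s t, (M s t).natDegree ≤ e := fun s t => hmax (s, t) (Finset.mem_univ _)
  have he1 : 1 ≤ e := he₀.trans ((Polynomial.le_natDegree_of_ne_zero h₀).trans (hle _ _))
  have hlead : (M s t).coeff e ≠ 0 := by
    intro h
    have : M s t = 0 := Polynomial.leadingCoeff_eq_zero.1 h
    rw [this, Polynomial.natDegree_zero] at he
    omega
  have hdet : (Matrix.of fun s t => (M s t).coeff e).det ≠ 0 := by
    refine det_ne_zero_of_shifted_diagonal _ (Fin.ofNat n e) (fun s t => hgr s t e) fun r => ?_
    have := hsh s t (r - s) e hlead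
    rw [hgr s t e hlead, add_right_comm, add_sub_cancel] at this
    exact this
  rw [← coeff_det_of_natDegree_le M e hle] at hdet
  exact lt_of_lt_of_le (Nat.mul_pos (NeZero.pos n) he1) (Polynomial.le_natDegree_of_ne_zero hdet)

end PolynomialMatrix

section CyclicMatrices

/-- The variables `a_{j,s}` (third component `false`) and `b_{j,s}` (third component `true`). -/
abbrev CyclicVar (g n : ℕ) : Type := Fin g × Fin n × Bool

theorem coeff_one_apply_eq_zero {k : Type*} [CommRing k] {g n : ℕ} {m : CyclicVar g n →₀ ℕ}
    (hm : m ≠ 0) (s t : Fin n) (e : ℕ) :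
    coeff m (((1 : Matrix (Fin n) (Fin n)
      (Polynomial (MvPolynomial (CyclicVar g n) k))) s t).coeff e) = 0 := by
  rw [Matrix.one_apply]
  split_ifs
  · rw [Polynomial.coeff_one]
    split_ifs
    · rw [MvPolynomial.coeff_one, if_neg hm.symm]
    · simp
  · simp

/-- The matrices `diag(a_{j,s})_s + T • diag(b_{j,s})_s P`, where `P` is the cyclic shift. -/
def cyclicMatrix (k : Type*) [CommRing k] (g n : ℕ) [NeZero n] (j : Fin g) :
    Matrix (Fin n) (Fin n) (Polynomial (MvPolynomial (CyclicVar g n) k)) :=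
  Matrix.of fun s t =>
    (if s = t then Polynomial.C (X (j, s, false)) else 0) +
      if s + 1 = t then Polynomial.X * Polynomial.C (X (j, s, true)) else 0

variable {k : Type*} [CommRing k] {g n : ℕ} [NeZero n]

theorem cyclicMatrix_mul_apply (j : Fin g)
    (Z : Matrix (Fin n) (Fin n) (Polynomial (MvPolynomial (CyclicVar g n) k))) (s t : Fin n) :
    (cyclicMatrix k g n j * Z) s t = Polynomial.C (X (j, s, false)) * Z s t +
      Polynomial.X * Polynomial.C (X (j, s, true)) * Z (s + 1) t := by
  simp [Matrix.mul_apply, cyclicMatrix, add_mul, Finset.sum_add_distrib]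

theorem coeff_cyclicMatrix_mul_zero (j : Fin g)
    (Z : Matrix (Fin n) (Fin n) (Polynomial (MvPolynomial (CyclicVar g n) k))) (s t : Fin n) :
    ((cyclicMatrix k g n j * Z) s t).coeff 0 = X (j, s, false) * (Z s t).coeff 0 := by
  simp [cyclicMatrix_mul_apply, mul_assoc]

theorem coeff_cyclicMatrix_mul_succ (j : Fin g)
    (Z : Matrix (Fin n) (Fin n) (Polynomial (MvPolynomial (CyclicVar g n) k))) (s t : Fin n)
    (e : ℕ) :
    ((cyclicMatrix k g n j * Z) s t).coeff (e + 1) =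
      X (j, s, false) * (Z s t).coeff (e + 1) + X (j, s, true) * (Z (s + 1) t).coeff e := by
  simp [cyclicMatrix_mul_apply, mul_assoc]

theorem eq_add_of_coeff_lift_cyclicMatrix_ne_zero (u : FreeAlgebra k (Fin g)) :
    ∀ s t e, ((FreeAlgebra.lift k (cyclicMatrix k g n) u) s t).coeff e ≠ 0 →
      t = s + Fin.ofNat n e := by
  induction u using FreeAlgebra.induction with
  | grade0 r =>
    intro s t e h
    rw [AlgHom.commutes, Matrix.algebraMap_matrix_apply] at h
    split_ifs at h with hst
    · subst hst
      rw [Polynomial.algebraMap_apply, Polynomial.coeff_C] at h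
      split_ifs at h with he
      · subst he
        exact (add_zero s).symm
      · exact absurd rfl h
    · simp at h
  | grade1 j =>
    intro s t e h
    rw [FreeAlgebra.lift_ι_apply, cyclicMatrix, Matrix.of_apply, Polynomial.coeff_add] at h
    rcases e with _ | _ | e
    · by_contra hst
      replace hst : s ≠ t := fun h' => hst (h'.symm.trans (add_zero s).symm)
      rw [if_neg hst] at h
      split_ifs at h <;> simp at h
    · by_contra hst
      replace hst : s + 1 ≠ t := fun h' => hst h'.symm
      rw [if_neg hst] at h
      split_ifs at h <;> simp at h
    · have h₁ : (Polynomial.X * Polynomial.C (X (R := k) (j, s, true))).coeff (e + 1 + 1) = 0 := by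
        rw [Polynomial.coeff_X_mul, Polynomial.coeff_C_succ]
      split_ifs at h <;> simp [h₁, -Polynomial.X_mul_C] at h
  | mul a b ha hb =>
    intro s t e h
    rw [map_mul, Matrix.mul_apply, Polynomial.finsetSum_coeff] at h
    obtain ⟨r, -, hr⟩ := Finset.exists_ne_zero_of_sum_ne_zero h
    rw [Polynomial.coeff_mul] at hr
    obtain ⟨⟨i, j⟩, hij, hne⟩ := Finset.exists_ne_zero_of_sum_ne_zero hr
    rw [Finset.HasAntidiagonal.mem_antidiagonal] at hij
    rw [hb r t j (right_ne_zero_of_mul hne), ha s r i (left_ne_zero_of_mul hne), add_assoc, ← hij]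
    congr 1
    ext
    simp [Fin.val_add]
  | add a b ha hb =>
    intro s t e h
    rw [map_add, Matrix.add_apply, Polynomial.coeff_add] at h
    by_cases h' : ((FreeAlgebra.lift k (cyclicMatrix k g n) a) s t).coeff e = 0
    · rw [h', zero_add] at h
      exact hb s t e h
    · exact ha s t e h'

/-- The cyclic shift of the variables by `c`. -/
def shiftVar (g : ℕ) {n : ℕ} [NeZero n] (c : Fin n) (p : CyclicVar g n) : CyclicVar g n :=
  (p.1, p.2.1 + c, p.2.2)

theorem shiftVar_injective (c : Fin n) : Function.Injective (shiftVar g c) := by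
  rintro ⟨j, s, x⟩ ⟨j', s', x'⟩ h
  simpa [shiftVar] using h

theorem lift_cyclicMatrix_shift (u : FreeAlgebra k (Fin g)) (s t c : Fin n) :
    (FreeAlgebra.lift k (cyclicMatrix k g n) u) (s + c) (t + c) =
      ((FreeAlgebra.lift k (cyclicMatrix k g n) u) s t).map
        (rename (R := k) (shiftVar g c)).toRingHom := by
  have h : ((Matrix.reindexAlgEquiv k (Polynomial (MvPolynomial (CyclicVar g n) k))
        (Equiv.addRight c).symm).toAlgHom).comp (FreeAlgebra.lift k (cyclicMatrix k g n)) =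
      (Polynomial.mapAlgHom (rename (R := k) (shiftVar g c))).mapMatrix.comp
        (FreeAlgebra.lift k (cyclicMatrix k g n)) := by
    refine FreeAlgebra.hom_ext (funext fun j => Matrix.ext fun s t => ?_)
    simp only [AlgHom.coe_comp, Function.comp_apply, FreeAlgebra.lift_ι_apply]
    change cyclicMatrix k g n j (s + c) (t + c) =
      (cyclicMatrix k g n j s t).map (rename (R := k) (shiftVar g c)).toRingHom
    simp only [cyclicMatrix, Matrix.of_apply, add_right_comm s c 1, add_left_inj]
    split_ifs <;> simp [shiftVar]
  have := congrFun (congrFun (DFunLike.congr_fun h u) s) t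
  simpa using this

theorem coeff_lift_cyclicMatrix_shift_ne_zero (u : FreeAlgebra k (Fin g)) (s t c : Fin n) (e : ℕ)
    (h : ((FreeAlgebra.lift k (cyclicMatrix k g n) u) s t).coeff e ≠ 0) :
    ((FreeAlgebra.lift k (cyclicMatrix k g n) u) (s + c) (t + c)).coeff e ≠ 0 := by
  rw [lift_cyclicMatrix_shift, Polynomial.coeff_map]
  exact fun h' => h ((map_eq_zero_iff _ (rename_injective _ (shiftVar_injective c))).1 h')

/-- A monomial that contains some `a_{j,v}` but none of the `b_{j,v-1}` does not occur in the
rows of a word other than the row `v`. -/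
theorem coeff_word_eq_zero {v : Fin n} {j : Fin g} (w : List (Fin g)) :
    ∀ (m : CyclicVar g n →₀ ℕ) (s t : Fin n) (e : ℕ), m (j, v, false) ≠ 0 →
      (∀ i r, r + 1 = v → m (i, r, true) = 0) → s ≠ v →
      coeff m (((w.map (cyclicMatrix k g n)).prod s t).coeff e) = 0 := by
  induction w with
  | nil =>
    intro m s t e hm _ _
    exact coeff_one_apply_eq_zero (fun h => hm (by simp [h])) s t e
  | cons i w ih =>
    intro m s t e hm hb hs
    have ha : coeff m (X (i, s, false) *
        ((w.map (cyclicMatrix k g n)).prod s t).coeff e) = 0 := by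
      rw [coeff_X_mul']
      split_ifs
      · refine ih _ _ _ _ ?_ (fun i' r hr => by simp [hb i' r hr]) hs
        simpa [Finsupp.single_apply, hs] using hm
      · rfl
    rw [List.map_cons, List.prod_cons]
    cases e with
    | zero => rw [coeff_cyclicMatrix_mul_zero, ha]
    | succ e =>
      rw [coeff_cyclicMatrix_mul_succ, coeff_add, ha, zero_add, coeff_X_mul']
      split_ifs with hmem
      · refine ih _ _ _ _ ?_ (fun i' r hr => by simp [hb i' r hr]) fun hv => ?_
        · simpa [Finsupp.single_apply] using hm
        · exact Finsupp.mem_support_iff.1 hmem (hb i s hv)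
      · rfl

/-- The monomial of the path that starts at the vertex `s`, follows the word `w`, and uses
alternately arrows `b_{j,i} : i → i + 1` and loops `a_{j,i}`, beginning with an arrow if the flag
is `true` and with a loop otherwise. -/
def pathMon (g n : ℕ) [NeZero n] : ℕ → Bool → List (Fin g) → (CyclicVar g n →₀ ℕ)
  | _, _, [] => 0
  | s, true, j :: w => Finsupp.single (j, Fin.ofNat n s, true) 1 + pathMon g n (s + 1) false w
  | s, false, j :: w => Finsupp.single (j, Fin.ofNat n s, false) 1 + pathMon g n s true w

/-- The number of arrows in an alternating path along a word. -/
def pathDeg {g : ℕ} : Bool → List (Fin g) → ℕ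
  | _, [] => 0
  | true, _ :: w => pathDeg false w + 1
  | false, _ :: w => pathDeg true w

theorem le_of_pathMon_ne_zero (w : List (Fin g)) : ∀ (s : ℕ) (x : Bool),
    w.length + 2 * s + x.toNat ≤ 2 * n → ∀ j (i : Fin n) y, pathMon g n s x w (j, i, y) ≠ 0 →
      s ≤ i ∧ (x = true → y = false → s < i) := by
  induction w with
  | nil => intro s x _ j i y h; simp [pathMon] at h
  | cons l w ih =>
    intro s x hx j i y h
    have hs : s % n = s := Nat.mod_eq_of_lt (by simp at hx; omega)
    cases x with
    | true =>
      rw [List.length_cons, Bool.toNat_true] at hx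
      by_cases h' : pathMon g n (s + 1) false w (j, i, y) = 0
      · rw [pathMon, Finsupp.add_apply, h', add_zero, Finsupp.single_apply] at h
        split_ifs at h with heq
        · simp only [Prod.mk.injEq] at heq
          obtain ⟨-, rfl, rfl⟩ := heq
          simp [hs]
        · exact absurd rfl h
      · have := (ih (s + 1) false (by simp; omega) j i y h').1
        exact ⟨by omega, fun _ _ => by omega⟩
    | false =>
      rw [List.length_cons, Bool.toNat_false] at hx
      refine ⟨?_, fun h => by simp at h⟩
      by_cases h' : pathMon g n s true w (j, i, y) = 0
      · rw [pathMon, Finsupp.add_apply, h', add_zero, Finsupp.single_apply] at h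
        split_ifs at h with heq
        · simp only [Prod.mk.injEq] at heq
          obtain ⟨-, rfl, rfl⟩ := heq
          simp [hs]
        · exact absurd rfl h
      · exact (ih s true (by simp; omega) j i y h').1

theorem coeff_single_add_X_mul {σ : Type*} [DecidableEq σ] (i i' : σ) (m : σ →₀ ℕ)
    (h : m i' = 0) (p : MvPolynomial σ k) :
    coeff (Finsupp.single i 1 + m) (X i' * p) = if i = i' then coeff m p else 0 := by
  split_ifs with hi
  · subst hi
    exact coeff_X_mul m i p
  · rw [coeff_X_mul', if_neg]
    simp [h, hi]

theorem pathMon_apply_eq_zero {s : ℕ} {x : Bool} {w : List (Fin g)}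
    (hx : w.length + 2 * s + x.toNat ≤ 2 * n) {j : Fin g} {i : Fin n} {y : Bool}
    (h : s ≤ i → ¬(x = true → y = false → s < i)) : pathMon g n s x w (j, i, y) = 0 := by
  by_contra h'
  have := le_of_pathMon_ne_zero w s x hx j i y h'
  exact h this.1 this.2

theorem coeff_word_pathMon (w : List (Fin g)) : ∀ (s : ℕ) (x : Bool),
    w.length + 2 * s + x.toNat ≤ 2 * n → (x = false → 1 ≤ s) → ∃ t : Fin n, ∀ w' : List (Fin g),
      coeff (pathMon g n s x w)
        (((w'.map (cyclicMatrix k g n)).prod (Fin.ofNat n s) t).coeff (pathDeg x w)) =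
      if w = w' then 1 else 0 := by
  induction w with
  | nil =>
    intro s x _ _
    refine ⟨Fin.ofNat n s, fun w' => ?_⟩
    cases w' with
    | nil => simp [pathMon, pathDeg]
    | cons j' w' =>
      rw [List.map_cons, List.prod_cons, pathDeg, coeff_cyclicMatrix_mul_zero, pathMon]
      simp [coeff_X_mul']
  | cons j w ih =>
    intro s x hx hs
    rw [List.length_cons] at hx
    have hlt : s < n := by omega
    have hmod : s % n = s := Nat.mod_eq_of_lt hlt
    have hval : (Fin.ofNat n s).val = s := hmod
    have hsucc : Fin.ofNat n s + 1 = Fin.ofNat n (s + 1) := by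
      ext; simp [Fin.val_add]
    cases x with
    | true =>
      rw [Bool.toNat_true] at hx
      have hlen : w.length + 2 * (s + 1) + false.toNat ≤ 2 * n := by simp; omega
      obtain ⟨t, ht⟩ := ih (s + 1) false hlen (by simp)
      refine ⟨t, fun w' => ?_⟩
      cases w' with
      | nil =>
        rw [if_neg (by simp)]
        refine coeff_one_apply_eq_zero (fun h => ?_) _ _ _
        simpa [pathMon] using DFunLike.congr_fun h (j, Fin.ofNat n s, true)
      | cons j' w' =>
        rw [List.map_cons, List.prod_cons, pathDeg, coeff_cyclicMatrix_mul_succ, coeff_add,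
          pathMon, coeff_single_add_X_mul _ _ _
            (pathMon_apply_eq_zero hlen (by simp [hmod])), if_neg (by simp), zero_add,
          coeff_single_add_X_mul _ _ _
            (pathMon_apply_eq_zero hlen (by simp [hmod])), hsucc, ht]
        by_cases hj : j = j' <;> simp [hj]
    | false =>
      rw [Bool.toNat_false] at hx
      have hs1 := hs rfl
      have hlen : w.length + 2 * s + true.toNat ≤ 2 * n := by simp; omega
      obtain ⟨t, ht⟩ := ih s true hlen (by simp)
      refine ⟨t, fun w' => ?_⟩
      cases w' with
      | nil =>
        rw [if_neg (by simp)]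
        refine coeff_one_apply_eq_zero (fun h => ?_) _ _ _
        simpa [pathMon] using DFunLike.congr_fun h (j, Fin.ofNat n s, false)
      | cons j' w' =>
        have hloop : ∀ e, e = pathDeg true w → coeff (pathMon g n s false (j :: w))
            (X (j', Fin.ofNat n s, false) *
              ((w'.map (cyclicMatrix k g n)).prod (Fin.ofNat n s) t).coeff e) =
            if j :: w = j' :: w' then 1 else 0 := by
          rintro e rfl
          rw [pathMon, coeff_single_add_X_mul _ _ _
            (pathMon_apply_eq_zero hlen (by simp [hmod])), ht]
          by_cases hj : j = j' <;> simp [hj]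
        have harrow : ∀ e, coeff (pathMon g n s false (j :: w)) (X (j', Fin.ofNat n s, true) *
            ((w'.map (cyclicMatrix k g n)).prod (Fin.ofNat n s + 1) t).coeff e) = 0 := by
          intro e
          rw [coeff_X_mul']
          split_ifs
          · refine coeff_word_eq_zero (v := Fin.ofNat n s) (j := j) w' _ _ _ _ ?_ ?_ ?_
            · simp [pathMon]
            · intro i r hr
              have hr' : r.val + 1 = s := by
                have hv : (r + 1).val = (r.val + 1) % n := by simp [Fin.val_add]
                rw [hr, hval] at hv
                rcases Nat.lt_or_ge (r.val + 1) n with h | h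
                · rw [hv, Nat.mod_eq_of_lt h]
                · rw [show r.val + 1 = n by omega, Nat.mod_self] at hv
                  omega
              have h0 : pathMon g n s true w (i, r, true) = 0 :=
                pathMon_apply_eq_zero hlen (by omega)
              simp [pathMon, h0]
            · intro h
              rw [hsucc] at h
              have hv : (s + 1) % n = s := (congrArg Fin.val h).trans hval
              rcases Nat.lt_or_ge (s + 1) n with h | h
              · rw [Nat.mod_eq_of_lt h] at hv
                omega
              · rw [show s + 1 = n by omega, Nat.mod_self] at hv
                omega
          · rfl
        rw [List.map_cons, List.prod_cons]
        change coeff _ (Polynomial.coeff _ (pathDeg true w)) = _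
        rcases hd : pathDeg true w with _ | e
        · rw [coeff_cyclicMatrix_mul_zero, hloop _ hd.symm]
        · rw [coeff_cyclicMatrix_mul_succ, coeff_add, hloop _ hd.symm, harrow, add_zero]

theorem natDegree_det_lift_cyclicMatrix_pos [IsDomain k] (u : FreeAlgebra k (Fin g))
    {w : FreeMonoid (Fin g)} (hw : w ∈ (wordCoeff u).support) (h1 : 1 ≤ w.length)
    (hn : w.length + 1 ≤ 2 * n) :
    0 < (FreeAlgebra.lift k (cyclicMatrix k g n) u).det.natDegree := by
  obtain ⟨t, ht⟩ := coeff_word_pathMon (k := k) (n := n) w.toList 0 true hn (by simp)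
  have hdeg : 1 ≤ pathDeg true w.toList := by
    cases hl : w.toList with
    | nil => simp [FreeMonoid.length, hl] at h1
    | cons j l => simp [pathDeg]
  refine natDegree_det_pos _ (eq_add_of_coeff_lift_cyclicMatrix_ne_zero u)
    (coeff_lift_cyclicMatrix_shift_ne_zero u) (s₀ := Fin.ofNat n 0) (t₀ := t) hdeg fun h => ?_
  have h2 := congrArg (coeff (pathMon g n 0 true w.toList)) h
  rw [freeAlgebra_lift_eq_sum, Finsupp.sum, Matrix.sum_apply, Polynomial.finsetSum_coeff,
    coeff_sum, coeff_zero] at h2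
  simp only [Matrix.smul_apply, Polynomial.coeff_smul, coeff_smul, ht] at h2
  rw [Finset.sum_eq_single_of_mem w hw] at h2
  · simp at h2
    simp [h2] at hw
  · intro w' _ hne
    rw [if_neg (fun h => hne (FreeMonoid.toList.injective h).symm), smul_zero]

end CyclicMatrices

/-- The determinant of a nonconstant polynomial with a short word in its support is not a unit
when evaluated at generic matrices. -/
theorem not_isUnit_det_genX {k : Type*} [Field k] {g n : ℕ} (u : FreeAlgebra k (Fin g))
    {w : FreeMonoid (Fin g)} (hw : w ∈ (wordCoeff u).support) (h1 : 1 ≤ w.length)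
    (hn : w.length + 1 ≤ 2 * n) : ¬IsUnit (scalarEval u (genX k g n)).det := by
  intro hunit
  have : NeZero n := ⟨by omega⟩
  have hpos := natDegree_det_lift_cyclicMatrix_pos u hw h1 hn
  let φ : MvPolynomial (Fin g × Fin n × Fin n) k →ₐ[k]
      Polynomial (MvPolynomial (CyclicVar g n) k) :=
    aeval fun p => cyclicMatrix k g n p.1 p.2.1 p.2.2
  have hφ : φ.mapMatrix.comp (FreeAlgebra.lift k (genX k g n)) =
      FreeAlgebra.lift k (cyclicMatrix k g n) := by
    ext j s t : 4
    simp [φ, genX]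
  have hdet : φ (scalarEval u (genX k g n)).det =
      (FreeAlgebra.lift k (cyclicMatrix k g n) u).det := by
    rw [AlgHom.map_det, ← hφ]
    rfl
  rw [← hdet, Polynomial.natDegree_eq_zero_of_isUnit (hunit.map φ)] at hpos
  exact lt_irrefl _ hpos

/-- If `f ∈ k⟨x⟩` has degree `δ ≥ 2` and constant term `1`, and `det f(gX⁽ⁿ⁾)` is irreducible
for some `n ≥ ⌈δ/2⌉`, then `f` is an atom. -/
theorem atom_of_det_genericMatrices_irreducible
    {k : Type*} [Field k] [IsAlgClosed k] [CharZero k] {g : ℕ}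
    (f : FreeAlgebra k (Fin g)) (δ : ℕ) (hδ : 2 ≤ δ)
    (hdeg : DegLE f δ) (hdeg' : ¬DegLE f (δ - 1))
    (h0 : FreeAlgebra.lift k (fun _ : Fin g => (0 : k)) f = 1)
    (n : ℕ) (hn : (δ + 1) / 2 ≤ n)
    (hirr : Irreducible (scalarEval f (genX k g n)).det) :
    ScalarAtom f := by
  refine ⟨?_, fun u v huv => ?_⟩
  · rintro ⟨c, rfl⟩
    refine hdeg' ?_
    rw [DegLE, Algebra.algebraMap_eq_smul_one]
    exact Submodule.smul_mem _ _ (Submodule.subset_span ⟨[], by simp, by simp⟩)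
  · by_contra! h
    subst huv
    obtain ⟨w, hw, w', hw', h1, h1', hle⟩ := exists_length_add_le hdeg h.1 h.2
    have hmul : (scalarEval (u * v) (genX k g n)).det =
        (scalarEval u (genX k g n)).det * (scalarEval v (genX k g n)).det := by
      rw [scalarEval, map_mul, Matrix.det_mul]
      rfl
    rcases hirr.isUnit_or_isUnit hmul with hu | hv
    · exact not_isUnit_det_genX u hw h1 (by omega) hu
    · exact not_isUnit_det_genX v hw' h1' (by omega) hv
end
end
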